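/- Let 0.046 ≤ p < 1/2 and define h(x) = −x log₂ x − (1−x) log₂(1−x), D(x‖y) = x log₂(x/y) + (1−x) log₂((1−x)/(1−y)), ρ₀ = √p/(√p + √(1−p)), ω₀ = 2ρ₀(1−ρ₀), R_crit = 1 − h(ρ₀), and R₁ = h( 1/2 − √(ω₀(1−ω₀)) ). Then for every rate R with R₁ ≤ R ≤ R_crit, the reliability function of the BSC satisfies E(R, p) = D(ρ₀‖p) + R_crit − R. -/

import Mathlib

open Finset Filter

/-- The binary entropy function `h(x) = −x log₂ x − (1−x) log₂(1−x)`. -/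
noncomputable def binEnt (x : ℝ) : ℝ :=
  -x * Real.logb 2 x - (1 - x) * Real.logb 2 (1 - x)

/-- The binary Kullback–Leibler divergence
`D(x‖y) = x log₂(x/y) + (1−x) log₂((1−x)/(1−y))`. -/
noncomputable def binKL (x y : ℝ) : ℝ :=
  x * Real.logb 2 (x / y) + (1 - x) * Real.logb 2 ((1 - x) / (1 - y))

/-- `ρ₀ = √p / (√p + √(1−p))`. -/
noncomputable def rho0 (p : ℝ) : ℝ := Real.sqrt p / (Real.sqrt p + Real.sqrt (1 - p))

/-- `ω₀ = 2ρ₀(1−ρ₀)`. -/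
noncomputable def omega0 (p : ℝ) : ℝ := 2 * rho0 p * (1 - rho0 p)

/-- The critical rate `R_crit = 1 − h(ρ₀)`. -/
noncomputable def Rcrit (p : ℝ) : ℝ := 1 - binEnt (rho0 p)

/-- The tangency rate `R₁ = h(1/2 − √(ω₀(1−ω₀)))`. -/
noncomputable def R1 (p : ℝ) : ℝ :=
  binEnt (1 / 2 - Real.sqrt (omega0 p * (1 - omega0 p)))

/-- BSC transition probabilities `P(y|x) = p^{d(x,y)} (1-p)^{n-d(x,y)}`. -/
noncomputable def bscProb (n : ℕ) (p : ℝ) (x y : Fin n → Bool) : ℝ :=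
  p ^ hammingDist x y * (1 - p) ^ (n - hammingDist x y)

/-- The (average) maximum-likelihood decoding error probability of a code `C`:
the minimum over all decoding maps `dec : X → C` of
`(1/|C|) ∑_{x ∈ C} ∑_{y : dec y ≠ x} P(y|x)`. -/
noncomputable def PeCode (n : ℕ) (p : ℝ) (C : Finset (Fin n → Bool)) : ℝ :=
  sInf {e : ℝ | ∃ dec : (Fin n → Bool) → (Fin n → Bool), (∀ y, dec y ∈ C) ∧
    e = (C.card : ℝ)⁻¹ * ∑ x ∈ C,
      ∑ y ∈ Finset.univ.filter (fun y => dec y ≠ x), bscProb n p x y}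

/-- The reliability function of the BSC:
`E(R,p) = limsup_{n→∞} max_{C ⊆ {0,1}ⁿ, |C| ≥ 2^{Rn}} (1/n) log₂ (1/P_e(C,p))`. -/
noncomputable def reliability (p R : ℝ) : ℝ :=
  limsup (fun n : ℕ =>
    sSup {e : ℝ | ∃ C : Finset (Fin n → Bool),
      (2 : ℝ) ^ (R * n) ≤ (C.card : ℝ) ∧
      e = (n : ℝ)⁻¹ * Real.logb 2 (1 / PeCode n p C)}) atTop

/-- The character `χ_z(x) = (-1)^{|z ∩ x|}` of the group of subsets of `β`. -/
def chi {β : Type*} [Fintype β] [DecidableEq β] (z x : Finset β) : ℝ :=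
  ∏ a, if a ∈ z ∧ a ∈ x then -1 else 1

lemma sum_prod_subset {β : Type*} [Fintype β] (φ : β → ℝ) :
    ∑ E : Finset β, ∏ a ∈ E, φ a = ∏ a, (1 + φ a) := by
  classical
  rw [Finset.prod_one_add, Finset.powerset_univ]

section Characters

variable {β : Type*} [Fintype β] [DecidableEq β]

lemma chi_comm (z x : Finset β) : chi z x = chi x z := by
  simp only [chi, and_comm]

lemma chi_symmDiff_right (z x y : Finset β) : chi z (symmDiff x y) = chi z x * chi z y := by
  simp only [chi, ← Finset.prod_mul_distrib]
  refine Finset.prod_congr rfl fun a _ => ?_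
  by_cases hz : a ∈ z <;> by_cases hx : a ∈ x <;> by_cases hy : a ∈ y <;>
    simp [Finset.mem_symmDiff, hz, hx, hy]

lemma chi_symmDiff_left (z w x : Finset β) : chi (symmDiff z w) x = chi z x * chi w x := by
  rw [chi_comm, chi_symmDiff_right, chi_comm x, chi_comm x]

lemma chi_mul_self (z x : Finset β) : chi z x * chi z x = 1 := by
  rw [← chi_symmDiff_right, symmDiff_self]
  simp [chi]

lemma chi_eq_prod (z x : Finset β) : chi z x = ∏ a ∈ z, if a ∈ x then (-1 : ℝ) else 1 := by
  rw [chi, ← Finset.prod_filter_mul_prod_filter_not univ (· ∈ z)]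
  rw [Finset.prod_congr (g := fun a => if a ∈ x then (-1 : ℝ) else 1) rfl
    (by intro a ha; simp only [mem_filter] at ha; simp [ha.2])]
  rw [Finset.prod_eq_one (s := univ.filter (fun a => ¬ a ∈ z))
    (by intro a ha; simp only [mem_filter] at ha; simp [ha.2])]
  simp

lemma sum_chi (z : Finset β) :
    ∑ x, chi z x = if z = ∅ then (2 : ℝ) ^ Fintype.card β else 0 := by
  simp_rw [chi_comm z, chi_eq_prod]
  rw [sum_prod_subset]
  split_ifs with h
  · subst h
    simp [Finset.card_univ]
    norm_num
  · obtain ⟨a, ha⟩ := Finset.nonempty_iff_ne_empty.mpr h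
    exact Finset.prod_eq_zero (mem_univ a) (by simp [ha])

lemma sum_chi_singleton (x : Finset β) :
    ∑ a, chi {a} x = (Fintype.card β : ℝ) - 2 * x.card := by
  have h : ∀ a, chi {a} x = 1 - 2 * (if a ∈ x then (1 : ℝ) else 0) := by
    intro a
    rw [chi_eq_prod, Finset.prod_singleton]
    split_ifs <;> norm_num
  simp_rw [h, Finset.sum_sub_distrib, ← Finset.mul_sum]
  simp [Finset.card_univ]

/-- The Walsh–Fourier transform of a function on subsets. -/
def walsh (f : Finset β → ℝ) (x : Finset β) : ℝ := ∑ z, f z * chi z x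

lemma parseval (f : Finset β → ℝ) :
    ∑ x, walsh f x ^ 2 = 2 ^ Fintype.card β * ∑ z, f z ^ 2 := by
  have h : ∀ x, walsh f x ^ 2 = ∑ z, ∑ w, f z * f w * chi (symmDiff z w) x := by
    intro x
    rw [sq, walsh, Finset.sum_mul_sum]
    refine sum_congr rfl fun z _ => sum_congr rfl fun w _ => ?_
    rw [chi_symmDiff_left]; ring
  simp_rw [h]
  rw [sum_comm]
  rw [Finset.mul_sum]
  refine sum_congr rfl fun z _ => ?_
  rw [sum_comm]
  simp_rw [← Finset.mul_sum, sum_chi]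
  rw [Finset.sum_eq_single z]
  · simp; ring
  · intro w _ hw
    have : symmDiff z w ≠ ∅ := by
      intro h0
      exact hw (symmDiff_eq_bot.mp h0).symm
    simp [this]
  · simp

/-- Delsarte's inequality for the kernel `(n - 2|x| - l) f̂(x)²`. -/
lemma delsarte_ineq {κ : Type*} (J : Finset κ) (x : κ → Finset β) (f : Finset β → ℝ)
    (hf : ∀ z, 0 ≤ f z) (l l' : ℝ) (hl : l' ≤ l)
    (hA : ∀ z, l * f z ≤ ∑ a, f (symmDiff z {a})) :
    (l - l') * (∑ z, f z ^ 2) * (J.card : ℝ) ^ 2 ≤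
      ∑ i ∈ J, ∑ j ∈ J, ((Fintype.card β : ℝ) - 2 * (symmDiff (x i) (x j)).card - l') *
        walsh f (symmDiff (x i) (x j)) ^ 2 := by
  set d : Finset β → ℝ := fun z => ∑ a, f (symmDiff z {a}) - l' * f z with hd
  have hdf : ∀ z, (l - l') * f z ≤ d z := fun z => by
    have := hA z
    simp only [hd]; linarith
  have hd0 : ∀ z, 0 ≤ d z := fun z =>
    le_trans (mul_nonneg (sub_nonneg.mpr hl) (hf z)) (hdf z)
  have key : ∀ y, ((Fintype.card β : ℝ) - 2 * y.card - l') * walsh f y ^ 2 =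
      ∑ z, ∑ w, d z * f w * (chi z y * chi w y) := by
    intro y
    have h1 : ((Fintype.card β : ℝ) - 2 * y.card) * walsh f y =
        ∑ z, (∑ a, f (symmDiff z {a})) * chi z y := by
      rw [← sum_chi_singleton, walsh, Finset.sum_mul_sum]
      simp_rw [Finset.sum_mul]
      rw [Finset.sum_comm (s := univ) (t := univ) (f := fun z a => f (symmDiff z {a}) * chi z y)]
      refine sum_congr rfl fun a _ => ?_
      refine Fintype.sum_equiv (Equiv.ofBijective (fun z => symmDiff z {a})
        (symmDiff_left_involutive {a}).bijective) _ _ fun z => ?_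
      simp only [Equiv.ofBijective_apply, symmDiff_symmDiff_cancel_right, chi_symmDiff_left]
      ring
    have h2 : ((Fintype.card β : ℝ) - 2 * y.card - l') * walsh f y = ∑ z, d z * chi z y := by
      rw [sub_mul, h1, walsh, Finset.mul_sum, ← Finset.sum_sub_distrib]
      refine sum_congr rfl fun z _ => ?_
      simp only [hd]; ring
    rw [sq, ← mul_assoc, h2, walsh, Finset.sum_mul_sum]
    refine sum_congr rfl fun z _ => sum_congr rfl fun w _ => ?_
    ring
  have e : ∑ i ∈ J, ∑ j ∈ J, ((Fintype.card β : ℝ) - 2 * (symmDiff (x i) (x j)).card - l') *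
        walsh f (symmDiff (x i) (x j)) ^ 2 =
      ∑ z, ∑ w, d z * f w * (∑ i ∈ J, chi z (x i) * chi w (x i)) ^ 2 := by
    simp_rw [key, sq, Finset.sum_mul_sum]
    simp_rw [Finset.mul_sum]
    rw [Finset.sum_congr rfl (fun i _ => Finset.sum_comm), Finset.sum_comm]
    refine sum_congr rfl fun z _ => ?_
    rw [Finset.sum_congr rfl (fun i _ => Finset.sum_comm), Finset.sum_comm]
    refine sum_congr rfl fun w _ => ?_
    refine sum_congr rfl fun i _ => sum_congr rfl fun j _ => ?_
    rw [chi_symmDiff_right, chi_symmDiff_right]; ring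
  rw [e, Finset.mul_sum, Finset.sum_mul]
  refine Finset.sum_le_sum fun z _ => ?_
  calc (l - l') * f z ^ 2 * (J.card : ℝ) ^ 2
      ≤ d z * f z * (∑ i ∈ J, chi z (x i) * chi z (x i)) ^ 2 := by
        simp_rw [chi_mul_self]
        simp only [sum_const, nsmul_eq_mul, mul_one]
        have := mul_le_mul_of_nonneg_right (hdf z) (hf z)
        refine mul_le_mul_of_nonneg_right ?_ (sq_nonneg _)
        linarith
    _ ≤ _ := Finset.single_le_sum (f := fun w => d z * f w *
          (∑ i ∈ J, chi z (x i) * chi w (x i)) ^ 2)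
          (fun w _ => mul_nonneg (mul_nonneg (hd0 z) (hf w)) (sq_nonneg _)) (mem_univ z)

end Characters

/-- The binary Krawtchouk polynomial of degree `k` at the integer `i`. -/
noncomputable def kraw (n k i : ℕ) : ℝ :=
  (((1 - Polynomial.X) ^ i * (1 + Polynomial.X) ^ (n - i) : Polynomial ℝ)).coeff k

lemma sum_chi_card {β : Type*} [Fintype β] [DecidableEq β] (k : ℕ) (x : Finset β) :
    ∑ z with z.card = k, chi z x = kraw (Fintype.card β) k x.card := by
  have h : ((1 - Polynomial.X) ^ x.card * (1 + Polynomial.X) ^ (Fintype.card β - x.card) :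
      Polynomial ℝ) = ∑ z : Finset β, Polynomial.C (chi z x) * Polynomial.X ^ z.card := by
    have h2 : ∀ z : Finset β, Polynomial.C (chi z x) * Polynomial.X ^ z.card =
        ∏ a ∈ z, (if a ∈ x then (-Polynomial.X : Polynomial ℝ) else Polynomial.X) := by
      intro z
      rw [chi_eq_prod, map_prod, ← Finset.prod_const, ← Finset.prod_mul_distrib]
      refine prod_congr rfl fun a _ => ?_
      split_ifs <;> simp
    simp_rw [h2]
    rw [← Finset.powerset_univ, ← Finset.prod_one_add]
    rw [← Finset.prod_filter_mul_prod_filter_not univ (· ∈ x)]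
    rw [Finset.prod_congr (g := fun _ => (1 - Polynomial.X : Polynomial ℝ)) rfl
      (by intro a ha; simp only [mem_filter] at ha; simp [ha.2, sub_eq_add_neg])]
    rw [Finset.prod_congr (g := fun _ => (1 + Polynomial.X : Polynomial ℝ))
      (s₁ := univ.filter (fun a => ¬ a ∈ x)) rfl
      (by intro a ha; simp only [mem_filter] at ha; simp [ha.2])]
    rw [prod_const, prod_const]
    congr 2
    · simp
    · rw [← Finset.card_compl]
      congr 1; ext a; simp
  rw [kraw, h, Polynomial.finsetSum_coeff, Finset.sum_filter]
  refine sum_congr rfl fun z _ => ?_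
  rw [Polynomial.coeff_C_mul_X_pow]
  simp only [eq_comm]

lemma walsh_radial {β : Type*} [Fintype β] [DecidableEq β] (c : ℕ → ℝ) (x : Finset β) :
    walsh (fun z => c z.card) x =
      ∑ k ∈ range (Fintype.card β + 1), c k * kraw (Fintype.card β) k x.card := by
  rw [walsh, ← Finset.sum_fiberwise_of_maps_to (t := range (Fintype.card β + 1))
    (g := fun z : Finset β => z.card)
    (fun z _ => mem_range.mpr (Nat.lt_succ_of_le (card_le_univ z)))]
  refine sum_congr rfl fun k _ => ?_
  rw [← sum_chi_card, Finset.mul_sum]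
  refine sum_congr rfl fun z hz => ?_
  rw [(mem_filter.mp hz).2]

lemma kraw_zero (n k : ℕ) : kraw n k 0 = n.choose k := by
  simp [kraw, Polynomial.coeff_one_add_X_pow]

lemma coeff_sub_two_X_mul_derivative (P : Polynomial ℝ) (n : ℝ) (k : ℕ) :
    (Polynomial.C n * P - 2 * (Polynomial.X * Polynomial.derivative P)).coeff k =
      (n - 2 * k) * P.coeff k := by
  have : (2 : Polynomial ℝ) = Polynomial.C 2 := (map_ofNat Polynomial.C 2).symm
  rw [this]
  rcases k with _ | k
  · simp
  · simp [Polynomial.coeff_derivative]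
    ring

lemma kraw_rec (j m k : ℕ) :
    ((m : ℝ) + 1) * kraw (j + m + 2) k (j + 2) + ((j : ℝ) + 1) * kraw (j + m + 2) k j =
      ((j + m + 2 : ℕ) - 2 * (k : ℝ)) * kraw (j + m + 2) k (j + 1) := by
  simp only [kraw]
  rw [← coeff_sub_two_X_mul_derivative, ← Polynomial.coeff_C_mul, ← Polynomial.coeff_C_mul,
    ← Polynomial.coeff_add]
  congr 1
  rw [show j + m + 2 - (j + 2) = m by omega, show j + m + 2 - j = m + 2 by omega,
    show j + m + 2 - (j + 1) = m + 1 by omega]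
  simp only [Polynomial.derivative_mul, Polynomial.derivative_pow, map_add, map_natCast, map_one,
    Polynomial.derivative_sub, Polynomial.derivative_one,
    Polynomial.derivative_X, Nat.add_sub_cancel]
  push_cast
  ring

lemma kraw_rec_zero (m k : ℕ) :
    ((m : ℝ) + 1) * kraw (m + 1) k 1 = ((m + 1 : ℕ) - 2 * (k : ℝ)) * kraw (m + 1) k 0 := by
  simp only [kraw]
  rw [← coeff_sub_two_X_mul_derivative, ← Polynomial.coeff_C_mul]
  congr 1
  simp only [Polynomial.derivative_mul, Polynomial.derivative_pow, map_add, map_natCast, map_one,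
    Polynomial.derivative_sub, Polynomial.derivative_one,
    Polynomial.derivative_X, Nat.add_sub_cancel, Nat.sub_zero]
  push_cast
  ring

lemma kraw_step {n k i₀ : ℕ} {s : ℝ} (hs : 0 < s) (hs1 : s ≤ 1) (hi₀ : i₀ ≤ n)
    (h : s * (n - i₀) + i₀ / s ≤ (n : ℝ) - 2 * k) {i : ℕ} (hi : i < i₀) :
    0 ≤ kraw n k i ∧ s * kraw n k i ≤ kraw n k (i + 1) := by
  have hss : s ≤ 1 / s := by rw [le_div_iff₀ hs]; nlinarith
  have mono : ∀ i : ℕ, i ≤ i₀ → s * (n - i) + i / s ≤ (n : ℝ) - 2 * k := by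
    intro i hi
    have : (i : ℝ) ≤ i₀ := by exact_mod_cast hi
    have h3 : (i₀ - i : ℝ) * s ≤ (i₀ - i) * (1 / s) :=
      mul_le_mul_of_nonneg_left hss (by linarith)
    have e1 : (i₀ : ℝ) / s = i₀ * (1 / s) := by ring
    have e2 : (i : ℝ) / s = i * (1 / s) := by ring
    rw [e1] at h; rw [e2]; nlinarith
  induction i with
  | zero =>
    have h0 : 0 ≤ kraw n k 0 := by rw [kraw_zero]; positivity
    refine ⟨h0, ?_⟩
    obtain ⟨m, rfl⟩ : ∃ m, n = m + 1 := ⟨n - 1, by omega⟩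
    have hr := kraw_rec_zero m k
    have hm := mono 0 (by omega)
    simp only [Nat.cast_zero, sub_zero, zero_div, add_zero] at hm
    have h4 := mul_le_mul_of_nonneg_right hm h0
    rw [← hr] at h4
    push_cast at h4
    have hpos : (0 : ℝ) < m + 1 := by positivity
    refine le_of_mul_le_mul_left ?_ hpos
    linarith
  | succ i ih =>
    obtain ⟨h0, h1⟩ := ih (by omega)
    have h2 : 0 ≤ kraw n k (i + 1) := le_trans (mul_nonneg hs.le h0) h1
    refine ⟨h2, ?_⟩
    obtain ⟨m, rfl⟩ : ∃ m, n = i + m + 2 := ⟨n - i - 2, by omega⟩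
    have hr := kraw_rec i m k
    have hm := mono (i + 1) (by omega)
    have h4 := mul_le_mul_of_nonneg_right hm h2
    rw [← hr] at h4
    have hpos : (0 : ℝ) < m + 1 := by positivity
    refine le_of_mul_le_mul_left ?_ hpos
    have h5 : kraw (i + m + 2) k i ≤ kraw (i + m + 2) k (i + 1) / s := by
      rw [le_div_iff₀ hs]; linarith
    have h6 := mul_le_mul_of_nonneg_left h5 (show (0 : ℝ) ≤ i + 1 by positivity)
    push_cast at h4
    have e1 : ((i : ℝ) + 1) / s * kraw (i + m + 2) k (i + 1) =
      ((i : ℝ) + 1) * (kraw (i + m + 2) k (i + 1) / s) := by ring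
    rw [add_mul, e1] at h4
    have e2 : s * ((i : ℝ) + m + 2 - (i + 1)) * kraw (i + m + 2) k (i + 1) =
      ((m : ℝ) + 1) * (s * kraw (i + m + 2) k (i + 1)) := by ring
    rw [e2] at h4
    have e3 : i + 1 + 1 = i + 2 := rfl
    rw [e3]
    linarith

section LinearProgramming

variable {β : Type*} [Fintype β] [DecidableEq β]

lemma choose_mul_walsh_sq_le (c : ℕ → ℝ) (x : Finset β) :
    ((Fintype.card β).choose x.card : ℝ) * walsh (fun z => c z.card) x ^ 2 ≤
      2 ^ Fintype.card β * ∑ z : Finset β, c z.card ^ 2 := by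
  rw [← parseval (fun z : Finset β => c z.card)]
  calc ((Fintype.card β).choose x.card : ℝ) * walsh (fun z => c z.card) x ^ 2
      = ∑ y ∈ powersetCard x.card (univ : Finset β), walsh (fun z => c z.card) y ^ 2 := by
        rw [Finset.sum_congr rfl (g := fun _ => walsh (fun z : Finset β => c z.card) x ^ 2)]
        · simp [Finset.card_univ]
        · intro y hy
          rw [walsh_radial, walsh_radial, (mem_powersetCard.mp hy).2]
    _ ≤ _ := Finset.sum_le_sum_of_subset_of_nonneg (subset_univ _) fun _ _ _ => sq_nonneg _

lemma choose_le_choose_of_le_half {n i d : ℕ} (hid : i ≤ d) (hd : 2 * d ≤ n) :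
    n.choose i ≤ n.choose d := by
  induction d, hid using Nat.le_induction with
  | base => exact le_rfl
  | succ m hm ih =>
    exact (ih (by omega)).trans (Nat.choose_le_succ_of_lt_half_left (by omega))

lemma walsh_sq_le_of_radial {i₀ i₁ : ℕ} {s : ℝ} (hs : 0 < s) (hs1 : s ≤ 1) (hi : i₀ ≤ i₁)
    (hi₁ : 2 * i₁ ≤ Fintype.card β) (c : ℕ → ℝ) (hc : ∀ k, 0 ≤ c k)
    (hck : ∀ k, c k ≠ 0 → s * ((Fintype.card β : ℝ) - i₀) + i₀ / s ≤ (Fintype.card β : ℝ) - 2 * k)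
    (x : Finset β) (hx : x.card ≤ i₁) :
    ((Fintype.card β).choose i₀ : ℝ) * (s ^ 2) ^ i₁ * walsh (fun z => c z.card) x ^ 2 ≤
      2 ^ Fintype.card β * (∑ z : Finset β, c z.card ^ 2) * (s ^ 2) ^ x.card := by
  set n := Fintype.card β
  set F : ℕ → ℝ := fun i => ∑ k ∈ range (n + 1), c k * kraw n k i with hF
  have hstep : ∀ i < i₀, 0 ≤ F i ∧ s * F i ≤ F (i + 1) := by
    intro i hi'
    have hk : ∀ k, 0 ≤ c k * kraw n k i ∧ s * (c k * kraw n k i) ≤ c k * kraw n k (i + 1) := by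
      intro k
      by_cases h0 : c k = 0
      · simp [h0]
      · obtain ⟨h1, h2⟩ := kraw_step hs hs1 (by omega) (hck k h0) hi'
        refine ⟨mul_nonneg (hc k) h1, ?_⟩
        have := mul_le_mul_of_nonneg_left h2 (hc k)
        linarith
    refine ⟨sum_nonneg fun k _ => (hk k).1, ?_⟩
    simp only [hF, Finset.mul_sum]
    exact sum_le_sum fun k _ => (hk k).2
  have hs2 : s ^ 2 ≤ 1 := pow_le_one₀ hs.le hs1
  set N : ℝ := ∑ z : Finset β, c z.card ^ 2 with hN
  have hN0 : 0 ≤ N := sum_nonneg fun _ _ => sq_nonneg _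
  rcases le_or_gt x.card i₀ with hd | hd
  · have hiter : ∀ m, ∀ d, d + m = i₀ → (s ^ m * F d) ^ 2 ≤ F i₀ ^ 2 := by
      intro m
      induction m with
      | zero => intro d hd; simp at hd; simp [hd]
      | succ m ih =>
        intro d hd
        refine le_trans ?_ (ih (d + 1) (by omega))
        obtain ⟨h1, h2⟩ := hstep d (by omega)
        refine pow_le_pow_left₀ (by positivity) ?_ 2
        have := mul_le_mul_of_nonneg_left h2 (pow_nonneg hs.le m)
        calc s ^ (m + 1) * F d = s ^ m * (s * F d) := by ring
          _ ≤ _ := this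
    obtain ⟨m, hm⟩ := Nat.exists_eq_add_of_le hd
    have h1 := hiter m x.card hm.symm
    obtain ⟨y, -, hy⟩ := Finset.exists_subset_card_eq (s := (univ : Finset β)) (n := i₀)
      (by rw [Finset.card_univ]; change i₀ ≤ n; omega)
    have h2 := choose_mul_walsh_sq_le c y
    rw [walsh_radial, hy] at h2
    rw [walsh_radial]
    change (n.choose i₀ : ℝ) * (s ^ 2) ^ i₁ * F x.card ^ 2 ≤ 2 ^ n * N * (s ^ 2) ^ x.card
    change (n.choose i₀ : ℝ) * F i₀ ^ 2 ≤ 2 ^ n * N at h2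
    calc (n.choose i₀ : ℝ) * (s ^ 2) ^ i₁ * F x.card ^ 2
        ≤ (n.choose i₀ : ℝ) * (s ^ 2) ^ i₀ * F x.card ^ 2 := by
          have := pow_le_pow_of_le_one (sq_nonneg s) hs2 hi
          gcongr
      _ = (s ^ 2) ^ x.card * ((n.choose i₀ : ℝ) * (s ^ m * F x.card) ^ 2) := by
          rw [hm]; ring
      _ ≤ (s ^ 2) ^ x.card * ((n.choose i₀ : ℝ) * F i₀ ^ 2) := by gcongr
      _ ≤ (s ^ 2) ^ x.card * (2 ^ n * N) := by gcongr
      _ = _ := by ring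
  · have h2 := choose_mul_walsh_sq_le c x
    have h3 : (n.choose i₀ : ℝ) ≤ n.choose x.card := by
      exact_mod_cast choose_le_choose_of_le_half hd.le (by omega)
    have h4 := pow_le_pow_of_le_one (sq_nonneg s) hs2 hx
    calc (n.choose i₀ : ℝ) * (s ^ 2) ^ i₁ * walsh (fun z => c z.card) x ^ 2
        ≤ (n.choose x.card : ℝ) * (s ^ 2) ^ x.card * walsh (fun z => c z.card) x ^ 2 := by
          gcongr
      _ = (s ^ 2) ^ x.card * ((n.choose x.card : ℝ) * walsh (fun z => c z.card) x ^ 2) := by ring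
      _ ≤ (s ^ 2) ^ x.card * (2 ^ n * N) := by gcongr
      _ = _ := by ring

/-- The adjacency operator of the cube acting on a radial function. -/
lemma sum_radial_symmDiff_singleton (c : ℕ → ℝ) (z : Finset β) :
    ∑ a, c (symmDiff z {a}).card =
      z.card * c (z.card - 1) + (Fintype.card β - z.card : ℝ) * c (z.card + 1) := by
  have h : ∀ a, c (symmDiff z {a}).card = if a ∈ z then c (z.card - 1) else c (z.card + 1) := by
    intro a
    split_ifs with ha
    · have : symmDiff z {a} = z.erase a := by
        ext b
        by_cases hb : b = a <;> simp [Finset.mem_symmDiff, hb, ha]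
      rw [this, card_erase_of_mem ha]
    · have : symmDiff z {a} = insert a z := by
        ext b
        by_cases hb : b = a <;> simp [Finset.mem_symmDiff, hb, ha]
      rw [this, card_insert_of_notMem ha]
  simp_rw [h]
  rw [Finset.sum_ite]
  simp only [sum_const, nsmul_eq_mul]
  congr 2
  · simp
  · have : univ.filter (fun a => a ∉ z) = zᶜ := by ext; simp
    rw [this, card_compl, Nat.cast_sub (card_le_univ z)]

lemma walsh_empty_sq_le (c : ℕ → ℝ) (r : ℕ) (hcr : ∀ k, r < k → c k = 0) :
    walsh (fun z : Finset β => c z.card) ∅ ^ 2 ≤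
      ((univ.filter fun z : Finset β => z.card ≤ r).card : ℝ) * ∑ z : Finset β, c z.card ^ 2 := by
  have h1 : walsh (fun z : Finset β => c z.card) ∅ =
      ∑ z : Finset β with z.card ≤ r, c z.card := by
    rw [walsh, Finset.sum_filter]
    refine sum_congr rfl fun z _ => ?_
    have : chi z ∅ = 1 := by simp [chi]
    rw [this, mul_one]
    split_ifs with h
    · rfl
    · exact hcr _ (by omega)
  rw [h1]
  refine (sq_sum_le_card_mul_sum_sq).trans ?_
  gcongr
  exact Finset.subset_univ _

/-- Linear programming bound: a large family of words has many pairs at small distance. -/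
lemma linear_programming_bound {κ : Type*} [DecidableEq κ] {i₀ i₁ r : ℕ} {s l l' : ℝ}
    (hs : 0 < s) (hs1 : s ≤ 1) (hi : i₀ ≤ i₁) (hi₁ : 2 * i₁ ≤ Fintype.card β)
    (c : ℕ → ℝ) (hc : ∀ k, 0 ≤ c k) (hcr : ∀ k, r < k → c k = 0) (hc0 : ∃ k ≤ r, c k ≠ 0)
    (hr : s * ((Fintype.card β : ℝ) - i₀) + i₀ / s ≤ (Fintype.card β : ℝ) - 2 * r)
    (hrn : r ≤ Fintype.card β)
    (hl' : 0 ≤ l') (hl : l' ≤ l)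
    (hA : ∀ k ≤ Fintype.card β, l * c k ≤ k * c (k - 1) + (Fintype.card β - k : ℝ) * c (k + 1))
    (hcut : ∀ d : ℕ, i₁ < d → (Fintype.card β : ℝ) - 2 * d ≤ l')
    (J : Finset κ) (x : κ → Finset β) :
    (l - l') * (J.card : ℝ) ^ 2 ≤ (Fintype.card β : ℝ) *
      (J.card * (univ.filter fun z : Finset β => z.card ≤ r).card +
      2 ^ Fintype.card β / ((Fintype.card β).choose i₀ * (s ^ 2) ^ i₁) *
        ∑ i ∈ J, ∑ j ∈ J with j ≠ i ∧ (symmDiff (x i) (x j)).card ≤ i₁,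
          (s ^ 2) ^ (symmDiff (x i) (x j)).card) := by
  set n := Fintype.card β with hn
  set N : ℝ := ∑ z : Finset β, c z.card ^ 2 with hN
  have hNpos : 0 < N := by
    obtain ⟨k, hk, hk0⟩ := hc0
    obtain ⟨y, -, hy⟩ := Finset.exists_subset_card_eq (s := (univ : Finset β)) (n := k)
      (by rw [Finset.card_univ]; change k ≤ n; omega)
    refine Finset.sum_pos' (fun _ _ => sq_nonneg _) ⟨y, mem_univ _, ?_⟩
    rw [hy]; positivity
  have hD := delsarte_ineq J x (fun z : Finset β => c z.card) (fun z => hc _) l l' hl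
    (fun z => by
      rw [sum_radial_symmDiff_singleton]; exact hA _ (card_le_univ z))
  have hch : (0 : ℝ) < n.choose i₀ := by exact_mod_cast Nat.choose_pos (by omega)
  set Bl : ℝ := ((univ.filter fun z : Finset β => z.card ≤ r).card : ℝ) with hBl
  set A : ℝ := 2 ^ n / (n.choose i₀ * (s ^ 2) ^ i₁) with hAdef
  have hw : ∀ y : Finset β, y.card ≤ i₁ →
      walsh (fun z => c z.card) y ^ 2 ≤ N * (A * (s ^ 2) ^ y.card) := by
    intro y hy
    have h1 := walsh_sq_le_of_radial hs hs1 hi hi₁ c hc (fun k hk => by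
      have hkr : k ≤ r := by
        by_contra h
        exact hk (hcr k (by omega))
      have : (k : ℝ) ≤ r := by exact_mod_cast hkr
      change s * ((n : ℝ) - i₀) + i₀ / s ≤ (n : ℝ) - 2 * k
      linarith) y hy
    change (n.choose i₀ : ℝ) * (s ^ 2) ^ i₁ * walsh (fun z => c z.card) y ^ 2 ≤
      2 ^ n * N * (s ^ 2) ^ y.card at h1
    have hpos : 0 < (n.choose i₀ : ℝ) * (s ^ 2) ^ i₁ := by positivity
    rw [hAdef]
    have : N * (2 ^ n / (n.choose i₀ * (s ^ 2) ^ i₁) * (s ^ 2) ^ y.card) =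
      (2 ^ n * N * (s ^ 2) ^ y.card) / (n.choose i₀ * (s ^ 2) ^ i₁) := by ring
    rw [this, le_div_iff₀ hpos]
    linarith
  have hterm : ∀ i ∈ J, ∑ j ∈ J, ((n : ℝ) - 2 * (symmDiff (x i) (x j)).card - l') *
      walsh (fun z => c z.card) (symmDiff (x i) (x j)) ^ 2 ≤
      n * N * (Bl + A * ∑ j ∈ J with j ≠ i ∧ (symmDiff (x i) (x j)).card ≤ i₁,
          (s ^ 2) ^ (symmDiff (x i) (x j)).card) := by
    intro i hiJ
    rw [← Finset.add_sum_erase J _ hiJ, symmDiff_self, mul_add]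
    have hle : ∀ y : Finset β, ((n : ℝ) - 2 * y.card - l') ≤ n := fun y => by
      have : (0 : ℝ) ≤ y.card := by positivity
      linarith
    refine add_le_add ?_ ?_
    · have h1 := walsh_empty_sq_le (β := β) c r hcr
      calc _ ≤ (n : ℝ) * walsh (fun z : Finset β => c z.card) ∅ ^ 2 :=
            mul_le_mul_of_nonneg_right (hle _) (sq_nonneg _)
        _ ≤ n * (Bl * N) := by gcongr
        _ = _ := by ring
    · have e : (J.filter fun j => j ≠ i ∧ (symmDiff (x i) (x j)).card ≤ i₁) =
          (J.erase i).filter fun j => (symmDiff (x i) (x j)).card ≤ i₁ := by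
        ext j; simp only [mem_filter, mem_erase]; tauto
      rw [e, Finset.sum_filter, Finset.mul_sum (J.erase i),
        Finset.mul_sum (J.erase i)]
      refine Finset.sum_le_sum fun j _ => ?_
      split_ifs with hj
      · calc _ ≤ (n : ℝ) * walsh (fun z : Finset β => c z.card) (symmDiff (x i) (x j)) ^ 2 :=
            mul_le_mul_of_nonneg_right (hle _) (sq_nonneg _)
          _ ≤ n * (N * (A * (s ^ 2) ^ (symmDiff (x i) (x j)).card)) :=
            mul_le_mul_of_nonneg_left (hw _ hj) (Nat.cast_nonneg _)
          _ = _ := by ring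
      · simp only [mul_zero]
        refine mul_nonpos_of_nonpos_of_nonneg ?_ (sq_nonneg _)
        have := hcut _ (not_le.mp hj)
        linarith
  have hsum := hD.trans (Finset.sum_le_sum hterm)
  rw [← Finset.mul_sum, Finset.sum_add_distrib, ← Finset.mul_sum] at hsum
  simp only [sum_const, nsmul_eq_mul] at hsum
  refine le_of_mul_le_mul_left ?_ hNpos
  calc _ = (l - l') * N * (J.card : ℝ) ^ 2 := by ring
    _ ≤ _ := hsum
    _ = _ := by ring

end LinearProgramming

section Binomial

lemma eventually_const_mul_pow_le_exp (C : ℝ) (k : ℕ) {ε : ℝ} (hε : 0 < ε) :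
    ∀ᶠ n : ℕ in atTop, C * ((n : ℝ) + 1) ^ k ≤ Real.exp (ε * n) := by
  have h := (isLittleO_pow_exp_pos_mul_atTop k hε).const_mul_left (|C| * Real.exp ε)
  have h1 : Tendsto (fun n : ℕ => ((n : ℝ) + 1)) atTop atTop :=
    tendsto_atTop_add_const_right _ _ tendsto_natCast_atTop_atTop
  have h2 := h1.eventually (h.bound one_pos)
  filter_upwards [h2] with n hn
  rw [one_mul, Real.norm_of_nonneg (by positivity), Real.norm_of_nonneg (by positivity),
    mul_add, mul_one, Real.exp_add, mul_comm |C|, mul_assoc, mul_comm (Real.exp (ε * n))] at hn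
  have := le_of_mul_le_mul_left hn (Real.exp_pos _)
  exact (mul_le_mul_of_nonneg_right (le_abs_self C) (by positivity)).trans this

lemma choose_mul_pow_le_mode {n k : ℕ} (hk : k ≤ n) (j : ℕ) (hj : j ≤ n) :
    n.choose j * k ^ j * (n - k) ^ (n - j) ≤ n.choose k * k ^ k * (n - k) ^ (n - k) := by
  set f : ℕ → ℕ := fun j => n.choose j * k ^ j * (n - k) ^ (n - j) with hf
  have step : ∀ j < n, (j + 1) * f (j + 1) * (n - k) = (n - j) * k * f j := by
    intro j hj
    have h1 := Nat.choose_succ_right_eq n j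
    have h2 : (n - k) ^ (n - j) = (n - k) ^ (n - (j + 1)) * (n - k) := by
      rw [← pow_succ]; congr 1; omega
    simp only [hf]
    rw [h2, pow_succ]
    calc _ = (n.choose (j + 1) * (j + 1)) * (k ^ j * k * (n - k) ^ (n - (j + 1)) * (n - k)) := by
            ring
      _ = _ := by rw [h1]; ring
  have up : ∀ j, j < k → f j ≤ f (j + 1) := by
    intro j hjk
    have hs := step j (by omega)
    rcases hk.eq_or_lt with rfl | hkn
    · have : f j = 0 := by simp [hf, Nat.sub_ne_zero_of_lt hjk]
      omega
    have hle : (j + 1) * (n - k) ≤ (n - j) * k := by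
      zify [hk, (by omega : j ≤ n)]
      have h1 : ((j : ℤ) + 1) * n ≤ k * n := by
        exact mul_le_mul_of_nonneg_right (by omega) (by omega)
      nlinarith
    have hpos : 0 < (j + 1) * (n - k) := Nat.mul_pos (by omega) (by omega)
    refine Nat.le_of_mul_le_mul_left ?_ hpos
    calc (j + 1) * (n - k) * f j ≤ (n - j) * k * f j := Nat.mul_le_mul_right _ hle
      _ = _ := by rw [← hs]; ring
  have down : ∀ j, k ≤ j → j < n → f (j + 1) ≤ f j := by
    intro j hkj hjn
    have hs := step j hjn
    have hle : (n - j) * k ≤ (j + 1) * (n - k) := by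
      zify [hk, hjn.le]
      have h1 : (k : ℤ) * n ≤ j * n := by
        exact mul_le_mul_of_nonneg_right (by omega) (by omega)
      nlinarith
    have hpos : 0 < (j + 1) * (n - k) := Nat.mul_pos (by omega) (by omega)
    refine Nat.le_of_mul_le_mul_left ?_ hpos
    calc (j + 1) * (n - k) * f (j + 1) = (n - j) * k * f j := by rw [← hs]; ring
      _ ≤ _ := Nat.mul_le_mul_right _ hle
  change f j ≤ f k
  rcases le_total j k with h | h
  · obtain ⟨d, rfl⟩ := Nat.exists_eq_add_of_le h
    have : ∀ e ≤ d, f j ≤ f (j + e) := by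
      intro e he
      induction e with
      | zero => exact le_rfl
      | succ e ih => exact (ih (by omega)).trans (up _ (by omega))
    exact this d le_rfl
  · obtain ⟨d, rfl⟩ := Nat.exists_eq_add_of_le h
    have : ∀ e ≤ d, f (k + e) ≤ f k := by
      intro e he
      induction e with
      | zero => exact le_rfl
      | succ e ih => exact (down (k + e) (by omega) (by omega)).trans (ih (by omega))
    exact this d le_rfl

lemma pow_self_le_choose_mul {n k : ℕ} (hk : k ≤ n) :
    n ^ n ≤ (n + 1) * (n.choose k * k ^ k * (n - k) ^ (n - k)) := by
  calc n ^ n = (k + (n - k)) ^ n := by congr 1; omega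
    _ = ∑ j ∈ range (n + 1), k ^ j * (n - k) ^ (n - j) * n.choose j := add_pow _ _ _
    _ ≤ ∑ j ∈ range (n + 1), n.choose k * k ^ k * (n - k) ^ (n - k) := by
      refine sum_le_sum fun j hj => ?_
      have := choose_mul_pow_le_mode hk j (by simpa [Nat.lt_succ_iff] using hj)
      calc _ = n.choose j * k ^ j * (n - k) ^ (n - j) := by ring
        _ ≤ _ := this
    _ = _ := by simp

lemma exp_mul_binEntropy_div {n k : ℕ} (hk0 : 0 < k) (hk : k < n) :
    Real.exp (n * Real.binEntropy (k / n)) * ((k : ℝ) ^ k * ((n : ℝ) - k) ^ (n - k)) =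
      (n : ℝ) ^ n := by
  have hn : (0 : ℝ) < n := by exact_mod_cast (by omega : 0 < n)
  have hk' : (0 : ℝ) < k := by exact_mod_cast hk0
  have hnk : (0 : ℝ) < (n : ℝ) - k := by
    have : (k : ℝ) < n := by exact_mod_cast hk
    linarith
  have e1 : ∀ (a : ℝ) (m : ℕ), 0 < a → a ^ m = Real.exp (m * Real.log a) := by
    intro a m ha
    rw [mul_comm, Real.exp_mul, Real.exp_log ha, Real.rpow_natCast]
  rw [e1 _ k hk', e1 _ (n - k) hnk, e1 _ n hn, ← Real.exp_add, ← Real.exp_add]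
  congr 1
  have h1 : (1 : ℝ) - k / n = (n - k) / n := by field_simp
  rw [Real.binEntropy, h1, inv_div, inv_div, Real.log_div hn.ne' hk'.ne',
    Real.log_div hn.ne' hnk.ne', Nat.cast_sub hk.le]
  field_simp
  ring

lemma exp_binEntropy_le_choose {n k : ℕ} (hk0 : 0 < k) (hk : k < n) :
    Real.exp (n * Real.binEntropy (k / n)) ≤ (n + 1) * n.choose k := by
  have h := exp_mul_binEntropy_div hk0 hk
  have h2 : ((n : ℝ)) ^ n ≤ (n + 1) * (n.choose k * k ^ k * ((n : ℝ) - k) ^ (n - k)) := by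
    have := pow_self_le_choose_mul hk.le
    rw [← Nat.cast_sub hk.le]
    exact_mod_cast this
  have hnk : (0 : ℝ) < (n : ℝ) - k := by
    have : (k : ℝ) < n := by exact_mod_cast hk
    linarith
  have hk' : (0 : ℝ) < k := by exact_mod_cast hk0
  refine le_of_mul_le_mul_right ?_ (by positivity : (0 : ℝ) < (k : ℝ) ^ k * ((n : ℝ) - k) ^ (n - k))
  rw [h]
  calc _ ≤ _ := h2
    _ = _ := by ring

lemma tendsto_floor_mul_div {ω : ℝ} (h0 : 0 ≤ ω) :
    Tendsto (fun n : ℕ => ((⌊ω * n⌋₊ : ℕ) : ℝ) / n) atTop (nhds ω) :=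
  (tendsto_nat_floor_mul_div_atTop h0).comp tendsto_natCast_atTop_atTop

/-- Binomial coefficients grow with the exponent given by the entropy. -/
lemma eventually_exp_le_choose_floor {ω ε : ℝ} (h0 : 0 < ω) (h1 : ω < 1) (hε : 0 < ε) :
    ∀ᶠ n : ℕ in atTop,
      Real.exp (n * (Real.binEntropy ω - ε)) ≤ (n.choose ⌊ω * n⌋₊ : ℝ) := by
  have hcont : Tendsto (fun n : ℕ => Real.binEntropy (((⌊ω * n⌋₊ : ℕ) : ℝ) / n)) atTop
      (nhds (Real.binEntropy ω)) :=
    (Real.binEntropy_continuous.tendsto ω).comp (tendsto_floor_mul_div h0.le)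
  have hbig : Tendsto (fun n : ℕ => ω * n) atTop atTop :=
    tendsto_natCast_atTop_atTop.const_mul_atTop h0
  filter_upwards [hcont.eventually (lt_mem_nhds (by linarith : Real.binEntropy ω - ε / 2 < _)),
    eventually_const_mul_pow_le_exp 1 1 (half_pos hε), hbig.eventually_ge_atTop 1,
    eventually_gt_atTop 0] with n hn hn2 hn3 hn4
  have hn' : (0 : ℝ) < n := by exact_mod_cast hn4
  have hk0 : 0 < ⌊ω * n⌋₊ := Nat.floor_pos.mpr hn3
  have hk : ⌊ω * n⌋₊ < n := by
    rw [Nat.floor_lt (by positivity)]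
    nlinarith
  have h := exp_binEntropy_le_choose hk0 hk
  have h3 : Real.exp (n * (Real.binEntropy ω - ε)) * Real.exp (ε / 2 * n) ≤
      Real.exp (ε / 2 * n) * (n.choose ⌊ω * n⌋₊ : ℝ) := by
    rw [← Real.exp_add]
    calc _ ≤ Real.exp (n * Real.binEntropy (((⌊ω * n⌋₊ : ℕ) : ℝ) / n)) := by
          apply Real.exp_le_exp.mpr
          nlinarith
      _ ≤ (n + 1) * n.choose ⌊ω * n⌋₊ := h
      _ ≤ _ := by
        gcongr
        simpa using hn2
  rw [mul_comm] at h3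
  exact le_of_mul_le_mul_left h3 (Real.exp_pos _)

lemma card_ball_le {β : Type*} [Fintype β] {ρ : ℝ} {r : ℕ} (h0 : 0 < ρ) (h1 : ρ ≤ 1 / 2)
    (hr : (r : ℝ) ≤ ρ * Fintype.card β) :
    ((univ.filter fun z : Finset β => z.card ≤ r).card : ℝ) ≤
      Real.exp (Fintype.card β * Real.binEntropy ρ) := by
  set n := Fintype.card β with hn
  have hsum : ∑ z : Finset β, ρ ^ z.card * (1 - ρ) ^ (n - z.card) = 1 := by
    rw [hn, Fintype.sum_pow_mul_eq_add_pow]; simp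
  have hlog : Real.log ρ ≤ Real.log (1 - ρ) := Real.log_le_log h0 (by linarith)
  have hone : 0 < 1 - ρ := by linarith
  have hterm : ∀ z ∈ univ.filter fun z : Finset β => z.card ≤ r,
      Real.exp (-(n * Real.binEntropy ρ)) ≤ ρ ^ z.card * (1 - ρ) ^ (n - z.card) := by
    intro z hz
    have hzn : z.card ≤ n := card_le_univ z
    have hz' : (z.card : ℝ) ≤ ρ * n :=
      le_trans (by exact_mod_cast (mem_filter.mp hz).2) hr
    rw [← Real.exp_log (pow_pos h0 z.card), ← Real.exp_log (pow_pos hone (n - z.card)),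
      ← Real.exp_add, Real.log_pow, Real.log_pow, Nat.cast_sub hzn]
    apply Real.exp_le_exp.mpr
    rw [Real.binEntropy, Real.log_inv, Real.log_inv]
    nlinarith
  have h2 := (Finset.card_nsmul_le_sum _ _ _ hterm).trans
    (Finset.sum_le_sum_of_subset_of_nonneg (Finset.subset_univ _)
      (fun z _ _ => by positivity))
  rw [hsum, nsmul_eq_mul, Real.exp_neg, ← div_eq_mul_inv, div_le_one (Real.exp_pos _)] at h2
  exact h2

end Binomial

section TentFunction

/-- Superharmonicity of a discrete tent function, up to a factor close to one. -/
lemma tent_second_difference (L m k : ℝ) (hL1 : 1 ≤ L) :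
    (2 - 2 / L) * max 0 (L - |k - m|) ≤
      max 0 (L - |k - 1 - m|) + max 0 (L - |k + 1 - m|) := by
  have hL : 0 < L := by linarith
  have hnn1 := le_max_left 0 (L - |k - 1 - m|)
  have hnn2 := le_max_left 0 (L - |k + 1 - m|)
  have h1 := le_max_right 0 (L - |k - 1 - m|)
  have h2 := le_max_right 0 (L - |k + 1 - m|)
  rcases le_total (L - |k - m|) 0 with h | h
  · rw [max_eq_left h]; linarith
  rw [max_eq_right h]
  have t1 : |k - 1 - m| ≤ |k - m| + 1 := by
    have := abs_sub (k - m) 1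
    rw [abs_one] at this
    rwa [show k - 1 - m = k - m - 1 by ring]
  have t2 : |k + 1 - m| ≤ |k - m| + 1 := by
    have := abs_add_le (k - m) 1
    rw [abs_one] at this
    rwa [show k + 1 - m = k - m + 1 by ring]
  have e : (2 - 2 / L) * (L - |k - m|) = 2 * (L - |k - m|) - 2 + 2 * |k - m| / L := by
    field_simp
    ring
  rw [e]
  have hle : |k - m| / L ≤ 1 := by rw [div_le_one hL]; linarith
  have hq : 2 * |k - m| / L = 2 * (|k - m| / L) := by ring
  rw [hq]
  rcases le_total 1 |k - m| with h3 | h3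
  · have : |k - 1 - m| + |k + 1 - m| = 2 * |k - m| := by
      rcases abs_cases (k - m) with ⟨ha, hb⟩ | ⟨ha, hb⟩
      · rw [abs_of_nonneg (by linarith : 0 ≤ k - 1 - m),
          abs_of_nonneg (by linarith : 0 ≤ k + 1 - m)]
        linarith
      · rw [abs_of_nonpos (by linarith : k - 1 - m ≤ 0),
          abs_of_nonpos (by linarith : k + 1 - m ≤ 0)]
        linarith
    linarith
  · have : |k - 1 - m| + |k + 1 - m| ≤ 2 := by
      rcases abs_cases (k - m) with ⟨ha, hb⟩ | ⟨ha, hb⟩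
      all_goals
        rw [abs_of_nonpos (by linarith : k - 1 - m ≤ 0),
          abs_of_nonneg (by linarith : 0 ≤ k + 1 - m)]
        linarith
    have : |k - m| / L ≤ |k - m| := div_le_self (abs_nonneg _) hL1
    linarith

lemma tent_mul_pow_supersolution {n : ℕ} {L m θ μ l : ℝ} (hL : 1 ≤ L) (hθ : 0 < θ) (hm : L ≤ m)
    (hμ : 0 ≤ μ) (h1 : μ * θ ≤ m - L) (h2 : μ ≤ (n - (m + L)) * θ) (hl : l ≤ μ * (2 - 2 / L))
    (k : ℕ) (hk : k ≤ n) :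
    l * (max 0 (L - |(k : ℝ) - m|) * θ ^ k) ≤
      k * (max 0 (L - |((k - 1 : ℕ) : ℝ) - m|) * θ ^ (k - 1)) +
        (n - k : ℝ) * (max 0 (L - |((k + 1 : ℕ) : ℝ) - m|) * θ ^ (k + 1)) := by
  have hkn : (k : ℝ) ≤ n := by exact_mod_cast hk
  rcases le_total (L - |(k : ℝ) - m|) 0 with h | h
  · rw [max_eq_left h, zero_mul, mul_zero]
    have := le_max_left 0 (L - |((k - 1 : ℕ) : ℝ) - m|)
    have := le_max_left 0 (L - |((k + 1 : ℕ) : ℝ) - m|)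
    have : (0 : ℝ) ≤ n - k := by linarith
    exact add_nonneg (by positivity) (mul_nonneg this (by positivity))
  have hab := abs_le.mp (by linarith : |(k : ℝ) - m| ≤ L)
  rcases Nat.eq_zero_or_pos k with rfl | hk0
  · have hz : max 0 (L - |((0 : ℕ) : ℝ) - m|) = 0 := by
      apply max_eq_left
      have := neg_abs_le (((0 : ℕ) : ℝ) - m)
      push_cast at this hab ⊢
      rw [zero_sub, abs_neg, abs_of_nonneg (by linarith)]
      linarith
    rw [hz]
    have := le_max_left 0 (L - |((0 + 1 : ℕ) : ℝ) - m|)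
    simp only [zero_mul, mul_zero, Nat.cast_zero, zero_add, sub_zero]
    positivity
  have ht := tent_second_difference L m k hL
  rw [Nat.cast_sub hk0, Nat.cast_add, Nat.cast_one]
  set t := max 0 (L - |(k : ℝ) - m|) with htdef
  set t₁ := max 0 (L - |(k : ℝ) - 1 - m|) with ht₁
  set t₂ := max 0 (L - |(k : ℝ) + 1 - m|) with ht₂
  have t0 : 0 ≤ t := le_max_left _ _
  have t10 : 0 ≤ t₁ := le_max_left _ _
  have t20 : 0 ≤ t₂ := le_max_left _ _
  have hpow : θ ^ k = θ ^ (k - 1) * θ := by rw [← pow_succ]; congr 1; omega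
  have hk1 : μ * θ ≤ k := by linarith
  have hk2 : μ ≤ (n - k) * θ := h2.trans (mul_le_mul_of_nonneg_right (by linarith) hθ.le)
  have a1 : μ * t₁ * θ ^ k ≤ k * (t₁ * θ ^ (k - 1)) := by
    rw [hpow]
    calc _ = (μ * θ) * (t₁ * θ ^ (k - 1)) := by ring
      _ ≤ _ := by gcongr
  have a2 : μ * t₂ * θ ^ k ≤ (n - k) * (t₂ * θ ^ (k + 1)) := by
    calc _ = μ * (t₂ * θ ^ k) := by ring
      _ ≤ ((n - k) * θ) * (t₂ * θ ^ k) := by gcongr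
      _ = _ := by ring
  calc l * (t * θ ^ k) ≤ μ * (2 - 2 / L) * (t * θ ^ k) := by gcongr
    _ = μ * ((2 - 2 / L) * t) * θ ^ k := by ring
    _ ≤ μ * (t₁ + t₂) * θ ^ k := by gcongr
    _ = μ * t₁ * θ ^ k + μ * t₂ * θ ^ k := by ring
    _ ≤ _ := add_le_add a1 a2

/-- The linear programming bound evaluated at a tent-shaped radial function. -/
lemma linear_programming_bound_tent {n L : ℕ} {ω δ ρ : ℝ} (h0 : 0 < ω) (h1 : ω < 1 / 2)
    (hδ : 0 < δ) (hδω : δ ≤ 1 / 2 - ω) (hρ0 : 0 < ρ) (hρφ : ρ ≤ 1 / 2 - √(ω * (1 - ω)))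
    (hρA : 1 - 2 * ω - δ < 2 * √(ρ * (1 - ρ))) (hL : 1 ≤ L) (hLδ : 16 / δ ≤ L)
    (hn : 0 < n) (hn1 : 2 * L + 1 ≤ ρ * n)
    (hn2 : (2 * L + 1) * (1 - ρ) / √(ρ * (1 - ρ)) ≤ δ / 16 * n)
    {κ : Type} [DecidableEq κ] (J : Finset κ) (x : κ → Finset (Fin n)) :
    δ / 4 * (J.card : ℝ) ^ 2 ≤
      J.card * (univ.filter fun z : Finset (Fin n) => z.card ≤ ⌊ρ * n⌋₊).card +
      2 ^ n / (n.choose ⌊ω * n⌋₊ * (ω / (1 - ω)) ^ ⌊(ω + δ) * n⌋₊) *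
        ∑ i ∈ J, ∑ j ∈ J with j ≠ i ∧ (symmDiff (x i) (x j)).card ≤ ⌊(ω + δ) * n⌋₊,
          (ω / (1 - ω)) ^ (symmDiff (x i) (x j)).card := by
  have hn' : (0 : ℝ) < n := by exact_mod_cast hn
  have hω1 : 0 < 1 - ω := by linarith
  set B := ω / (1 - ω) with hB
  have hB0 : 0 < B := by positivity
  have hB1 : B < 1 := by rw [hB, div_lt_one hω1]; linarith
  obtain ⟨s, hs0, hs2⟩ : ∃ s, 0 < s ∧ s ^ 2 = B := ⟨√B, Real.sqrt_pos.mpr hB0, Real.sq_sqrt hB0.le⟩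
  have hs1 : s ≤ 1 := by nlinarith
  obtain ⟨g, hg⟩ : ∃ g, g = √(ω * (1 - ω)) := ⟨_, rfl⟩
  have hg0 : 0 < g := by rw [hg]; exact Real.sqrt_pos.mpr (by positivity)
  have hg2 : g ^ 2 = ω * (1 - ω) := by rw [hg]; exact Real.sq_sqrt (by positivity)
  rw [← hg] at hρφ
  have hρ1 : ρ < 1 / 2 := by linarith
  obtain ⟨a, ha⟩ : ∃ a, a = √(ρ * (1 - ρ)) := ⟨_, rfl⟩
  rw [← ha] at hρA hn2
  have ha0 : 0 < a := by rw [ha]; exact Real.sqrt_pos.mpr (mul_pos hρ0 (by linarith))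
  have ha2 : a ^ 2 = ρ * (1 - ρ) := by
    rw [ha]; exact Real.sq_sqrt (mul_nonneg hρ0.le (by linarith))
  have hah : a < 1 / 2 := by nlinarith [sq_nonneg (1 - 2 * ρ)]
  obtain ⟨θ, hθ⟩ : ∃ θ, θ = a / (1 - ρ) := ⟨_, rfl⟩
  have hθ0 : 0 < θ := by rw [hθ]; exact div_pos ha0 (by linarith)
  have hθ1 : (1 - ρ) * θ = a := by rw [hθ]; field_simp [(by linarith : (1 - ρ) ≠ 0)]
  have hθ2 : ρ = a * θ := by
    rw [hθ, ← mul_div_assoc, ← sq, ha2, mul_div_assoc, div_self (by linarith), mul_one]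
  have hn2' : (2 * L + 1) ≤ δ / 16 * n * θ := by
    rw [mul_div_assoc, ← inv_div a, ← hθ, ← div_eq_mul_inv, div_le_iff₀ hθ0] at hn2
    exact hn2
  have hL1 : (1 : ℝ) ≤ L := by exact_mod_cast hL
  obtain ⟨r, hr⟩ : ∃ r, r = ⌊ρ * n⌋₊ := ⟨_, rfl⟩
  have hrle : (r : ℝ) ≤ ρ * n := by rw [hr]; exact Nat.floor_le (by positivity)
  have hrgt : ρ * n < r + 1 := by rw [hr]; exact Nat.lt_floor_add_one _
  have hrL : 2 * L ≤ r := by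
    have : (2 * L : ℝ) < r + 1 := by linarith
    have : 2 * L < r + 1 := by exact_mod_cast this
    omega
  have hrL' : (2 * L : ℝ) ≤ r := by exact_mod_cast hrL
  have hrn : r ≤ n := by
    have : (r : ℝ) ≤ n := by nlinarith
    exact_mod_cast this
  have hcr : ∀ k : ℕ, r < k → max 0 ((L : ℝ) - |(k : ℝ) - (r - L)|) * θ ^ k = 0 := by
    intro k hk
    have hk' : (r : ℝ) < k := by exact_mod_cast hk
    rw [abs_of_nonneg (by linarith), max_eq_left (by linarith), zero_mul]
  have hi : ⌊ω * n⌋₊ ≤ ⌊(ω + δ) * n⌋₊ := Nat.floor_le_floor (by gcongr; linarith)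
  have hi1 : 2 * ⌊(ω + δ) * n⌋₊ ≤ n := by
    have h3 : (⌊(ω + δ) * n⌋₊ : ℝ) ≤ (ω + δ) * n := Nat.floor_le (by positivity)
    have : ((2 * ⌊(ω + δ) * n⌋₊ : ℕ) : ℝ) ≤ n := by push_cast; nlinarith
    exact_mod_cast this
  have hrs : s * ((n : ℝ) - ⌊ω * n⌋₊) + ⌊ω * n⌋₊ / s ≤ (n : ℝ) - 2 * r := by
    have hi₀le : (⌊ω * n⌋₊ : ℝ) ≤ ω * n := Nat.floor_le (by positivity)
    have hsg : s * (1 - ω) = g := by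
      have : (s * (1 - ω)) ^ 2 = g ^ 2 := by
        rw [mul_pow, hs2, hg2, hB]; field_simp
      exact (sq_eq_sq₀ (by positivity) hg0.le).mp this
    have hsg' : ω / s = g := by
      have : (ω / s) ^ 2 = g ^ 2 := by
        rw [div_pow, hs2, hg2, hB]; field_simp
      exact (sq_eq_sq₀ (by positivity) hg0.le).mp this
    have hs3 : 1 ≤ 1 / s := by rw [le_div_iff₀ hs0]; linarith
    have hmul : (⌊ω * n⌋₊ : ℝ) * (1 / s - s) ≤ ω * n * (1 / s - s) :=
      mul_le_mul_of_nonneg_right hi₀le (by linarith)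
    have e2 : ω * n * (1 / s - s) = n * (ω / s) - ω * n * s := by ring
    rw [e2, hsg'] at hmul
    have e3 : s * n - ω * n * s = n * g := by rw [← hsg]; ring
    have e4 : (⌊ω * n⌋₊ : ℝ) * (1 / s - s) = ⌊ω * n⌋₊ / s - s * ⌊ω * n⌋₊ := by ring
    rw [e4] at hmul
    have e5 : n * ρ ≤ n * (1 / 2 - g) := by gcongr
    linarith
  have hA : ∀ k ≤ n, n * (2 * a - δ / 4) * (max 0 ((L : ℝ) - |(k : ℝ) - (r - L)|) * θ ^ k) ≤
      k * (max 0 (L - |((k - 1 : ℕ) : ℝ) - (r - L)|) * θ ^ (k - 1)) +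
        (n - k : ℝ) * (max 0 (L - |((k + 1 : ℕ) : ℝ) - (r - L)|) * θ ^ (k + 1)) := by
    have hdom : 0 ≤ n * (a - δ / 16) := by
      have : 0 ≤ a - δ / 16 := by linarith
      positivity
    refine tent_mul_pow_supersolution (μ := n * (a - δ / 16)) hL1 hθ0 (by linarith) hdom
      ?_ ?_ ?_
    · have e1 : n * (a - δ / 16) * θ = n * (a * θ) - δ / 16 * n * θ := by ring
      rw [e1, ← hθ2]
      linarith
    · have e1 : (n - ((r : ℝ) - L + L)) * θ = (n - r) * θ := by ring
      rw [e1]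
      calc n * (a - δ / 16) ≤ n * a := by gcongr; linarith
        _ = n * ((1 - ρ) * θ) := by rw [hθ1]
        _ = (n - ρ * n) * θ := by ring
        _ ≤ _ := by gcongr
    · have hLd : 2 / (L : ℝ) ≤ δ / 8 := by
        rw [div_le_iff₀ hδ] at hLδ
        rw [div_le_iff₀ (by linarith)]
        linarith
      have h2 : 2 * a - δ / 4 ≤ (a - δ / 16) * (2 - 2 / L) := by
        have h3 : (a - δ / 16) * (2 / L) ≤ 1 * (δ / 8) := by gcongr; linarith
        linarith
      calc n * (2 * a - δ / 4) ≤ n * ((a - δ / 16) * (2 - 2 / L)) := by gcongr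
        _ = _ := by ring
  have hcut : ∀ d : ℕ, ⌊(ω + δ) * n⌋₊ < d → (n : ℝ) - 2 * d ≤ n * (2 * a - δ / 2) := by
    intro d hd
    have hd' : (ω + δ) * n < d := (Nat.floor_lt (by positivity)).mp hd
    have : n * (1 - 2 * ω - 2 * δ) ≤ n * (2 * a - δ / 2) :=
      mul_le_mul_of_nonneg_left (by linarith) hn'.le
    linarith
  have key := linear_programming_bound (β := Fin n) (i₀ := ⌊ω * n⌋₊) (i₁ := ⌊(ω + δ) * n⌋₊) (r := r)
    (l := n * (2 * a - δ / 4)) (l' := n * (2 * a - δ / 2)) hs0 hs1 hi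
    (by rw [Fintype.card_fin]; exact hi1) (fun k => max 0 ((L : ℝ) - |(k : ℝ) - (r - L)|) * θ ^ k)
    (fun k => mul_nonneg (le_max_left _ _) (pow_nonneg hθ0.le _)) hcr
    ⟨r - L, by omega, by
      rw [Nat.cast_sub (by omega), sub_self, abs_zero, sub_zero, max_eq_right (by linarith)]
      positivity⟩
    (by rw [Fintype.card_fin]; exact hrs) (by rw [Fintype.card_fin]; exact hrn)
    (mul_nonneg hn'.le (by linarith))
    (mul_le_mul_of_nonneg_left (by linarith) hn'.le)
    (by rw [Fintype.card_fin]; exact hA) (by rw [Fintype.card_fin]; exact hcut) J x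
  rw [Fintype.card_fin, hs2] at key
  refine le_of_mul_le_mul_left ?_ hn'
  rw [← hr]
  calc _ = (n * (2 * a - δ / 4) - n * (2 * a - δ / 2)) * (J.card : ℝ) ^ 2 := by ring
    _ ≤ _ := key

end TentFunction

/-- A large family of words has many pairs at distance at most about `ω n`, measured by the
weights `(ω / (1 - ω)) ^ d`. -/
lemma exists_close_pairs {ω η : ℝ} (h0 : 0 < ω) (h1 : ω < 1 / 2) (hη : 0 < η) :
    ∃ ε > 0, ∀ᶠ n : ℕ in atTop, ∀ (κ : Type) [DecidableEq κ] (J : Finset κ)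
      (x : κ → Finset (Fin n)),
      Real.exp (n * (Real.binEntropy (1 / 2 - √(ω * (1 - ω))) - ε)) ≤ J.card →
      J.card * Real.exp (n * (Real.binEntropy (1 / 2 - √(ω * (1 - ω))) - Real.log 2 -
        Real.log (1 - ω) - η)) ≤
      ∑ i ∈ J, ∑ j ∈ J with j ≠ i ∧ ((symmDiff (x i) (x j)).card : ℝ) ≤ (ω + η) * n,
        (ω / (1 - ω)) ^ (symmDiff (x i) (x j)).card := by
  have hω1 : 0 < 1 - ω := by linarith
  obtain ⟨B, hB⟩ : ∃ B, B = ω / (1 - ω) := ⟨_, rfl⟩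
  have hB0 : 0 < B := by rw [hB]; positivity
  have hB1 : B < 1 := by rw [hB, div_lt_one hω1]; linarith
  obtain ⟨g, hg⟩ : ∃ g, g = √(ω * (1 - ω)) := ⟨_, rfl⟩
  have hg0 : 0 < g := by rw [hg]; exact Real.sqrt_pos.mpr (by positivity)
  have hg2 : g ^ 2 = ω * (1 - ω) := by rw [hg]; exact Real.sq_sqrt (by positivity)
  have hgh : g < 1 / 2 := by nlinarith [mul_pos (sub_pos.mpr h1) (sub_pos.mpr h1)]
  obtain ⟨φ, hφ⟩ : ∃ φ, φ = 1 / 2 - g := ⟨_, rfl⟩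
  have hφ0 : 0 < φ := by linarith
  have hlogB : Real.log B < 0 := Real.log_neg hB0 hB1
  -- slack in the distance
  obtain ⟨δ, hδ0, hδη, hδω, hδB⟩ : ∃ δ, 0 < δ ∧ δ ≤ η ∧ δ ≤ 1 / 2 - ω ∧
      δ * (1 - Real.log B) ≤ η / 4 := by
    refine ⟨min (min η (1 / 2 - ω)) (η / (4 * (1 - Real.log B))),
      lt_min (lt_min hη (by linarith)) (div_pos hη (by linarith)),
      (min_le_left _ _).trans (min_le_left _ _), (min_le_left _ _).trans (min_le_right _ _), ?_⟩
    have := min_le_right (min η (1 / 2 - ω)) (η / (4 * (1 - Real.log B)))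
    rw [le_div_iff₀ (by linarith)] at this
    linarith
  -- choice of the radius
  obtain ⟨ρ, hρ0, hρφ, hρA⟩ : ∃ ρ, 0 < ρ ∧ ρ < φ ∧ 1 - 2 * ω - δ < 2 * √(ρ * (1 - ρ)) := by
    have hc : Continuous fun ρ : ℝ => 2 * √(ρ * (1 - ρ)) := by fun_prop
    have hval : 2 * √(φ * (1 - φ)) = 1 - 2 * ω := by
      have : φ * (1 - φ) = ((1 - 2 * ω) / 2) ^ 2 := by
        calc φ * (1 - φ) = 1 / 4 - g ^ 2 := by rw [hφ]; ring
          _ = _ := by rw [hg2]; ring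
      rw [this, Real.sqrt_sq (by linarith)]
      ring
    have ht := (hc.tendsto φ).eventually (lt_mem_nhds (by rw [hval]; linarith :
      1 - 2 * ω - δ < _))
    have ht' := (ht.filter_mono nhdsWithin_le_nhds : ∀ᶠ ρ in nhdsWithin φ (Set.Iio φ), _)
    obtain ⟨ρ, hρ1, hρ2, hρ3⟩ := (ht'.and ((Ioo_mem_nhdsLT hφ0 : Set.Ioo 0 φ ∈ _))).exists
    exact ⟨ρ, hρ2, hρ3, hρ1⟩
  have hρ1 : ρ < 1 / 2 := by linarith
  have hent : Real.binEntropy ρ < Real.binEntropy φ := by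
    refine Real.binEntropy_strictMonoOn ⟨hρ0.le, ?_⟩ ⟨hφ0.le, ?_⟩ hρφ <;> norm_num <;> linarith
  obtain ⟨L, hL⟩ := exists_nat_gt (16 / δ)
  have hL0 : (0 : ℝ) < L := lt_trans (by positivity) hL
  have hL1 : 1 ≤ L := by exact_mod_cast hL0
  obtain ⟨ε, hε0, hε1, hε2⟩ : ∃ ε, 0 < ε ∧ ε ≤ (Real.binEntropy φ - Real.binEntropy ρ) / 2 ∧
      ε ≤ η / 8 :=
    ⟨min ((Real.binEntropy φ - Real.binEntropy ρ) / 2) (η / 8), lt_min (by linarith) (by linarith),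
      min_le_left _ _, min_le_right _ _⟩
  refine ⟨ε, hε0, ?_⟩
  have hlarge1 : Tendsto (fun n : ℕ => ρ * n) atTop atTop :=
    tendsto_natCast_atTop_atTop.const_mul_atTop hρ0
  have hlarge2 : Tendsto (fun n : ℕ => δ / 16 * n) atTop atTop :=
    tendsto_natCast_atTop_atTop.const_mul_atTop (by positivity)
  filter_upwards [eventually_exp_le_choose_floor h0 (by linarith) hε0,
    eventually_const_mul_pow_le_exp (8 / δ) 0 hε0,
    eventually_const_mul_pow_le_exp (8 / δ) 0 (half_pos hη),
    hlarge1.eventually_ge_atTop (2 * L + 1),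
    hlarge2.eventually_ge_atTop ((2 * L + 1) * (1 - ρ) / √(ρ * (1 - ρ))),
    eventually_gt_atTop 0] with n hn1 hn2 hn2' hn3 hn4 hn5 κ _ J x hJ
  simp only [pow_zero, mul_one] at hn2 hn2'
  have hn : (0 : ℝ) < n := by exact_mod_cast hn5
  have key := linear_programming_bound_tent h0 h1 hδ0 hδω hρ0 (by rw [← hg, ← hφ]; exact hρφ.le)
    hρA hL1 hL.le hn5 hn3 hn4 J x
  rw [← hg, ← hφ] at hJ ⊢
  rw [← hB] at key ⊢
  have hball := card_ball_le (β := Fin n) (r := ⌊ρ * n⌋₊) hρ0 hρ1.le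
    (by rw [Fintype.card_fin]; exact Nat.floor_le (by positivity))
  rw [Fintype.card_fin] at hball
  set Bl : ℝ := ((univ.filter fun z : Finset (Fin n) => z.card ≤ ⌊ρ * n⌋₊).card : ℝ) with hBl
  set S := ∑ i ∈ J, ∑ j ∈ J with j ≠ i ∧ (symmDiff (x i) (x j)).card ≤ ⌊(ω + δ) * n⌋₊,
          B ^ (symmDiff (x i) (x j)).card with hS
  have hSle : S ≤ ∑ i ∈ J, ∑ j ∈ J with j ≠ i ∧ ((symmDiff (x i) (x j)).card : ℝ) ≤ (ω + η) * n,
        B ^ (symmDiff (x i) (x j)).card := by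
    refine sum_le_sum fun i _ => ?_
    refine sum_le_sum_of_subset_of_nonneg ?_ (fun _ _ _ => by positivity)
    intro j hj
    simp only [mem_filter] at hj ⊢
    refine ⟨hj.1, hj.2.1, ?_⟩
    have := (Nat.le_floor_iff (by positivity)).mp hj.2.2
    exact this.trans (by gcongr)
  refine le_trans ?_ hSle
  have hM0 : (0 : ℝ) < J.card := lt_of_lt_of_le (Real.exp_pos _) hJ
  -- the ball is negligible
  have hBlJ : Bl ≤ δ / 8 * J.card := by
    have : 8 / δ * Bl ≤ J.card := by
      calc 8 / δ * Bl ≤ Real.exp (ε * n) * Real.exp (n * Real.binEntropy ρ) := by gcongr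
        _ = Real.exp (ε * n + n * Real.binEntropy ρ) := (Real.exp_add _ _).symm
        _ ≤ Real.exp (n * (Real.binEntropy φ - ε)) := by
          apply Real.exp_le_exp.mpr
          have : n * Real.binEntropy ρ ≤ n * (Real.binEntropy φ - 2 * ε) := by
            apply mul_le_mul_of_nonneg_left _ hn.le; linarith
          linarith
        _ ≤ _ := hJ
    rw [div_mul_eq_mul_div, div_le_iff₀ hδ0] at this
    linarith
  have hch : (0 : ℝ) < n.choose ⌊ω * n⌋₊ := lt_of_lt_of_le (Real.exp_pos _) hn1
  set A : ℝ := n.choose ⌊ω * n⌋₊ * B ^ ⌊(ω + δ) * n⌋₊ with hA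
  have hA0 : 0 < A := by positivity
  have h3 : J.card * (δ / 8 * J.card * A / 2 ^ n) ≤ S := by
    have h2 : δ / 8 * (J.card : ℝ) ^ 2 ≤ 2 ^ n / A * S := by
      have := mul_le_mul_of_nonneg_left hBlJ hM0.le
      linarith
    rw [div_mul_eq_mul_div (2 ^ n), le_div_iff₀ hA0] at h2
    rw [← mul_div_assoc, div_le_iff₀ (by positivity)]
    linarith
  refine le_trans ?_ h3
  refine mul_le_mul_of_nonneg_left ?_ hM0.le
  have hAlow : Real.exp (n * (Real.binEntropy ω - ε) + (ω + δ) * n * Real.log B) ≤ A := by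
    rw [Real.exp_add, hA]
    gcongr
    rw [← Real.exp_log (pow_pos hB0 _), Real.log_pow]
    apply Real.exp_le_exp.mpr
    exact mul_le_mul_of_nonpos_right (Nat.floor_le (by positivity)) hlogB.le
  have hδe : Real.exp (-(η / 2 * n)) ≤ δ / 8 := by
    rw [Real.exp_neg, inv_le_comm₀ (Real.exp_pos _) (by positivity), inv_div]
    exact hn2'
  have h2n : (2 : ℝ) ^ n = Real.exp (n * Real.log 2) := by
    rw [mul_comm, Real.exp_mul, Real.exp_log two_pos, Real.rpow_natCast]
  rw [le_div_iff₀ (by positivity), h2n, ← Real.exp_add]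
  calc _ ≤ Real.exp (-(η / 2 * n) + n * (Real.binEntropy φ - ε) +
          (n * (Real.binEntropy ω - ε) + (ω + δ) * n * Real.log B)) := by
        apply Real.exp_le_exp.mpr
        have he : Real.binEntropy ω + ω * Real.log B = - Real.log (1 - ω) := by
          rw [Real.binEntropy, hB, Real.log_div h0.ne' hω1.ne', Real.log_inv, Real.log_inv]
          ring
        have hsl : - η ≤ -(η / 2) - 2 * ε + δ * Real.log B := by linarith
        have h5 : n * (- η) ≤ n * (-(η / 2) - 2 * ε + δ * Real.log B) := by gcongr
        have h6 : n * (Real.binEntropy ω + ω * Real.log B) = n * (- Real.log (1 - ω)) := by rw [he]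
        linarith
    _ ≤ δ / 8 * J.card * A := by
        rw [Real.exp_add, Real.exp_add]
        gcongr

section ScalarInequalities

/-- Taylor polynomial of `log (1 + x)` of degree `n`. -/
noncomputable def logTaylor (n : ℕ) (x : ℝ) : ℝ := ∑ i ∈ range n, -(-x) ^ (i + 1) / ((i : ℝ) + 1)

lemma hasDerivAt_log_sub_logTaylor (n : ℕ) {x : ℝ} (hx : -1 < x) :
    HasDerivAt (fun y => Real.log (1 + y) - logTaylor n y) ((-x) ^ n / (1 + x)) x := by
  have h4 : (1 + x) ≠ 0 := by linarith
  have h1 : HasDerivAt (fun y : ℝ => Real.log (1 + y)) (1 / (1 + x)) x :=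
    ((hasDerivAt_id x).const_add 1).log h4
  have h2 : HasDerivAt (fun y : ℝ => logTaylor n y) (∑ i ∈ range n, (-x) ^ i) x := by
    refine HasDerivAt.fun_sum fun i _ => ?_
    have h := ((((hasDerivAt_neg x).fun_pow (i + 1)).fun_neg).div_const ((i : ℝ) + 1))
    refine h.congr_deriv ?_
    have : (i : ℝ) + 1 ≠ 0 := by positivity
    push_cast
    field_simp
  refine (h1.sub h2).congr_deriv ?_
  have h3 := geom_sum_mul (-x) n
  field_simp
  linarith

lemma logTaylor_le_log {n : ℕ} (hn : Even n) {x : ℝ} (hx : 0 ≤ x) :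
    logTaylor n x ≤ Real.log (1 + x) := by
  have hm : MonotoneOn (fun y => Real.log (1 + y) - logTaylor n y) (Set.Ici 0) := by
    refine monotoneOn_of_hasDerivWithinAt_nonneg (convex_Ici 0)
      (fun y hy => (hasDerivAt_log_sub_logTaylor n
        (neg_one_lt_zero.trans_le hy)).continuousAt.continuousWithinAt)
      (fun y hy => (hasDerivAt_log_sub_logTaylor n ?_).hasDerivWithinAt) fun y hy => ?_
    · exact neg_one_lt_zero.trans_le (Set.mem_Ici.1 (interior_subset hy))
    · have : (0 : ℝ) ≤ y := interior_subset hy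
      have := hn.pow_nonneg (-y)
      positivity
  have := hm (Set.mem_Ici.2 le_rfl) (Set.mem_Ici.2 hx) hx
  simp [logTaylor] at this ⊢
  exact this

lemma log_le_logTaylor {n : ℕ} (hn : Odd n) {x : ℝ} (hx : -1 < x) :
    Real.log (1 + x) ≤ logTaylor n x := by
  rcases le_total 0 x with h0 | h0
  · have hm : AntitoneOn (fun y => Real.log (1 + y) - logTaylor n y) (Set.Ici 0) := by
      refine antitoneOn_of_hasDerivWithinAt_nonpos (convex_Ici 0)
        (fun y hy => (hasDerivAt_log_sub_logTaylor n
          (neg_one_lt_zero.trans_le hy)).continuousAt.continuousWithinAt)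
        (fun y hy => (hasDerivAt_log_sub_logTaylor n ?_).hasDerivWithinAt) fun y hy => ?_
      · exact neg_one_lt_zero.trans_le (Set.mem_Ici.1 (interior_subset hy))
      · have hy0 : (0 : ℝ) ≤ y := interior_subset hy
        refine div_nonpos_of_nonpos_of_nonneg ?_ (by positivity)
        rw [hn.neg_pow]
        have : 0 ≤ y ^ n := by positivity
        linarith
    have := hm (Set.mem_Ici.2 le_rfl) (Set.mem_Ici.2 h0) h0
    simp [logTaylor] at this ⊢
    exact this
  · have hm : MonotoneOn (fun y => Real.log (1 + y) - logTaylor n y) (Set.Icc x 0) := by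
      refine monotoneOn_of_hasDerivWithinAt_nonneg (convex_Icc x 0)
        (fun y hy => (hasDerivAt_log_sub_logTaylor n
          (hx.trans_le hy.1)).continuousAt.continuousWithinAt)
        (fun y hy => (hasDerivAt_log_sub_logTaylor n ?_).hasDerivWithinAt) fun y hy => ?_
      · exact hx.trans_le (interior_subset hy).1
      · have hy0 := interior_subset hy
        exact div_nonneg (pow_nonneg (by linarith [hy0.2]) n) (by linarith [hy0.1])
    have := hm (Set.left_mem_Icc.2 h0) (Set.right_mem_Icc.2 h0) h0
    simp [logTaylor] at this ⊢
    exact this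

lemma HasSum.of_eq {f g : ℕ → ℝ} {a b : ℝ} (h : HasSum f a) (hf : ∀ k, g k = f k) (ha : b = a) :
    HasSum g b := by
  rw [ha, funext hf]
  exact h

/-- `S e = (e / 2) log ((1 + e) / (1 - e)) = e · artanh e`. -/
noncomputable def mulArtanh (e : ℝ) : ℝ := e / 2 * (Real.log (1 + e) - Real.log (1 - e))

lemma hasSum_mulArtanh {e : ℝ} (h0 : 0 ≤ e) (h1 : e < 1) :
    HasSum (fun k : ℕ => (1 / (2 * (k : ℝ) + 1)) * (e ^ 2) ^ (k + 1)) (mulArtanh e) := by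
  have h := (Real.hasSum_log_sub_log_of_abs_lt_one (x := e) (by rw [abs_of_nonneg h0]; exact h1))
  have h' := h.mul_left (e / 2)
  refine h'.of_eq (fun k => ?_) rfl
  have : (2 * (k : ℝ) + 1) ≠ 0 := by positivity
  field_simp
  ring

lemma hasSum_log_combination {x : ℝ} (h0 : 0 ≤ x) (h1 : x < 1) :
    HasSum (fun k : ℕ => (-(3 / (4 * ((k : ℝ) + 1))) + 1 / (4 * (k : ℝ))) * x ^ (k + 1))
      ((3 - x) / 4 * Real.log (1 - x)) := by
  have hx : |x| < 1 := by rwa [abs_of_nonneg h0]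
  have ha := (Real.hasSum_pow_div_log_of_abs_lt_one hx)
  have hb : HasSum (fun k : ℕ => x ^ (k + 1) / (k : ℝ)) (x * -Real.log (1 - x)) := by
    rw [← hasSum_nat_add_iff' 1]
    have := ha.mul_left x
    simp only [range_one, sum_singleton, CharP.cast_eq_zero, div_zero, sub_zero]
    refine this.of_eq (fun k => ?_) rfl
    push_cast
    ring
  have h := (ha.mul_left (-(3 / 4))).add (hb.mul_left (1 / 4))
  refine h.of_eq (fun k => ?_) (by ring)
  · rcases Nat.eq_zero_or_pos k with rfl | hk
    · simp
    · have : (k : ℝ) ≠ 0 := by positivity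
      have : (k : ℝ) + 1 ≠ 0 := by positivity
      field_simp

lemma partial_sum_le {e x : ℝ} (h0 : 0 ≤ e) (h1 : e < 1) (hx : x = e ^ 2) :
    x / 4 + 5 / 24 * x ^ 2 + 3 / 40 * x ^ 3 + 13 / 336 * x ^ 4 + 17 / 720 * x ^ 5
      + 7 / 440 * x ^ 6 ≤ (3 - x) / 4 * Real.log (1 - x) + mulArtanh e := by
  have hx0 : 0 ≤ x := by rw [hx]; positivity
  have hx1 : x < 1 := by rw [hx]; nlinarith
  have h := (hasSum_log_combination hx0 hx1).add (hasSum_mulArtanh h0 h1)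
  have := sum_le_hasSum (range 6) (fun k _ => ?_) h
  · refine le_trans (le_of_eq ?_) this
    simp only [sum_range_succ, range_zero, sum_empty, ← hx]
    norm_num
    ring
  · rw [← hx, ← add_mul]
    refine mul_nonneg ?_ (by positivity)
    rcases Nat.eq_zero_or_pos k with rfl | hk
    · norm_num
    · have hk : (0 : ℝ) < k := by exact_mod_cast hk
      rw [show -(3 / (4 * ((k : ℝ) + 1))) + 1 / (4 * k) + 1 / (2 * k + 1)
        = (4 * k + 1) / (4 * k * (k + 1) * (2 * k + 1)) by field_simp; ring]
      positivity

lemma le_mulArtanh {e : ℝ} (h0 : 0 ≤ e) (h1 : e < 1) : e ^ 2 ≤ mulArtanh e := by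
  have := sum_le_hasSum (range 1) (fun k _ => by positivity) (hasSum_mulArtanh h0 h1)
  simpa using this

lemma shifted_polynomial_nonneg {s : ℝ} (hs1 : -(14 / 100) ≤ s) (hs2 : s ≤ 7 / 100) :
    0 ≤ (2015503765349279/10828125000000000000)
        + (404314119930691/433125000000000000) * s
        + (1196933846100667/8662500000000000) * s ^ 2 + (29052139284397/86625000000000) * s ^ 3
        + (-225969306401/1732500000000) * s ^ 4 + (-105157933/9900000000) * s ^ 5
        + (-99090997/66000000) * s ^ 6 + (-52021/105000) * s ^ 7 + (-1021/2800) * s ^ 8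
        + (-1/8) * s ^ 9 := by
  have b : s ^ 2 ≤ (14 / 100) ^ 2 := by nlinarith
  have lo : ∀ k : ℕ, -(14 / 100) * s ^ (2 * k) ≤ s ^ (2 * k) * s := fun k => by
    rw [mul_comm]
    exact mul_le_mul_of_nonneg_left hs1 (by rw [pow_mul]; positivity)
  have up : ∀ k : ℕ, s ^ (2 * k) * s ≤ 7 / 100 * s ^ (2 * k) := fun k => by
    rw [mul_comm (7 / 100)]
    exact mul_le_mul_of_nonneg_left hs2 (by rw [pow_mul]; positivity)
  have ev : ∀ k : ℕ, s ^ (2 * k) * s ^ 2 ≤ s ^ (2 * k) * (14 / 100) ^ 2 := fun k =>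
    mul_le_mul_of_nonneg_left b (by rw [pow_mul]; positivity)
  have l1 := lo 1
  have u2 := up 2
  have u3 := up 3
  have u4 := up 4
  have e1 := ev 1
  have e2 := ev 2
  have e3 := ev 3
  simp only [← pow_add, ← pow_succ] at l1 u2 u3 u4 e1 e2 e3
  norm_num at l1 u2 u3 u4 e1 e2 e3
  have f1 : 0 ≤ (s + 1 / 100) ^ 2 := sq_nonneg _
  have f2 := sq_nonneg s
  linarith

lemma degree_eight_polynomial_nonneg {x : ℝ} (hx0 : 0 ≤ x) (h : x ≤ 1 / 5) :
    0 ≤ 0.06 - 0.41667 * x + 1.03333 * x ^ 2 - 1.56548 * x ^ 3 + 3.0111 * x ^ 4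
        - 6.02576 * x ^ 5 + 12.994 * x ^ 6 - 234.304 * x ^ 7 - 0.125 * x ^ 8 := by
  have b : x ^ 2 ≤ 1 / 25 := by nlinarith
  have c : ∀ k : ℕ, x ^ k * x ≤ x ^ k * (1 / 5) := fun k =>
    mul_le_mul_of_nonneg_left h (by positivity)
  have c3 := c 2
  have c4 := c 3
  have c5 := c 4
  have c6 := c 5
  have c7 := c 6
  have c8 := c 7
  simp only [← pow_succ] at c3 c4 c5 c6 c7 c8
  norm_num at c3 c4 c5 c6 c7 c8
  have b4 : 0 ≤ x ^ 4 := by positivity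
  have b6 : 0 ≤ x ^ 6 := by positivity
  have f2 := sq_nonneg (x - 1 / 5)
  linarith

/-- The function bounding the entropy of the JPL distance. -/
noncomputable def entropyMajorant (e : ℝ) : ℝ :=
  (1 + e ^ 2) * Real.log (1 + e ^ 2) + (3 - e ^ 2) / 4 * Real.log (1 - e ^ 2)
    - (1 + 3 * e ^ 2) / 4 * Real.log (1 + 3 * e ^ 2) + mulArtanh e

lemma mul_le_entropyMajorant {e : ℝ} (h0 : 0 ≤ e) (h1 : e ^ 2 ≤ 84 / 205) :
    0.44 * e ^ 2 ≤ entropyMajorant e := by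
  obtain ⟨x, hx⟩ : ∃ x, x = e ^ 2 := ⟨_, rfl⟩
  have hx0 : 0 ≤ x := by rw [hx]; positivity
  have he1 : e < 1 := by nlinarith
  have hp := partial_sum_le h0 he1 hx
  rw [entropyMajorant, ← hx]
  rw [← hx] at h1
  have hT := logTaylor_le_log (n := 8) (by decide) hx0
  have hT' := mul_le_mul_of_nonneg_left hT (show 0 ≤ 1 + x by linarith)
  simp only [logTaylor, sum_range_succ, range_zero, sum_empty] at hT'
  norm_num at hT'
  rcases le_total x (1 / 5) with h | h
  · have hL := log_le_logTaylor (n := 7) (by decide) (show -1 < 3 * x by linarith)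
    have hL' := mul_le_mul_of_nonneg_left hL (show 0 ≤ (1 + 3 * x) / 4 by linarith)
    simp only [logTaylor, sum_range_succ, range_zero, sum_empty] at hL'
    norm_num at hL'
    suffices H : 0 ≤ x * (0.06 - 0.41667 * x + 1.03333 * x ^ 2 - 1.56548 * x ^ 3 + 3.0111 * x ^ 4
        - 6.02576 * x ^ 5 + 12.994 * x ^ 6 - 234.304 * x ^ 7 - 0.125 * x ^ 8) by
      have e2 : 0 ≤ x ^ 2 := by positivity
      have e3 : 0 ≤ x ^ 3 := by positivity
      have e4 : 0 ≤ x ^ 4 := by positivity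
      have e5 : 0 ≤ x ^ 5 := by positivity
      have e6 : 0 ≤ x ^ 6 := by positivity
      have e7 : 0 ≤ x ^ 7 := by positivity
      have e8 : 0 ≤ x ^ 8 := by positivity
      linarith
    exact mul_nonneg hx0 (degree_eight_polynomial_nonneg hx0 h)
  · have hL := log_le_logTaylor (n := 5) (by decide) (show -1 < (3 * x - 1) / 2 by linarith)
    have h2 : Real.log (1 + 3 * x) ≤ 0.6931471808 + logTaylor 5 ((3 * x - 1) / 2) := by
      rw [show 1 + 3 * x = 2 * (1 + (3 * x - 1) / 2) by ring,
        Real.log_mul (by norm_num) (by linarith)]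
      linarith [Real.log_two_lt_d9]
    have hL' := mul_le_mul_of_nonneg_left h2 (show 0 ≤ (1 + 3 * x) / 4 by linarith)
    simp only [logTaylor, sum_range_succ, range_zero, sum_empty] at hL'
    norm_num at hL'
    obtain ⟨s, hs⟩ : ∃ s, s = x - 34 / 100 := ⟨_, rfl⟩
    have hs1 : -(14 / 100) ≤ s := by linarith
    have hs2 : s ≤ 7 / 100 := by linarith
    obtain rfl : x = s + 34 / 100 := by linarith
    have b2 : 0 ≤ s ^ 2 := by positivity
    have hE := shifted_polynomial_nonneg hs1 hs2
    linarith

end ScalarInequalities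

section OverlapExponent

lemma binEntropy_le_of_sq_add_sq {x s : ℝ} (hx0 : 0 < x) (hx1 : x ≤ 84 / 205) (hs : 0 ≤ s)
    (hxs : x ^ 2 + s ^ 2 = 1) : Real.binEntropy ((1 - s) / 2) ≤ 0.44 * x := by
  have hs' : 187 / 205 ≤ s := by nlinarith
  obtain ⟨w, hw⟩ : ∃ w, w = x / (1 + s) := ⟨_, rfl⟩
  have hw0 : 0 < w := by rw [hw]; positivity
  have hw1 : w ≤ 3 / 14 := by
    rw [hw, div_le_iff₀ (by positivity)]
    linarith
  have hss : w ^ 2 = (1 - s) / (1 + s) := by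
    rw [hw, div_pow, div_eq_div_iff (by positivity) (by positivity)]
    linear_combination (1 + s) * hxs
  have hsw : s = (1 - w ^ 2) / (1 + w ^ 2) := by
    rw [hss]
    field_simp
    ring
  have hxw : x = 2 * w / (1 + w ^ 2) := by
    rw [hss, hw]
    field_simp
    ring
  have hlogT : Real.log (1 + w ^ 2) ≤ w ^ 2 - w ^ 4 / 2 + w ^ 6 / 3 := by
    have := log_le_logTaylor (n := 3) (by decide) (x := w ^ 2) (by nlinarith)
    simp only [logTaylor, sum_range_succ, range_zero, sum_empty] at this
    norm_num at this
    linarith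
  have hH : Real.binEntropy ((1 - s) / 2)
      = Real.log (1 + w ^ 2) - 2 * w ^ 2 / (1 + w ^ 2) * Real.log w := by
    have h1 : (1 - s) / 2 = w ^ 2 / (1 + w ^ 2) := by
      rw [hsw]
      field_simp
      ring
    have h2 : 1 - w ^ 2 / (1 + w ^ 2) = 1 / (1 + w ^ 2) := by
      field_simp
      ring
    rw [h1, Real.binEntropy, h2, inv_div, inv_div, Real.log_div (by positivity) (by positivity),
      Real.log_pow, div_one]
    push_cast
    field_simp
    ring
  have hlogw : -Real.log w ≤ 1.5407 + (3 / 14 / w - 1) := by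
    have h1 := Real.log_le_sub_one_of_pos (show 0 < 3 / 14 / w by positivity)
    rw [Real.log_div (by norm_num) hw0.ne'] at h1
    have h2 : -Real.log (3 / 14) ≤ 1.5407 := by
      have h3 := log_le_logTaylor (n := 3) (by decide) (x := 1 / 6) (by norm_num)
      simp only [logTaylor, sum_range_succ, range_zero, sum_empty] at h3
      norm_num at h3
      rw [← Real.log_inv, show ((3 : ℝ) / 14)⁻¹ = 2 ^ 2 * (7 / 6) by norm_num,
        Real.log_mul (by norm_num) (by norm_num), Real.log_pow]
      push_cast
      linarith [Real.log_two_lt_d9]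
    linarith
  rw [hH, hxw]
  have h5 : 2 * w * -Real.log w ≤ 2 * w * (1.5407 + (3 / 14 / w - 1)) :=
    mul_le_mul_of_nonneg_left hlogw (by positivity)
  have h6 : 2 * w * (1.5407 + (3 / 14 / w - 1)) = 2 * w * 0.5407 + 3 / 7 := by
    field_simp
    ring
  have h7 : (1 + w ^ 2) * Real.log (1 + w ^ 2) ≤ (1 + w ^ 2) * (w ^ 2 - w ^ 4 / 2 + w ^ 6 / 3) :=
    mul_le_mul_of_nonneg_left hlogT (by positivity)
  have h8 : (1 + w ^ 2) * (w - w ^ 3 / 2 + w ^ 5 / 3) + 2 * w * 0.5407 + 3 / 7 ≤ 0.88 := by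
    have m1 : w ^ 2 ≤ (3 / 14) ^ 2 := pow_le_pow_left₀ hw0.le hw1 2
    have m2 : w ^ 3 ≤ (3 / 14) ^ 3 := pow_le_pow_left₀ hw0.le hw1 3
    have m3 : w ^ 7 ≤ (3 / 14) ^ 7 := pow_le_pow_left₀ hw0.le hw1 7
    have m4 : 0 ≤ w ^ 5 := by positivity
    norm_num at m1 m2 m3
    nlinarith
  have h9 : Real.log (1 + w ^ 2) - 2 * w ^ 2 / (1 + w ^ 2) * Real.log w
      = ((1 + w ^ 2) * Real.log (1 + w ^ 2) + w * (2 * w * -Real.log w)) / (1 + w ^ 2) := by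
    field_simp
    ring
  rw [h9, ← mul_div_assoc]
  refine div_le_div_of_nonneg_right ?_ (by positivity)
  have h10 := mul_le_mul_of_nonneg_left (h5.trans_eq h6) hw0.le
  have h11 := mul_le_mul_of_nonneg_left h8 hw0.le
  nlinarith

lemma slope_nonneg {x : ℝ} (h0 : 0 ≤ x) (h1 : x < 1) :
    0 ≤ 2 * Real.log (1 + x) - 1 / 2 * Real.log (1 - x) - 3 / 2 * Real.log (1 + 3 * x)
      + 2 * x / (1 + x) := by
  have hd : ∀ y : ℝ, 0 ≤ y → y < 1 → HasDerivAt (fun y => 2 * Real.log (1 + y)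
      - 1 / 2 * Real.log (1 - y) - 3 / 2 * Real.log (1 + 3 * y) + 2 * y / (1 + y))
      (8 * y / ((1 + y) ^ 2 * (1 - y) * (1 + 3 * y))) y := by
    intro y hy0 hy1
    have a1 : 1 + y ≠ 0 := by positivity
    have a2 : 1 - y ≠ 0 := by linarith
    have a3 : 1 + 3 * y ≠ 0 := by positivity
    have d1 := ((hasDerivAt_id y).const_add 1).log a1
    have d2 := ((hasDerivAt_id y).const_sub 1).log a2
    have d3 := (((hasDerivAt_id y).const_mul 3).const_add 1).log a3
    have d4 := ((hasDerivAt_id y).const_mul 2).fun_div ((hasDerivAt_id y).const_add 1) a1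
    refine ((((d1.const_mul 2).sub (d2.const_mul (1 / 2))).sub (d3.const_mul (3 / 2))).add
      d4).congr_deriv ?_
    simp only [id]
    field_simp
    ring
  have hm : MonotoneOn (fun y => 2 * Real.log (1 + y)
      - 1 / 2 * Real.log (1 - y) - 3 / 2 * Real.log (1 + 3 * y) + 2 * y / (1 + y))
      (Set.Icc 0 x) := by
    refine monotoneOn_of_hasDerivWithinAt_nonneg (convex_Icc 0 x)
      (fun y hy => (hd y hy.1 (hy.2.trans_lt h1)).continuousAt.continuousWithinAt)
      (fun y hy => (hd y ?_ ?_).hasDerivWithinAt) fun y hy => ?_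
    · exact (interior_subset hy).1
    · exact (interior_subset hy).2.trans_lt h1
    · have a := (interior_subset hy).1
      have b : 0 ≤ 1 - y := by linarith [(interior_subset hy).2]
      positivity
  have := hm (Set.left_mem_Icc.2 h0) (Set.right_mem_Icc.2 h0) h0
  simpa using this

/-- The exponential growth rate of the overlap sums in the low-rate bound. -/
noncomputable def overlapExponent (e u t : ℝ) : ℝ :=
  (u + min u (2 * t)) * (Real.log (1 + e ^ 2) - Real.log (1 - e ^ 2))
    + (2 * Real.log (1 + e) - Real.log 2 - Real.log (1 + e ^ 2))
    + ((1 - e) ^ 2 / (2 * (1 + e ^ 2)) * (1 - u) - 3 / 2 * u)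
      * (Real.log (1 + e) - Real.log (1 - e))
    + 2 * t * (Real.log 2 - Real.log (1 + e)) + (u - t) * (Real.log 2 - Real.log (1 - e))
    + (1 - u - t) * (Real.log 2 + Real.log (1 + 3 * e ^ 2) - 3 * Real.log (1 + e))

lemma overlapExponent_le_half {e u t : ℝ} (h0 : 0 < e) (h1 : e < 1) :
    overlapExponent e u t ≤ overlapExponent e u (u / 2) := by
  have hx : Real.log (1 - e ^ 2) = Real.log (1 + e) + Real.log (1 - e) := by
    rw [← Real.log_mul (by linarith) (by linarith)]
    ring_nf
  have hx1 : e ^ 2 < 1 := by nlinarith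
  have s1 : Real.log (1 - e ^ 2) + Real.log (1 + 3 * e ^ 2) ≤ 2 * Real.log (1 + e ^ 2) := by
    rw [← Real.log_mul (by linarith) (by positivity),
      show 2 * Real.log (1 + e ^ 2) = Real.log ((1 + e ^ 2) ^ 2) by rw [Real.log_pow]; norm_num]
    refine Real.log_le_log (mul_pos (by linarith) (by positivity)) ?_
    nlinarith [sq_nonneg (e ^ 2)]
  have s2 : Real.log (1 - e ^ 2) ≤ Real.log (1 + 3 * e ^ 2) :=
    Real.log_le_log (by linarith) (by nlinarith)
  simp only [overlapExponent]
  rw [show 2 * (u / 2) = u by ring, min_self]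
  rcases le_total (2 * t) u with h | h
  · rw [min_eq_right h]
    nlinarith
  · rw [min_eq_left h]
    nlinarith

lemma overlapExponent_le {e u t δ : ℝ} (h0 : 0 < e) (h1 : e ^ 2 ≤ 84 / 205)
    (hu : u ≤ (1 - e ^ 2) / 2 + δ) :
    overlapExponent e u t ≤ Real.log (1 + e ^ 2)
      - Real.binEntropy ((1 - Real.sqrt (1 - (e ^ 2) ^ 2)) / 2)
      + δ * (2 * Real.log (1 + e ^ 2) - 1 / 2 * Real.log (1 - e ^ 2)
        - 3 / 2 * Real.log (1 + 3 * e ^ 2) + 2 * mulArtanh e / (1 + e ^ 2)) := by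
  have he1 : e < 1 := by nlinarith
  refine (overlapExponent_le_half h0 he1).trans ?_
  have hx : Real.log (1 - e ^ 2) = Real.log (1 + e) + Real.log (1 - e) := by
    rw [← Real.log_mul (by linarith) (by linarith)]
    ring_nf
  have hx1 : e ^ 2 < 1 := by linarith
  have hH := binEntropy_le_of_sq_add_sq (x := e ^ 2) (by positivity) h1
    (Real.sqrt_nonneg (1 - (e ^ 2) ^ 2)) (by rw [Real.sq_sqrt (by nlinarith)]; ring)
  have hW := mul_le_entropyMajorant h0.le h1
  obtain ⟨σ, hσ⟩ : ∃ σ, σ = 2 * Real.log (1 + e ^ 2) - 1 / 2 * Real.log (1 - e ^ 2)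
        - 3 / 2 * Real.log (1 + 3 * e ^ 2) + 2 * mulArtanh e / (1 + e ^ 2) := ⟨_, rfl⟩
  have hσ0 : 0 ≤ σ := by
    have a := slope_nonneg (sq_nonneg e) hx1
    have b := div_le_div_of_nonneg_right (le_mulArtanh h0.le he1)
      (show (0 : ℝ) ≤ 1 + e ^ 2 by positivity)
    rw [hσ]
    rw [mul_div_assoc] at a ⊢
    linarith
  rw [← hσ]
  have key : overlapExponent e u (u / 2) = -Real.log (1 + e ^ 2)
      + Real.log (1 + 3 * e ^ 2) - 1 / 2 * Real.log (1 - e ^ 2)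
      - 2 * mulArtanh e / (1 + e ^ 2) + u * σ := by
    simp only [overlapExponent]
    rw [show 2 * (u / 2) = u by ring, min_self, hσ, hx, mulArtanh]
    field_simp
    ring
  have hfin : (1 - e ^ 2) / 2 * σ = -entropyMajorant e + 2 * Real.log (1 + e ^ 2)
      - Real.log (1 + 3 * e ^ 2) + 1 / 2 * Real.log (1 - e ^ 2)
      + 2 * mulArtanh e / (1 + e ^ 2) := by
    rw [hσ, entropyMajorant]
    field_simp
    ring
  have := mul_le_mul_of_nonneg_right hu hσ0
  rw [key]
  linarith

end OverlapExponent

section Overlap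

variable {n : ℕ}

/-- Probability of the noise pattern `E` on the binary symmetric channel. -/
noncomputable def noiseProb (p : ℝ) (E : Finset (Fin n)) : ℝ :=
  p ^ E.card * (1 - p) ^ (n - E.card)

lemma noiseProb_nonneg {p : ℝ} (h0 : 0 ≤ p) (h1 : p ≤ 1) (E : Finset (Fin n)) :
    0 ≤ noiseProb p E :=
  mul_nonneg (pow_nonneg h0 _) (pow_nonneg (by linarith) _)

lemma noiseProb_eq {p r : ℝ} (hr : (1 - p) * r ^ 2 = p) (E : Finset (Fin n)) :
    noiseProb p E = (1 - p) ^ n * r ^ (2 * E.card) := by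
  have hE : E.card ≤ n := by simpa using card_le_univ E
  rw [noiseProb]
  nth_rewrite 1 [← hr]
  rw [mul_pow, ← pow_mul, mul_right_comm, ← pow_add, Nat.add_sub_cancel' hE]

/-- Noise patterns meeting `D` in exactly `c` points and its complement in at most `m`. -/
def overlapSet (D : Finset (Fin n)) (c m : ℕ) : Finset (Finset (Fin n)) :=
  univ.filter fun E => (E ∩ D).card = c ∧ (E \ D).card ≤ m

lemma binomial_mean (N : ℕ) (p : ℝ) :
    ∑ k ∈ range (N + 1), (k : ℝ) * (N.choose k * (p ^ k * (1 - p) ^ (N - k))) = N * p := by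
  have h := congrArg (Polynomial.eval p) (bernsteinPolynomial.sum_smul ℝ N)
  simp only [Polynomial.eval_finsetSum, bernsteinPolynomial, nsmul_eq_mul, Polynomial.eval_mul,
    Polynomial.eval_natCast, Polynomial.eval_pow, Polynomial.eval_sub, Polynomial.eval_one,
    Polynomial.eval_X] at h
  rw [← h]
  exact sum_congr rfl fun k _ => by ring

lemma binomial_total (N : ℕ) (p : ℝ) :
    ∑ k ∈ range (N + 1), (N.choose k * (p ^ k * (1 - p) ^ (N - k))) = 1 := by
  have h := add_pow p (1 - p) N
  rw [add_sub_cancel, one_pow] at h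
  exact (sum_congr rfl fun k _ => by ring).trans h.symm

lemma binomial_lower_tail {N n m : ℕ} {p ε : ℝ} (hN : N ≤ n) (h0 : 0 < p) (h1 : p ≤ 1) (hε : 0 < ε)
    (hm : p * N + ε * n ≤ m + 1) :
    ε / (p + ε) ≤ ∑ k ∈ range (N + 1) with k ≤ m, (N.choose k * (p ^ k * (1 - p) ^ (N - k))) := by
  have hw : ∀ k, 0 ≤ (N.choose k * (p ^ k * (1 - p) ^ (N - k)) : ℝ) := fun k => by
    have : 0 ≤ 1 - p := by linarith
    positivity
  have hsplit := sum_filter_add_sum_filter_not (range (N + 1)) (fun k => k ≤ m)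
    (fun k => (N.choose k * (p ^ k * (1 - p) ^ (N - k)) : ℝ))
  rw [binomial_total] at hsplit
  have hbad : ((m : ℝ) + 1) * ∑ k ∈ range (N + 1) with ¬ k ≤ m,
      (N.choose k * (p ^ k * (1 - p) ^ (N - k)) : ℝ) ≤ N * p := by
    rw [← binomial_mean, mul_sum]
    refine (sum_le_sum fun k hk => ?_).trans
      (sum_le_sum_of_subset_of_nonneg (filter_subset _ _) fun k _ _ =>
        mul_nonneg k.cast_nonneg (hw k))
    refine mul_le_mul_of_nonneg_right ?_ (hw k)
    have := (mem_filter.1 hk).2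
    exact_mod_cast (by omega : m + 1 ≤ k)
  obtain ⟨b, hb⟩ : ∃ b, b = ∑ k ∈ range (N + 1) with ¬ k ≤ m,
      (N.choose k * (p ^ k * (1 - p) ^ (N - k)) : ℝ) := ⟨_, rfl⟩
  rw [← hb] at hbad hsplit
  have hm' : (p + ε) * N ≤ m + 1 := by
    have : (N : ℝ) ≤ n := by exact_mod_cast hN
    nlinarith
  have hm0 : (0 : ℝ) < m + 1 := by positivity
  have hb1 : (p + ε) * b ≤ p := by
    have : (m + 1 : ℝ) * ((p + ε) * b) ≤ (m + 1) * p := by nlinarith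
    exact le_of_mul_le_mul_left this hm0
  rw [div_le_iff₀ (by positivity)]
  nlinarith

lemma sum_powerset_lower_tail {s : Finset (Fin n)} {m : ℕ} {p ε : ℝ} (h0 : 0 < p) (h1 : p ≤ 1)
    (hε : 0 < ε) (hm : p * s.card + ε * n ≤ m + 1) :
    ε / (p + ε) ≤ ∑ F ∈ s.powerset with F.card ≤ m, p ^ F.card * (1 - p) ^ (s.card - F.card) := by
  have hs : s.card ≤ n := by simpa using card_le_univ s
  refine (binomial_lower_tail hs h0 h1 hε hm).trans (le_of_eq ?_)
  rw [sum_filter, sum_filter]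
  rw [sum_powerset_apply_card (fun k => if k ≤ m then p ^ k * (1 - p) ^ (s.card - k) else 0)]
  refine sum_congr rfl fun k _ => ?_
  rw [nsmul_eq_mul]
  split_ifs <;> simp

lemma two_pow_le_choose_half (u : ℕ) :
    (2 : ℝ) ^ u ≤ (u + 1) * (u.choose ((u + 1) / 2) : ℝ) := by
  have h : u.choose ((u + 1) / 2) = u.choose (u / 2) := by
    rw [← Nat.choose_symm (show u / 2 ≤ u by omega)]
    congr 1
    omega
  have h2 : 2 ^ u ≤ (u + 1) * u.choose (u / 2) := by
    rw [← Nat.sum_range_choose]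
    refine (sum_le_sum fun k _ => Nat.choose_le_middle k u).trans ?_
    simp
  rw [h]
  exact_mod_cast h2

lemma le_sum_overlapSet {D : Finset (Fin n)} {u m : ℕ} {p r B ε : ℝ} (hD : D.card = u)
    (h0 : 0 < p) (h1 : p < 1) (hr0 : 0 < r) (hr1 : r ≤ 1) (hr : (1 - p) * r ^ 2 = p)
    (hB : B = 2 * ((1 - p) * r)) (hε : 0 < ε) (hm : p * (n - u) + ε * n ≤ m + 1) :
    B ^ u * (r / (n + 1) * (ε / (p + ε)))
      ≤ ∑ E ∈ overlapSet D ((u + 1) / 2) m, noiseProb p E := by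
  obtain ⟨c, hc⟩ : ∃ c, c = (u + 1) / 2 := ⟨_, rfl⟩
  have hu : u ≤ n := by rw [← hD]; simpa using card_le_univ D
  have hq : 0 < 1 - p := by linarith
  have hcompl : (Dᶜ).card = n - u := by rw [card_compl, hD, Fintype.card_fin]
  have hU : ∀ {F F' : Finset (Fin n)}, F ⊆ D → F' ⊆ Dᶜ →
      (F ∪ F') ∩ D = F ∧ (F ∪ F') \ D = F' := by
    refine fun {F F'} hF hF' => ⟨?_, ?_⟩ <;>
    · ext a
      have h1 := @hF a
      have h2 := @hF' a
      simp only [mem_compl, mem_inter, Finset.mem_sdiff, mem_union] at h2 ⊢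
      tauto
  have hsum : ∑ E ∈ overlapSet D c m, noiseProb p E
      = (u.choose c * (p ^ c * (1 - p) ^ (u - c))) * ∑ F ∈ (Dᶜ).powerset with F.card ≤ m,
        p ^ F.card * (1 - p) ^ ((Dᶜ).card - F.card) := by
    rw [← hD, ← card_powersetCard, ← nsmul_eq_mul, ← sum_const, sum_mul_sum,
      ← sum_product']
    refine sum_nbij' (fun E => (E ∩ D, E \ D)) (fun F => F.1 ∪ F.2) ?_ ?_ ?_ ?_ ?_
    · intro E hE
      simp only [overlapSet, mem_filter, mem_univ, true_and] at hE
      simp only [mem_product, mem_powersetCard, mem_filter, mem_powerset, inter_subset_right,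
        true_and, hE, and_true]
      intro a ha
      simp_all
    · rintro ⟨F, F'⟩ hF
      simp only [mem_product, mem_powersetCard, mem_filter, mem_powerset] at hF
      obtain ⟨e1, e2⟩ := hU hF.1.1 hF.2.1
      simp [overlapSet, e1, e2, hF]
    · intro E _
      ext a
      simp only [mem_union, mem_inter, Finset.mem_sdiff]
      tauto
    · rintro ⟨F, F'⟩ hF
      simp only [mem_product, mem_powersetCard, mem_filter, mem_powerset] at hF
      obtain ⟨e1, e2⟩ := hU hF.1.1 hF.2.1
      simp [e1, e2]
    · intro E hE
      simp only [overlapSet, mem_filter, mem_univ, true_and] at hE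
      have hcard : E.card = c + (E \ D).card := by
        rw [← hE.1, add_comm, card_sdiff_add_card_inter]
      have hcD : c ≤ D.card := by rw [← hE.1]; exact card_le_card inter_subset_right
      have hle : (E \ D).card ≤ (Dᶜ).card := card_le_card fun a ha => by simp_all
      have hn : n = D.card + (Dᶜ).card := by rw [hcompl]; omega
      simp only [noiseProb]
      rw [hcard, pow_add]
      have : n - (c + (E \ D).card) = (D.card - c) + ((Dᶜ).card - (E \ D).card) := by omega
      rw [this, pow_add]
      ring
  rw [← hc, hsum]
  have htail : ε / (p + ε) ≤ ∑ F ∈ (Dᶜ).powerset with F.card ≤ m,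
      p ^ F.card * (1 - p) ^ ((Dᶜ).card - F.card) := by
    refine sum_powerset_lower_tail h0 h1.le hε ?_
    rw [hcompl, Nat.cast_sub hu]
    exact hm
  rw [← mul_assoc]
  refine mul_le_mul ?_ htail (by positivity) (by positivity)
  have hcu : c ≤ u ∨ u = 0 := by omega
  have hcu : c ≤ u := by omega
  have h3 : p ^ c * (1 - p) ^ (u - c) = (1 - p) ^ u * r ^ (2 * c) := by
    nth_rewrite 1 [← hr]
    rw [mul_pow, ← pow_mul, mul_right_comm, ← pow_add, Nat.add_sub_cancel' hcu]
  have h4 : r ^ (u + 1) ≤ r ^ (2 * c) := pow_le_pow_of_le_one hr0.le hr1 (by omega)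
  have h5 := two_pow_le_choose_half u
  rw [← hc] at h5
  rw [h3]
  have hun : (u : ℝ) + 1 ≤ n + 1 := by exact_mod_cast Nat.succ_le_succ hu
  have h6 : (2 : ℝ) ^ u / (n + 1) ≤ u.choose c := by
    rw [div_le_iff₀ (by positivity)]
    refine h5.trans ?_
    rw [mul_comm]
    exact mul_le_mul_of_nonneg_left hun (by positivity)
  calc B ^ u * (r / (n + 1)) = (2 : ℝ) ^ u / (n + 1) * ((1 - p) ^ u * r ^ (u + 1)) := by
        rw [hB, mul_pow, mul_pow, pow_succ]
        ring
    _ ≤ _ := mul_le_mul h6 (mul_le_mul_of_nonneg_left h4 (by positivity)) (by positivity)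
        (by positivity)

/-- Upper bound for the probability of two overlapping sets with centres at distance `2 t`. -/
noncomputable def pairBound (n : ℕ) (p r : ℝ) (c m u t : ℕ) : ℝ :=
  (1 - p) ^ n * r ^ (4 * c) * (r⁻¹) ^ (c + m)
    * ((1 + r ^ 3) ^ (n - u - t) * (1 + r) ^ (2 * t) * (1 + r⁻¹) ^ (u - t))

lemma card_symmDiff_eq {D D' : Finset (Fin n)} {u : ℕ} (hD : D.card = u) (hD' : D'.card = u) :
    ∃ t ≤ u, u + t ≤ n ∧ (symmDiff D D').card = 2 * t ∧ (D ∩ D').card = u - t ∧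
      (D ∪ D').card = u + t := by
  have h1 := card_union_add_card_inter D D'
  have h2 : (D ∪ D').card ≤ n := by simpa using card_le_univ (D ∪ D')
  have h3 : (D ∩ D').card ≤ u := by rw [← hD]; exact card_le_card inter_subset_left
  have h4 : (symmDiff D D').card = (D ∪ D').card - (D ∩ D').card := by
    rw [symmDiff_eq_sup_sdiff_inf]
    exact card_sdiff_of_subset (inter_subset_left.trans subset_union_left)
  exact ⟨u - (D ∩ D').card, by omega, by omega, by omega, by omega, by omega⟩

lemma sum_inter_overlapSet_le {D D' : Finset (Fin n)} {u t c m : ℕ} {p r : ℝ} (hD : D.card = u)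
    (hD' : D'.card = u) (ht : (symmDiff D D').card = 2 * t) (h1 : p < 1)
    (hr0 : 0 < r) (hr1 : r ≤ 1) (hr : (1 - p) * r ^ 2 = p) :
    ∑ E ∈ overlapSet D c m ∩ overlapSet D' c m, noiseProb p E ≤ pairBound n p r c m u t := by
  have hq : 0 < 1 - p := by linarith
  obtain ⟨φ, hφ⟩ : ∃ φ : Fin n → ℝ, φ = fun a =>
    r ^ 3 * ((if a ∈ D then (r⁻¹) ^ 2 else 1) * (if a ∈ D' then (r⁻¹) ^ 2 else 1)) := ⟨_, rfl⟩
  have hφ0 : ∀ a, 0 ≤ φ a := fun a => by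
    rw [hφ]
    positivity
  have hprod : ∀ E : Finset (Fin n), ∏ a ∈ E, φ a
      = r ^ (3 * E.card) * ((r⁻¹) ^ (2 * (E ∩ D).card) * (r⁻¹) ^ (2 * (E ∩ D').card)) := by
    intro E
    rw [hφ]
    simp only [prod_mul_distrib, prod_const, prod_ite_mem, ← pow_mul]
  calc ∑ E ∈ overlapSet D c m ∩ overlapSet D' c m, noiseProb p E
      ≤ ∑ E ∈ overlapSet D c m ∩ overlapSet D' c m,
        (1 - p) ^ n * r ^ (4 * c) * (r⁻¹) ^ (c + m) * ∏ a ∈ E, φ a := by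
        refine sum_le_sum fun E hE => ?_
        simp only [overlapSet, mem_inter, mem_filter, mem_univ, true_and] at hE
        rw [noiseProb_eq hr, hprod, hE.1.1, hE.2.1]
        have hcard : E.card ≤ c + m := by
          have := card_sdiff_add_card_inter E D
          omega
        have e1 : r ^ (3 * E.card) = r ^ (2 * E.card) * r ^ E.card := by
          rw [← pow_add]; congr 1; ring
        have e2 : r ^ (c + m) ≤ r ^ E.card := pow_le_pow_of_le_one hr0.le hr1 hcard
        have e3 : r ^ (4 * c) * (r⁻¹ ^ (2 * c) * r⁻¹ ^ (2 * c)) = 1 := by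
          rw [← pow_add, inv_pow, ← two_mul, ← mul_assoc]
          exact mul_inv_cancel₀ (by positivity)
        have e4 : 1 ≤ r⁻¹ ^ (c + m) * r ^ E.card := by
          rw [inv_pow, inv_mul_eq_div, one_le_div (by positivity)]
          exact e2
        calc (1 - p) ^ n * r ^ (2 * E.card)
            ≤ ((1 - p) ^ n * r ^ (2 * E.card)) * (r⁻¹ ^ (c + m) * r ^ E.card) :=
              le_mul_of_one_le_right (by positivity) e4
          _ = (1 - p) ^ n * r ^ (2 * E.card) * (r⁻¹ ^ (c + m) * r ^ E.card)
              * (r ^ (4 * c) * (r⁻¹ ^ (2 * c) * r⁻¹ ^ (2 * c))) := by rw [e3, mul_one]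
          _ = _ := by rw [e1]; ring
    _ ≤ ∑ E : Finset (Fin n), (1 - p) ^ n * r ^ (4 * c) * (r⁻¹) ^ (c + m) * ∏ a ∈ E, φ a :=
        sum_le_sum_of_subset_of_nonneg (subset_univ _) fun E _ _ =>
          mul_nonneg (by positivity) (prod_nonneg fun a _ => hφ0 a)
    _ = pairBound n p r c m u t := by
        rw [← mul_sum, sum_prod_subset, pairBound]
        congr 1
        obtain ⟨t', ht', hut, hs, hi, hun⟩ := card_symmDiff_eq hD hD'
        obtain rfl : t' = t := by omega
        have hrr : r * r⁻¹ = 1 := mul_inv_cancel₀ hr0.ne'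
        rw [← prod_mul_prod_compl (D ∪ D'), ← prod_sdiff (s₁ := D ∩ D') (s₂ := D ∪ D')
          (inter_subset_left.trans subset_union_left)]
        have p1 : ∏ a ∈ (D ∪ D')ᶜ, (1 + φ a) = (1 + r ^ 3) ^ (n - u - t') := by
          rw [prod_congr rfl (g := fun _ => 1 + r ^ 3), prod_const, card_compl, hun,
            Fintype.card_fin, Nat.sub_sub]
          intro a ha
          simp only [mem_compl, mem_union, not_or] at ha
          simp [hφ, ha]
        have p2 : ∏ a ∈ D ∩ D', (1 + φ a) = (1 + r⁻¹) ^ (u - t') := by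
          rw [prod_congr rfl (g := fun _ => 1 + r⁻¹), prod_const, hi]
          intro a ha
          simp only [mem_inter] at ha
          simp only [hφ, ha, if_true]
          field_simp
        have p3 : ∏ a ∈ (D ∪ D') \ (D ∩ D'), (1 + φ a) = (1 + r) ^ (2 * t') := by
          rw [prod_congr rfl (g := fun _ => 1 + r), prod_const,
            show ((D ∪ D') \ (D ∩ D')).card = 2 * t' by rw [← hs, symmDiff_eq_sup_sdiff_inf]; rfl]
          intro a ha
          simp only [Finset.mem_sdiff, mem_union, mem_inter, not_and] at ha
          rcases ha with ⟨h | h, h'⟩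
          · simp only [hφ, h, h' h, if_true, if_false]
            field_simp
          · have : a ∉ D := fun h2 => h' h2 h
            simp only [hφ, h, this, if_true, if_false]
            field_simp
        rw [p1, p2, p3]
        ring

end Overlap

section Neighbours

lemma sq_sum_sum_le {κ Ω : Type*} [DecidableEq Ω] (N : Finset κ) (Y : κ → Finset Ω) (A : Finset Ω)
    (w : Ω → ℝ) (hw : ∀ E, 0 ≤ w E) (hY : ∀ j ∈ N, Y j ⊆ A) :
    (∑ j ∈ N, ∑ E ∈ Y j, w E) ^ 2
      ≤ (∑ E ∈ A, w E) * ∑ j ∈ N, ∑ k ∈ N, ∑ E ∈ Y j ∩ Y k, w E := by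
  obtain ⟨c, hc⟩ : ∃ c : Ω → ℝ, c = fun E => ∑ j ∈ N, if E ∈ Y j then 1 else 0 := ⟨_, rfl⟩
  have h1 : ∑ j ∈ N, ∑ E ∈ Y j, w E = ∑ E ∈ A, w E * c E := by
    simp only [hc, mul_sum]
    rw [sum_comm]
    refine sum_congr rfl fun j hj => ?_
    simp only [mul_ite, mul_one, mul_zero]
    rw [← sum_filter, filter_mem_eq_inter, inter_eq_right.2 (hY j hj)]
  have h2 : ∑ j ∈ N, ∑ k ∈ N, ∑ E ∈ Y j ∩ Y k, w E = ∑ E ∈ A, w E * c E ^ 2 := by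
    have : ∀ E, w E * c E ^ 2
        = ∑ j ∈ N, ∑ k ∈ N, if E ∈ Y j ∩ Y k then w E else 0 := fun E => by
      rw [sq, hc, sum_mul_sum, mul_sum]
      refine sum_congr rfl fun j _ => ?_
      rw [mul_sum]
      refine sum_congr rfl fun k _ => ?_
      by_cases h : E ∈ Y j <;> by_cases h' : E ∈ Y k <;> simp [h, h']
    simp only [this]
    symm
    rw [sum_comm]
    refine sum_congr rfl fun j hj => ?_
    rw [sum_comm]
    refine sum_congr rfl fun k _ => ?_
    rw [← sum_filter, filter_mem_eq_inter,
      inter_eq_right.2 (inter_subset_left.trans (hY j hj))]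
  rw [h1, h2]
  exact sum_sq_le_sum_mul_sum_of_sq_le_mul A (fun E _ => hw E)
    (fun E _ => mul_nonneg (hw E) (sq_nonneg _)) fun E _ => (by ring : _ = _).le

lemma card_mul_le_of_overlap_le {κ Ω : Type*} [DecidableEq κ] [DecidableEq Ω] (N : Finset κ)
    (Y : κ → Finset Ω) (A : Finset Ω) (w : Ω → ℝ) (hw : ∀ E, 0 ≤ w E) (hY : ∀ j ∈ N, Y j ⊆ A)
    {a M : ℝ} (hM : 0 ≤ M) (hlow : ∀ j ∈ N, a ≤ ∑ E ∈ Y j, w E)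
    (hpair : ∀ j ∈ N, ∑ k ∈ N.erase j, ∑ E ∈ Y j ∩ Y k, w E ≤ M * a) :
    N.card * a ≤ (M + 1) * ∑ E ∈ A, w E := by
  obtain ⟨s, hs⟩ : ∃ s, s = ∑ j ∈ N, ∑ E ∈ Y j, w E := ⟨_, rfl⟩
  have hA : 0 ≤ ∑ E ∈ A, w E := sum_nonneg fun E _ => hw E
  have hNs : N.card * a ≤ s := by
    rw [hs, ← nsmul_eq_mul]
    exact card_nsmul_le_sum _ _ _ hlow
  have h1 : ∑ j ∈ N, ∑ k ∈ N, ∑ E ∈ Y j ∩ Y k, w E ≤ (M + 1) * s := by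
    rw [hs, mul_sum]
    refine sum_le_sum fun j hj => ?_
    rw [← add_sum_erase N _ hj, inter_self]
    have := hpair j hj
    have := mul_le_mul_of_nonneg_left (hlow j hj) hM
    linarith
  have h2 := sq_sum_sum_le N Y A w hw hY
  rw [← hs] at h2
  refine hNs.trans ?_
  rcases (show 0 ≤ s by
    rw [hs]; exact sum_nonneg fun j _ => sum_nonneg fun E _ => hw E).eq_or_lt with h | h
  · rw [← h]
    positivity
  · have := mul_le_mul_of_nonneg_left h1 hA
    refine le_of_mul_le_mul_right ?_ h
    nlinarith

variable {n : ℕ}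

lemma symmDiff_symmDiff_eq (X Y Z : Finset (Fin n)) :
    symmDiff (symmDiff X Y) (symmDiff X Z) = symmDiff Y Z := by
  ext a
  simp only [mem_symmDiff]
  tauto

lemma mem_overlapSet_card_le {D E : Finset (Fin n)} {m : ℕ}
    (hE : E ∈ overlapSet D ((D.card + 1) / 2) m) : (symmDiff D E).card ≤ E.card := by
  simp only [overlapSet, mem_filter, mem_univ, true_and] at hE
  have h1 : (symmDiff D E).card ≤ (D \ E).card + (E \ D).card := card_union_le _ _
  have h2 := card_sdiff_add_card_inter D E
  have h3 := card_sdiff_add_card_inter E D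
  rw [inter_comm] at h2
  omega

/-- If the error probability of every codeword of `J` is small, then no codeword of `J` has many
neighbours at a small distance. -/
theorem card_neighbours_le {κ : Type*} [DecidableEq κ] (J : Finset κ) (x : κ → Finset (Fin n))
    (A : κ → Finset (Finset (Fin n))) {p r B ε Γ : ℝ} {i₁ : ℕ} (h0 : 0 < p) (h1 : p < 1)
    (hr0 : 0 < r) (hr1 : r ≤ 1) (hr : (1 - p) * r ^ 2 = p) (hB : B = 2 * ((1 - p) * r))
    (hε : 0 < ε) (hΓ : 0 ≤ Γ)
    (hA : ∀ i ∈ J, ∀ j ∈ J, j ≠ i → ∀ E, (symmDiff (symmDiff (x i) (x j)) E).card ≤ E.card →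
      E ∈ A i)
    (herr : ∀ i ∈ J, (n + 2) * ∑ E ∈ A i, noiseProb p E < Γ * (r / (n + 1) * (ε / (p + ε))))
    (hQ : ∀ u ≤ i₁, ∀ t ≤ u, u + t ≤ n →
      Γ * (B⁻¹) ^ (min u (2 * t)) * pairBound n p r ((u + 1) / 2) ⌊p * (n - u) + ε * n⌋₊ u t
        ≤ B ^ u * (r / (n + 1) * (ε / (p + ε)))) (u : ℕ) :
    u ≤ i₁ → ∀ i ∈ J,
      ((J.filter fun j => j ≠ i ∧ (symmDiff (x i) (x j)).card = u).card : ℝ) ≤ Γ * (B⁻¹) ^ u := by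
  have hq : 0 < 1 - p := by linarith
  have hB0 : 0 < B := by rw [hB]; positivity
  have hQ0 : ∀ c m u t, 0 ≤ pairBound n p r c m u t := fun c m u t => by
    unfold pairBound
    positivity
  induction u using Nat.strong_induction_on with
  | _ u ih =>
  intro hu i hi
  by_contra! hcon
  obtain ⟨N, hN, hNc⟩ := exists_subset_card_eq (n := ⌊Γ * (B⁻¹) ^ u⌋₊ + 1)
    (Nat.succ_le_of_lt ((Nat.floor_lt (by positivity)).2 hcon))
  have hN' : ∀ j ∈ N, j ∈ J ∧ j ≠ i ∧ (symmDiff (x i) (x j)).card = u := fun j hj => by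
    simpa using hN hj
  obtain ⟨j₀, hj₀⟩ : N.Nonempty := card_pos.1 (by omega)
  have hun : u ≤ n := by
    rw [← (hN' j₀ hj₀).2.2]
    simpa using card_le_univ (symmDiff (x i) (x j₀))
  have hun' : (u : ℝ) ≤ n := by exact_mod_cast hun
  obtain ⟨m, hm⟩ : ∃ m, m = ⌊p * (n - u) + ε * n⌋₊ := ⟨_, rfl⟩
  obtain ⟨a, ha⟩ : ∃ a, a = B ^ u * (r / (n + 1) * (ε / (p + ε))) := ⟨_, rfl⟩
  have ha0 : 0 < a := by rw [ha]; positivity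
  have hm' : p * (n - u) + ε * n ≤ m + 1 := by
    rw [hm]
    exact (Nat.lt_floor_add_one _).le
  have hstep := card_mul_le_of_overlap_le (a := a) N
    (fun j => overlapSet (symmDiff (x i) (x j)) ((u + 1) / 2) m) (A i) (noiseProb p)
    (noiseProb_nonneg h0.le h1.le) (fun j hj E hE => ?_) (show (0 : ℝ) ≤ n + 1 by positivity)
    (fun j hj => ?_) (fun j hj => ?_)
  · have hle : Γ * (r / (n + 1) * (ε / (p + ε))) ≤ N.card * a := by
      have h3 : Γ * (B⁻¹) ^ u ≤ N.card := by
        rw [hNc]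
        push_cast
        exact (Nat.lt_floor_add_one _).le
      refine le_trans (le_of_eq ?_) (mul_le_mul_of_nonneg_right h3 ha0.le)
      rw [ha, inv_pow]
      field_simp
    have := herr i hi
    have e : ((n : ℝ) + 1 + 1) = n + 2 := by ring
    rw [e] at hstep
    linarith
  · obtain ⟨hjJ, hji, hju⟩ := hN' j hj
    refine hA i hi j hjJ hji E (mem_overlapSet_card_le (m := m) ?_)
    rw [hju]
    exact hE
  · rw [ha]
    exact le_sum_overlapSet (hN' j hj).2.2 h0 h1 hr0 hr1 hr hB hε hm'
  · obtain ⟨hjJ, hji, hju⟩ := hN' j hj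
    have hpair : ∀ k ∈ N, ∃ t ≤ u, u + t ≤ n ∧ (symmDiff (x j) (x k)).card = 2 * t := by
      intro k hk
      obtain ⟨t, h1, h2, h3, -⟩ := card_symmDiff_eq hju (hN' k hk).2.2
      rw [symmDiff_symmDiff_eq] at h3
      exact ⟨t, h1, h2, h3⟩
    calc ∑ k ∈ N.erase j, ∑ E ∈ overlapSet (symmDiff (x i) (x j)) ((u + 1) / 2) m
          ∩ overlapSet (symmDiff (x i) (x k)) ((u + 1) / 2) m, noiseProb p E
        ≤ ∑ k ∈ N.erase j, pairBound n p r ((u + 1) / 2) m u ((symmDiff (x j) (x k)).card / 2) := by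
          refine sum_le_sum fun k hk => ?_
          have hk' := mem_of_mem_erase hk
          obtain ⟨t, -, -, ht⟩ := hpair k hk'
          refine sum_inter_overlapSet_le hju (hN' k hk').2.2 ?_ h1 hr0 hr1 hr
          rw [symmDiff_symmDiff_eq]
          omega
      _ = ∑ t ∈ range (u + 1), ∑ k ∈ N.erase j with (symmDiff (x j) (x k)).card / 2 = t,
          pairBound n p r ((u + 1) / 2) m u ((symmDiff (x j) (x k)).card / 2) := by
          refine (sum_fiberwise_of_maps_to (fun k hk => ?_) _).symm
          obtain ⟨t, h1, -, ht⟩ := hpair k (mem_of_mem_erase hk)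
          rw [mem_range]
          omega
      _ ≤ ∑ t ∈ range (u + 1), a := by
          refine sum_le_sum fun t ht => ?_
          rw [sum_congr rfl (g := fun _ => pairBound n p r ((u + 1) / 2) m u t)
            fun k hk => by rw [(mem_filter.1 hk).2], sum_const, nsmul_eq_mul]
          have htu : t ≤ u := by simpa [Nat.lt_succ_iff] using ht
          rcases (filter (fun k => (symmDiff (x j) (x k)).card / 2 = t) (N.erase j)).eq_empty_or_nonempty
            with hem | ⟨k₀, hk₀⟩
          · rw [hem]
            simpa using ha0.le
          · obtain ⟨hk₁, hk₂⟩ := mem_filter.1 hk₀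
            obtain ⟨t', -, hut, ht'⟩ := hpair k₀ (mem_of_mem_erase hk₁)
            obtain rfl : t = t' := by omega
            refine le_trans (mul_le_mul_of_nonneg_right ?_ (hQ0 _ _ _ _))
              (by rw [ha, hm]; exact hQ u hu t htu hut)
            rcases lt_or_ge (2 * t) u with h | h
            · rw [min_eq_right h.le]
              refine le_trans ?_ (ih (2 * t) h (by omega) j hjJ)
              refine Nat.cast_le.2 (card_le_card fun k hk => ?_)
              obtain ⟨hk1, hk2⟩ := mem_filter.1 hk
              obtain ⟨t', -, -, ht''⟩ := hpair k (mem_of_mem_erase hk1)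
              refine mem_filter.2 ⟨(hN' k (mem_of_mem_erase hk1)).1, ne_of_mem_erase hk1, ?_⟩
              omega
            · rw [min_eq_left h]
              refine le_trans (Nat.cast_le.2 (card_filter_le _ _)) ?_
              rw [card_erase_of_mem hj, hNc, Nat.add_sub_cancel]
              exact Nat.floor_le (by positivity)
      _ ≤ (n + 1) * a := by
          rw [sum_const, card_range, nsmul_eq_mul]
          push_cast
          exact mul_le_mul_of_nonneg_right (by linarith) ha0.le

end Neighbours

section LowRate

/-- The crossover probability with `(√(1-p) - √p) / (√(1-p) + √p) = e`. -/
noncomputable def crossover (e : ℝ) : ℝ := (1 - e) ^ 2 / (2 * (1 + e ^ 2))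

/-- `√(p / (1 - p))` for `p = crossover e`. -/
noncomputable def oddsRoot (e : ℝ) : ℝ := (1 - e) / (1 + e)

/-- The Bhattacharyya coefficient `2 √(p (1 - p))` for `p = crossover e`. -/
noncomputable def bhattacharyya (e : ℝ) : ℝ := (1 - e ^ 2) / (1 + e ^ 2)

/-- The entropy of the relative distance in the linear programming bound. -/
noncomputable def jplEntropy (e : ℝ) : ℝ :=
  Real.binEntropy ((1 - Real.sqrt (1 - (e ^ 2) ^ 2)) / 2)

lemma one_sub_crossover (e : ℝ) : 1 - crossover e = (1 + e) ^ 2 / (2 * (1 + e ^ 2)) := by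
  rw [crossover]
  field_simp
  ring

lemma crossover_pos {e : ℝ} (h1 : e < 1) : 0 < crossover e := by
  have : 0 < 1 - e := by linarith
  rw [crossover]
  positivity

lemma one_sub_crossover_pos {e : ℝ} (h0 : 0 < e) : 0 < 1 - crossover e := by
  rw [one_sub_crossover]
  positivity

lemma oddsRoot_pos {e : ℝ} (h0 : 0 < e) (h1 : e < 1) : 0 < oddsRoot e :=
  div_pos (by linarith) (by linarith)

lemma oddsRoot_le_one {e : ℝ} (h0 : 0 < e) : oddsRoot e ≤ 1 := by
  rw [oddsRoot, div_le_one (by linarith)]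
  linarith

lemma one_sub_crossover_mul {e : ℝ} (h0 : 0 < e) :
    (1 - crossover e) * oddsRoot e ^ 2 = crossover e := by
  rw [one_sub_crossover, crossover, oddsRoot]
  field_simp

lemma bhattacharyya_eq {e : ℝ} (h0 : 0 < e) :
    bhattacharyya e = 2 * ((1 - crossover e) * oddsRoot e) := by
  rw [one_sub_crossover, bhattacharyya, oddsRoot]
  field_simp
  ring

lemma bhattacharyya_pos {e : ℝ} (h0 : 0 < e) (h1 : e < 1) : 0 < bhattacharyya e :=
  div_pos (by nlinarith) (by positivity)

lemma pairBound_le_exp {e ε : ℝ} (h0 : 0 < e) (h1 : e < 1) (hε : 0 < ε) {n u t : ℕ} (hn : 0 < n)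
    (htu : t ≤ u) (hut : u + t ≤ n) :
    ((bhattacharyya e)⁻¹) ^ u * ((bhattacharyya e)⁻¹) ^ (min u (2 * t))
      * pairBound n (crossover e) (oddsRoot e) ((u + 1) / 2)
        ⌊crossover e * (n - u) + ε * n⌋₊ u t
      ≤ Real.exp (n * (overlapExponent e (u / n) (t / n)
        + ε * (Real.log (1 + e) - Real.log (1 - e)))) := by
  have hx : 0 < 1 - e ^ 2 := by nlinarith
  have h1' : 0 < 1 - e := by linarith
  obtain ⟨c, hc⟩ : ∃ c, c = (u + 1) / 2 := ⟨_, rfl⟩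
  obtain ⟨m, hm⟩ : ∃ m, m = ⌊crossover e * (n - u) + ε * n⌋₊ := ⟨_, rfl⟩
  have hun : (u : ℝ) ≤ n := by exact_mod_cast (by omega : u ≤ n)
  have hmle : (m : ℝ) ≤ crossover e * (n - u) + ε * n := by
    rw [hm]
    have := (crossover_pos h1).le
    exact Nat.floor_le (add_nonneg (mul_nonneg this (by linarith)) (by positivity))
  have hcle : (u : ℝ) / 2 ≤ c := by
    have : u ≤ 2 * c := by omega
    have : (u : ℝ) ≤ 2 * c := by exact_mod_cast this
    linarith
  rw [← hc, ← hm, pairBound]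
  have eB : (bhattacharyya e)⁻¹ = Real.exp (Real.log (1 + e ^ 2) - Real.log (1 - e ^ 2)) := by
    rw [Real.exp_sub, Real.exp_log (by positivity), Real.exp_log hx, bhattacharyya, inv_div]
  have eq : 1 - crossover e
      = Real.exp (2 * Real.log (1 + e) - Real.log 2 - Real.log (1 + e ^ 2)) := by
    rw [Real.exp_sub, Real.exp_sub, two_mul, Real.exp_add, Real.exp_log (by positivity),
      Real.exp_log (by positivity), Real.exp_log (by positivity), one_sub_crossover]
    field_simp
  have er : oddsRoot e = Real.exp (-(Real.log (1 + e) - Real.log (1 - e))) := by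
    rw [neg_sub, Real.exp_sub, Real.exp_log h1', Real.exp_log (by positivity), oddsRoot]
  have er' : (oddsRoot e)⁻¹ = Real.exp (Real.log (1 + e) - Real.log (1 - e)) := by
    rw [er, Real.exp_neg, inv_inv]
  have er1 : 1 + oddsRoot e = Real.exp (Real.log 2 - Real.log (1 + e)) := by
    rw [Real.exp_sub, Real.exp_log (by positivity), Real.exp_log (by positivity), oddsRoot]
    field_simp
    ring
  have er2 : 1 + (oddsRoot e)⁻¹ = Real.exp (Real.log 2 - Real.log (1 - e)) := by
    rw [Real.exp_sub, Real.exp_log (by positivity), Real.exp_log h1', oddsRoot, inv_div]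
    field_simp
    ring
  have er3 : 1 + oddsRoot e ^ 3
      = Real.exp (Real.log 2 + Real.log (1 + 3 * e ^ 2) - 3 * Real.log (1 + e)) := by
    rw [Real.exp_sub, Real.exp_add, Real.exp_log (by positivity), Real.exp_log (by positivity),
      show 3 * Real.log (1 + e) = Real.log ((1 + e) ^ 3) by rw [Real.log_pow]; norm_num,
      Real.exp_log (by positivity), oddsRoot]
    field_simp
    ring
  have hlam : 0 ≤ Real.log (1 + e) - Real.log (1 - e) := by
    rw [sub_nonneg]
    exact Real.log_le_log h1' (by linarith)
  rw [er1, er2, er3, er', er, eq, eB]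
  simp only [← Real.exp_nat_mul, ← Real.exp_add]
  rw [Real.exp_le_exp, overlapExponent]
  push_cast [Nat.cast_sub htu, Nat.sub_sub, Nat.cast_sub hut]
  have hn' : (0 : ℝ) < n := by exact_mod_cast hn
  have hmin : (n : ℝ) * min ((u : ℝ) / n) (2 * (t / n)) = min (u : ℝ) (2 * t) := by
    rw [mul_min_of_nonneg _ _ hn'.le]
    congr 1 <;> field_simp
  have e1 : (n : ℝ) * (u / n) = u := by field_simp
  have e2 : (n : ℝ) * (t / n) = t := by field_simp
  obtain ⟨M, hM⟩ : ∃ M, M = min ((u : ℝ) / n) (2 * (t / n)) := ⟨_, rfl⟩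
  obtain ⟨U, hU⟩ : ∃ U, U = (u : ℝ) / n := ⟨_, rfl⟩
  obtain ⟨T, hT⟩ : ∃ T, T = (t : ℝ) / n := ⟨_, rfl⟩
  rw [← hM] at hmin ⊢
  rw [← hmin]
  rw [← hU] at e1 ⊢
  rw [← hT] at e2 ⊢
  have key : ((m : ℝ) - 3 * c) * (Real.log (1 + e) - Real.log (1 - e))
      ≤ (n * (crossover e * (1 - U)) - 3 / 2 * (n * U) + ε * n)
        * (Real.log (1 + e) - Real.log (1 - e)) := by
    refine mul_le_mul_of_nonneg_right ?_ hlam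
    rw [← e1] at hmle hcle
    linarith
  rw [← e1, ← e2]
  rw [crossover] at key
  linarith

/-- The gap between the cutoff rate and the entropy of the linear programming distance. -/
noncomputable def rateGap (e : ℝ) : ℝ := Real.log (1 + e ^ 2) - jplEntropy e

lemma sum_close_le {n i₁ : ℕ} {κ : Type*} [DecidableEq κ] (J : Finset κ) (x : κ → Finset (Fin n))
    {B Γ : ℝ} (hB : 0 < B) (hΓ : 0 ≤ Γ) (i : κ)
    (h : ∀ u ≤ i₁, ((J.filter fun j => j ≠ i ∧ (symmDiff (x i) (x j)).card = u).card : ℝ)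
      ≤ Γ * (B⁻¹) ^ u) :
    ∑ j ∈ J with j ≠ i ∧ (symmDiff (x i) (x j)).card ≤ i₁, B ^ (symmDiff (x i) (x j)).card
      ≤ (n + 1) * Γ := by
  rw [← sum_fiberwise_of_maps_to (t := range (n + 1))
    (g := fun j => (symmDiff (x i) (x j)).card) fun j _ => by
      have := card_le_univ (symmDiff (x i) (x j))
      rw [Fintype.card_fin] at this
      exact mem_range.2 (by omega)]
  have hu : ∀ u ∈ range (n + 1), ∑ j ∈ (J.filter fun j => j ≠ i ∧ (symmDiff (x i) (x j)).card ≤ i₁)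
      with (symmDiff (x i) (x j)).card = u, B ^ (symmDiff (x i) (x j)).card ≤ Γ := by
    intro u _
    rw [filter_filter]
    rcases le_or_gt u i₁ with hle | hgt
    · have e1 : ∀ j ∈ J.filter (fun j => (j ≠ i ∧ (symmDiff (x i) (x j)).card ≤ i₁)
          ∧ (symmDiff (x i) (x j)).card = u), B ^ (symmDiff (x i) (x j)).card = B ^ u :=
        fun j hj => by rw [(mem_filter.1 hj).2.2]
      rw [sum_congr rfl e1, sum_const, nsmul_eq_mul]
      have hsub : J.filter (fun j => (j ≠ i ∧ (symmDiff (x i) (x j)).card ≤ i₁)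
          ∧ (symmDiff (x i) (x j)).card = u)
          ⊆ J.filter fun j => j ≠ i ∧ (symmDiff (x i) (x j)).card = u := by
        intro j
        simp only [mem_filter]
        tauto
      have h1 := (Nat.cast_le (α := ℝ).2 (card_le_card hsub)).trans (h u hle)
      calc _ ≤ Γ * (B⁻¹) ^ u * B ^ u := mul_le_mul_of_nonneg_right h1 (by positivity)
        _ = Γ := by rw [mul_assoc, ← mul_pow, inv_mul_cancel₀ hB.ne', one_pow, mul_one]
    · rw [filter_false_of_mem, sum_empty]
      · exact hΓ
      · rintro j - ⟨⟨-, h1⟩, h2⟩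
        omega
  refine (sum_le_sum hu).trans (le_of_eq ?_)
  rw [sum_const, card_range, nsmul_eq_mul]
  push_cast
  rfl

lemma entropy_close_eq (e : ℝ) :
    Real.binEntropy (1 / 2 - √((1 - e ^ 2) / 2 * (1 - (1 - e ^ 2) / 2))) = jplEntropy e := by
  have : (1 - e ^ 2) / 2 * (1 - (1 - e ^ 2) / 2) = (1 - (e ^ 2) ^ 2) * (1 / 2) ^ 2 := by ring
  rw [jplEntropy, this, Real.sqrt_mul' _ (by positivity), Real.sqrt_sq (by norm_num)]
  congr 1
  ring

/-- A code all of whose codewords have a small error probability has a small rate. -/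
theorem exists_card_lt_of_reliable {e η : ℝ} (h0 : 0 < e) (h1 : e ^ 2 ≤ 84 / 205) (hη : 0 < η) :
    ∃ ε₁ > 0, ∃ ε > 0, ∀ᶠ n : ℕ in atTop, ∀ (κ : Type) [DecidableEq κ] (J : Finset κ)
      (x : κ → Finset (Fin n)) (A : κ → Finset (Finset (Fin n))),
      (∀ i ∈ J, ∀ j ∈ J, j ≠ i → ∀ E, (symmDiff (symmDiff (x i) (x j)) E).card ≤ E.card →
        E ∈ A i) →
      (∀ i ∈ J, (n + 2) * ∑ E ∈ A i, noiseProb (crossover e) E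
        < Real.exp (-(n * (rateGap e + η)))
          * (oddsRoot e / (n + 1) * (ε₁ / (crossover e + ε₁)))) →
      (J.card : ℝ) < Real.exp (n * (jplEntropy e - ε)) := by
  have he1 : e < 1 := by nlinarith
  have hx : 0 < e ^ 2 := by positivity
  obtain ⟨σ, hσ⟩ : ∃ σ, σ = 2 * Real.log (1 + e ^ 2) - 1 / 2 * Real.log (1 - e ^ 2)
        - 3 / 2 * Real.log (1 + 3 * e ^ 2) + 2 * mulArtanh e / (1 + e ^ 2) := ⟨_, rfl⟩
  obtain ⟨lam, hlam⟩ : ∃ lam, lam = Real.log (1 + e) - Real.log (1 - e) := ⟨_, rfl⟩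
  have hscale : ∀ s : ℝ, η / (4 * (1 + |s|)) * s ≤ η / 4 := fun s => by
    have h2 : s ≤ 1 + |s| := by linarith [le_abs_self s]
    have h3 : 0 < 1 + |s| := by positivity
    rw [div_mul_eq_mul_div, div_le_div_iff₀ (by positivity) (by norm_num)]
    have := mul_le_mul_of_nonneg_left h2 hη.le
    linarith
  obtain ⟨ηB, hηB⟩ : ∃ ηB, ηB = η / (4 * (1 + |σ|)) := ⟨_, rfl⟩
  have hηB0 : 0 < ηB := by rw [hηB]; positivity
  have hηB1 : ηB ≤ η / 4 := by
    rw [hηB]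
    refine div_le_div_of_nonneg_left hη.le (by norm_num) ?_
    linarith [abs_nonneg σ]
  have hηBσ : ηB * σ ≤ η / 4 := by rw [hηB]; exact hscale σ
  obtain ⟨ε₁, hε₁⟩ : ∃ ε₁, ε₁ = η / (4 * (1 + |lam|)) := ⟨_, rfl⟩
  have hε₁0 : 0 < ε₁ := by rw [hε₁]; positivity
  have hε₁lam : ε₁ * lam ≤ η / 4 := by rw [hε₁]; exact hscale lam
  obtain ⟨ε, hε, hclose⟩ := exists_close_pairs (ω := (1 - e ^ 2) / 2) (η := ηB)
    (by linarith) (by linarith) hηB0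
  have hp := crossover_pos he1
  have hr := oddsRoot_pos h0 he1
  have hBpos := bhattacharyya_pos h0 he1
  obtain ⟨c, hc⟩ : ∃ c, c = oddsRoot e * (ε₁ / (crossover e + ε₁)) := ⟨_, rfl⟩
  have hc0 : 0 < c := by rw [hc]; positivity
  refine ⟨ε₁, hε₁0, ε, hε, ?_⟩
  filter_upwards [hclose, eventually_gt_atTop 0,
    eventually_const_mul_pow_le_exp c⁻¹ 1 (ε := η / 2) (by positivity),
    eventually_const_mul_pow_le_exp 2 1 (ε := η / 2) (by positivity)]
    with n hclose hn hpoly hpoly2 κ _ J x A hA herr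
  have hn' : (0 : ℝ) < n := by exact_mod_cast hn
  by_contra! hcon
  have hratio : (1 - e ^ 2) / 2 / (1 - (1 - e ^ 2) / 2) = bhattacharyya e := by
    rw [bhattacharyya, div_eq_div_iff (by linarith) (by positivity)]
    ring
  have hlog : Real.log 2 + Real.log (1 - (1 - e ^ 2) / 2) = Real.log (1 + e ^ 2) := by
    rw [← Real.log_mul (by norm_num) (by linarith)]
    congr 1
    ring
  have hclose := hclose κ J x (by rw [entropy_close_eq]; exact hcon)
  rw [entropy_close_eq, hratio, sub_sub (jplEntropy e), hlog] at hclose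
  obtain ⟨i₁, hi₁⟩ : ∃ i₁, i₁ = ⌊((1 - e ^ 2) / 2 + ηB) * n⌋₊ := ⟨_, rfl⟩
  have hi₁n : (0 : ℝ) ≤ ((1 - e ^ 2) / 2 + ηB) * n :=
    mul_nonneg (by linarith) hn'.le
  have hwc : oddsRoot e / (n + 1) * (ε₁ / (crossover e + ε₁)) = c / (n + 1) := by
    rw [hc]
    ring
  obtain ⟨Γ, hΓ⟩ : ∃ Γ, Γ = Real.exp (-(n * (rateGap e + η))) := ⟨_, rfl⟩
  have hΓ0 : 0 < Γ := by rw [hΓ]; exact Real.exp_pos _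
  have hcard := card_neighbours_le J x A (i₁ := i₁) (Γ := Γ) hp
    (by linarith [one_sub_crossover_pos h0]) hr (oddsRoot_le_one h0) (one_sub_crossover_mul h0)
    (bhattacharyya_eq h0) hε₁0 hΓ0.le hA (by rw [hΓ]; exact herr) ?_
  · have hsum : ∀ i ∈ J, ∑ j ∈ J with j ≠ i ∧ ((symmDiff (x i) (x j)).card : ℝ)
        ≤ ((1 - e ^ 2) / 2 + ηB) * n, bhattacharyya e ^ (symmDiff (x i) (x j)).card
        ≤ (n + 1) * Γ := fun i hi => by
      have h2 := sum_close_le J x hBpos hΓ0.le i (i₁ := i₁) fun u hu => hcard u hu i hi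
      simpa only [hi₁, Nat.le_floor_iff hi₁n] using h2
    have h3 := hclose.trans (sum_le_sum hsum)
    rw [sum_const, nsmul_eq_mul] at h3
    have hJ : (0 : ℝ) < J.card := (Real.exp_pos _).trans_le hcon
    have h4 := le_of_mul_le_mul_left h3 hJ
    have h5 : ((n : ℝ) + 1) * Γ < Real.exp (n * (η / 2)) * Γ := by
      refine mul_lt_mul_of_pos_right ?_ hΓ0
      rw [pow_one, mul_comm (η / 2)] at hpoly2
      linarith
    have h6 := h4.trans_lt h5
    rw [hΓ, ← Real.exp_add, Real.exp_lt_exp, rateGap] at h6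
    have h7 := mul_le_mul_of_nonneg_left hηB1 hn'.le
    have h8 : 0 < n * η := by positivity
    linarith
  · intro u hu t htu hut
    rw [hwc]
    have hE := pairBound_le_exp h0 he1 hε₁0 hn htu hut
    have hub : (u : ℝ) / n ≤ (1 - e ^ 2) / 2 + ηB := by
      rw [div_le_iff₀ hn']
      exact (Nat.le_floor_iff hi₁n).1 (hi₁ ▸ hu)
    have hO := overlapExponent_le (t := (t : ℝ) / n) h0 h1 hub
    rw [← hσ] at hO
    rw [← hlam] at hE
    have hfin : Real.exp (n * (overlapExponent e (u / n) (t / n) + ε₁ * lam))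
        ≤ Real.exp (n * (rateGap e + η)) * Real.exp (-(n * (η / 2))) := by
      rw [← Real.exp_add, Real.exp_le_exp, rateGap, jplEntropy]
      have := mul_le_mul_of_nonneg_left hO hn'.le
      have h7 := mul_le_mul_of_nonneg_left hηBσ hn'.le
      have h8 := mul_le_mul_of_nonneg_left hε₁lam hn'.le
      linarith
    have hsmall : Real.exp (-(n * (η / 2))) ≤ c / (n + 1) := by
      rw [Real.exp_neg, inv_le_comm₀ (Real.exp_pos _) (by positivity), inv_div, mul_comm (n : ℝ)]
      refine le_trans (le_of_eq ?_) hpoly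
      rw [pow_one]
      ring
    have hBu : (0 : ℝ) < bhattacharyya e ^ u := by positivity
    have hΓexp : Γ * Real.exp (n * (rateGap e + η)) = 1 := by
      rw [hΓ, ← Real.exp_add, neg_add_cancel, Real.exp_zero]
    obtain ⟨Q, hQ⟩ : ∃ Q, Q = ((bhattacharyya e)⁻¹) ^ (min u (2 * t))
      * pairBound n (crossover e) (oddsRoot e) ((u + 1) / 2)
        ⌊crossover e * (n - u) + ε₁ * n⌋₊ u t := ⟨_, rfl⟩
    rw [mul_assoc, ← hQ] at hE ⊢
    rw [inv_pow] at hE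
    calc Γ * Q = bhattacharyya e ^ u * (Γ * ((bhattacharyya e ^ u)⁻¹ * Q)) := by
          field_simp
      _ ≤ bhattacharyya e ^ u * (Γ * (Real.exp (n * (rateGap e + η))
          * Real.exp (-(n * (η / 2))))) :=
          mul_le_mul_of_nonneg_left (mul_le_mul_of_nonneg_left (hE.trans hfin) hΓ0.le) hBu.le
      _ = bhattacharyya e ^ u * Real.exp (-(n * (η / 2))) := by
          rw [← mul_assoc Γ, hΓexp, one_mul]
      _ ≤ _ := by gcongr

lemma noiseProb_le_of_card_le {n : ℕ} {p r : ℝ} (h1 : p < 1) (hr0 : 0 < r) (hr1 : r ≤ 1)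
    (hr : (1 - p) * r ^ 2 = p) {E F : Finset (Fin n)} (h : E.card ≤ F.card) :
    noiseProb p F ≤ noiseProb p E := by
  rw [noiseProb_eq hr, noiseProb_eq hr]
  exact mul_le_mul_of_nonneg_left (pow_le_pow_of_le_one hr0.le hr1 (by omega))
    (pow_nonneg (by linarith) _)

/-- The noise patterns confusing the codeword `i` with another codeword of `S`. -/
def confusable {n : ℕ} {κ : Type*} [DecidableEq κ] (S : Finset κ) (x : κ → Finset (Fin n))
    (i : κ) : Finset (Finset (Fin n)) :=
  univ.filter fun E => ∃ j ∈ S, j ≠ i ∧ (symmDiff (symmDiff (x i) (x j)) E).card ≤ E.card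

/-- Up to a factor two, every decoder fails on all confusable noise patterns. -/
lemma sum_confusable_le {n : ℕ} {κ : Type*} [DecidableEq κ] (S : Finset κ)
    (x : κ → Finset (Fin n)) (dec : Finset (Fin n) → κ) {p r : ℝ} (h0 : 0 < p) (h1 : p < 1)
    (hr0 : 0 < r) (hr1 : r ≤ 1) (hr : (1 - p) * r ^ 2 = p) :
    ∑ i ∈ S, ∑ E ∈ confusable S x i, noiseProb p E
      ≤ 2 * ∑ i ∈ S, ∑ y with dec y ≠ i, noiseProb p (symmDiff (x i) y) := by
  have hre : ∀ i ∈ S, ∑ E ∈ confusable S x i, noiseProb p E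
      = ∑ y, if ∃ j ∈ S, j ≠ i ∧ (symmDiff (x j) y).card ≤ (symmDiff (x i) y).card
        then noiseProb p (symmDiff (x i) y) else 0 := fun i _ => by
    rw [confusable, sum_filter]
    refine sum_nbij' (fun E => symmDiff (x i) E) (fun E => symmDiff (x i) E)
      (fun _ _ => mem_univ _) (fun _ _ => mem_univ _)
      (fun E _ => symmDiff_symmDiff_cancel_left _ _)
      (fun E _ => symmDiff_symmDiff_cancel_left _ _) fun E _ => ?_
    have e1 : ∀ j, symmDiff (x j) (symmDiff (x i) E) = symmDiff (symmDiff (x i) (x j)) E :=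
      fun j => by rw [← symmDiff_assoc, symmDiff_comm (x j)]
    simp only [e1, symmDiff_self, bot_symmDiff]
  rw [sum_congr rfl hre, sum_comm]
  simp only [sum_filter]
  rw [sum_comm (s := S), mul_sum]
  refine sum_le_sum fun y _ => ?_
  have hP : ∀ i, 0 ≤ noiseProb p (symmDiff (x i) y) := fun i => noiseProb_nonneg h0.le h1.le _
  obtain ⟨W, hW⟩ : ∃ W, W = ∑ i ∈ S, if dec y ≠ i then noiseProb p (symmDiff (x i) y) else 0 :=
    ⟨_, rfl⟩
  have hW0 : 0 ≤ W := by
    rw [hW]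
    exact sum_nonneg fun i _ => by split_ifs <;> simp [hP]
  rw [← hW]
  have hrest : ∑ i ∈ S.erase (dec y),
      (if ∃ j ∈ S, j ≠ i ∧ (symmDiff (x j) y).card ≤ (symmDiff (x i) y).card
        then noiseProb p (symmDiff (x i) y) else 0) ≤ W := by
    rw [hW]
    calc _ ≤ ∑ i ∈ S.erase (dec y), if dec y ≠ i then noiseProb p (symmDiff (x i) y) else 0 := by
          refine sum_le_sum fun i hi => ?_
          rw [if_pos (mem_erase.1 hi).1.symm]
          split_ifs <;> simp [hP]
      _ ≤ _ := sum_le_sum_of_subset_of_nonneg (erase_subset _ _) fun i _ _ => by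
          split_ifs <;> simp [hP]
  by_cases hd : dec y ∈ S
  · rw [← add_sum_erase _ _ hd, two_mul]
    refine add_le_add ?_ hrest
    split_ifs with hex
    · obtain ⟨j, hj, hne, hle⟩ := hex
      refine (noiseProb_le_of_card_le h1 hr0 hr1 hr hle).trans ?_
      rw [hW]
      have h2 := single_le_sum (f := fun i => if dec y ≠ i then noiseProb p (symmDiff (x i) y)
        else 0) (fun i _ => by split_ifs <;> simp [hP]) hj
      simpa only [if_pos hne.symm] using h2
    · exact hW0
  · rw [erase_eq_of_notMem hd] at hrest
    linarith

/-- Lower bound on the error probability at the rates where the linear programming bound meets the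
cutoff rate. -/
theorem exists_low_rate_bound {e η : ℝ} (h0 : 0 < e) (h1 : e ^ 2 ≤ 84 / 205) (hη : 0 < η) :
    ∃ ε > 0, ∀ᶠ n : ℕ in atTop, ∀ (κ : Type) [DecidableEq κ] (S : Finset κ)
      (x : κ → Finset (Fin n)) (dec : Finset (Fin n) → κ),
      Real.exp (n * (jplEntropy e - ε)) ≤ S.card →
      S.card * Real.exp (-(n * (rateGap e + η)))
        ≤ ∑ i ∈ S, ∑ y with dec y ≠ i, noiseProb (crossover e) (symmDiff (x i) y) := by
  have he1 : e < 1 := by nlinarith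
  obtain ⟨ε₁, hε₁, ε, hε, hlow⟩ := exists_card_lt_of_reliable h0 h1 (half_pos hη)
  have hp := crossover_pos he1
  have hp1 : crossover e < 1 := by linarith [one_sub_crossover_pos h0]
  have hr := oddsRoot_pos h0 he1
  obtain ⟨c, hc⟩ : ∃ c, c = oddsRoot e * (ε₁ / (crossover e + ε₁)) := ⟨_, rfl⟩
  have hc0 : 0 < c := by rw [hc]; positivity
  refine ⟨ε / 2, half_pos hε, ?_⟩
  filter_upwards [hlow, eventually_const_mul_pow_le_exp 2 0 (half_pos hε),
    eventually_const_mul_pow_le_exp (8 * c⁻¹) 2 (half_pos hη)]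
    with n hlow htwo hpoly κ _ S x dec hS
  have hn' : (0 : ℝ) ≤ n := n.cast_nonneg
  obtain ⟨w, hw⟩ : ∃ w, w = Real.exp (-(n * (rateGap e + η / 2)))
          * (oddsRoot e / (n + 1) * (ε₁ / (crossover e + ε₁))) := ⟨_, rfl⟩
  rw [← hw] at hlow
  obtain ⟨f, hf⟩ : ∃ f : κ → ℝ, f = fun i => ∑ E ∈ confusable S x i, noiseProb (crossover e) E :=
    ⟨_, rfl⟩
  have hf0 : ∀ i, 0 ≤ f i := fun i => by
    rw [hf]
    exact sum_nonneg fun E _ => noiseProb_nonneg hp.le hp1.le E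
  have hJ := hlow κ (S.filter fun i => (n + 2) * f i < w) x (confusable S x)
    (fun i _ j hj hne E hE => mem_filter.2 ⟨mem_univ _, j, (mem_filter.1 hj).1, hne, hE⟩)
    (fun i hi => by
      have := (mem_filter.1 hi).2
      rwa [hf] at this)
  have hJ2 : 2 * ((S.filter fun i => (n + 2) * f i < w).card : ℝ) ≤ S.card := by
    rw [pow_zero, mul_one] at htwo
    have h3 : 2 * Real.exp (n * (jplEntropy e - ε)) ≤ Real.exp (n * (jplEntropy e - ε / 2)) := by
      calc _ ≤ Real.exp (ε / 2 * n) * Real.exp (n * (jplEntropy e - ε)) := by gcongr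
        _ = _ := by
          rw [← Real.exp_add]
          congr 1
          ring
    linarith
  have hcount : ((S.filter fun i => (n + 2) * f i < w).card : ℝ)
      + (S.filter fun i => ¬ (n + 2) * f i < w).card = S.card := by
    exact_mod_cast card_filter_add_card_filter_not (s := S) (fun i => (n + 2) * f i < w)
  have hsum : ((S.filter fun i => ¬ (n + 2) * f i < w).card : ℝ) * w ≤ (n + 2) * ∑ i ∈ S, f i := by
    rw [← nsmul_eq_mul, mul_sum]
    refine (card_nsmul_le_sum _ _ _ fun i hi => not_lt.1 (mem_filter.1 hi).2).trans ?_
    exact sum_le_sum_of_subset_of_nonneg (filter_subset _ _) fun i _ _ =>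
      mul_nonneg (by positivity) (hf0 i)
  have hconf := sum_confusable_le S x dec hp hp1 hr (oddsRoot_le_one h0) (one_sub_crossover_mul h0)
  rw [show ∑ i ∈ S, ∑ E ∈ confusable S x i, noiseProb (crossover e) E = ∑ i ∈ S, f i by
    rw [hf]] at hconf
  obtain ⟨T, hT⟩ : ∃ T, T = ∑ i ∈ S, ∑ y with dec y ≠ i,
    noiseProb (crossover e) (symmDiff (x i) y) := ⟨_, rfl⟩
  rw [← hT] at hconf ⊢
  have hw0 : 0 < w := by
    rw [hw]
    positivity
  have h4 : (S.card : ℝ) * w ≤ 4 * (n + 2) * T := by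
    have h5 := mul_le_mul_of_nonneg_left hconf (by positivity : (0 : ℝ) ≤ n + 2)
    have h6 : (S.card : ℝ) * w ≤ 2 * (S.filter fun i => ¬ (n + 2) * f i < w).card * w :=
      mul_le_mul_of_nonneg_right (by linarith) hw0.le
    linarith
  have h7 : 4 * (n + 2) * Real.exp (-(n * (rateGap e + η))) ≤ w := by
    have h8 : 4 * ((n : ℝ) + 2) * ((n + 1) / c) ≤ Real.exp (n * (η / 2)) := by
      rw [mul_comm (n : ℝ) (η / 2)]
      refine le_trans ?_ hpoly
      rw [mul_div_assoc', div_eq_mul_inv]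
      have : 0 < c⁻¹ := by positivity
      have h9 : 4 * ((n : ℝ) + 2) * (n + 1) ≤ 8 * (n + 1) ^ 2 := by nlinarith
      have := mul_le_mul_of_nonneg_right h9 this.le
      linarith
    have h10 : Real.exp (-(n * (rateGap e + η)))
        = Real.exp (-(n * (rateGap e + η / 2))) * (Real.exp (n * (η / 2)))⁻¹ := by
      rw [← Real.exp_neg, ← Real.exp_add]
      congr 1
      ring
    have h11 : w = Real.exp (-(n * (rateGap e + η / 2))) * (c / (n + 1)) := by
      rw [hw, hc]
      ring
    rw [h10, h11, mul_left_comm]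
    refine mul_le_mul_of_nonneg_left ?_ (Real.exp_pos _).le
    rw [← div_eq_mul_inv, div_le_iff₀ (Real.exp_pos _)]
    calc 4 * ((n : ℝ) + 2) = c / (n + 1) * (4 * (n + 2) * ((n + 1) / c)) := by field_simp
      _ ≤ _ := by gcongr
  have h12 := (mul_le_mul_of_nonneg_left h7 S.card.cast_nonneg).trans h4
  refine le_of_mul_le_mul_left ?_ (by positivity : (0 : ℝ) < 4 * (n + 2))
  linarith

end LowRate

section StraightLine

lemma sum_card_sphere {n : ℕ} {κ : Type*} (C : Finset κ) (a : κ → Finset (Fin n)) (k : ℕ) :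
    ∑ y, (C.filter fun i => (symmDiff (a i) y).card = k).card = C.card * n.choose k := by
  simp only [card_eq_sum_ones, sum_filter]
  rw [sum_comm, sum_mul]
  refine sum_congr rfl fun i _ => ?_
  rw [one_mul, ← sum_filter, ← card_eq_sum_ones]
  rw [← card_nbij' (s := powersetCard k (univ : Finset (Fin n))) (fun E => symmDiff (a i) E)
    (fun E => symmDiff (a i) E)]
  · rw [card_powersetCard, card_univ, Fintype.card_fin]
  · intro E hE
    have := (mem_powersetCard.1 hE).2
    simpa [symmDiff_symmDiff_cancel_left] using this
  · intro y hy
    simpa [mem_powersetCard] using hy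
  · intro E _
    exact symmDiff_symmDiff_cancel_left _ _
  · intro E _
    exact symmDiff_symmDiff_cancel_left _ _

/-- Splitting the block: a lower bound at a low rate on the second block, valid for every list of
at least `K` codewords, extends to the whole block. -/
theorem straight_line_bound {n₁ n₂ k : ℕ} {κ : Type*} [DecidableEq κ] (C : Finset κ)
    (a : κ → Finset (Fin n₁)) (b : κ → Finset (Fin n₂))
    (dec : Finset (Fin n₁) → Finset (Fin n₂) → κ) {p K E : ℝ} (h0 : 0 < p) (h1 : p < 1)
    (hK : 0 < K) (hE : 0 ≤ E)
    (hlow : ∀ (S : Finset κ) (dec : Finset (Fin n₂) → κ), K ≤ S.card →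
      S.card * E ≤ ∑ i ∈ S, ∑ y with dec y ≠ i, noiseProb p (symmDiff (b i) y))
    (hM : 2 * (2 ^ n₁ * K) ≤ C.card * n₁.choose k) :
    C.card * (n₁.choose k * (p ^ k * (1 - p) ^ (n₁ - k)) * E)
      ≤ 2 * ∑ i ∈ C, ∑ y, ∑ z with dec y z ≠ i,
        noiseProb p (symmDiff (a i) y) * noiseProb p (symmDiff (b i) z) := by
  obtain ⟨w, hw⟩ : ∃ w, w = p ^ k * (1 - p) ^ (n₁ - k) := ⟨_, rfl⟩
  have hq : 0 < 1 - p := by linarith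
  have hw0 : 0 < w := by rw [hw]; positivity
  obtain ⟨f, hf⟩ : ∃ f : κ → Finset (Fin n₁) → ℝ, f = fun i y =>
    ∑ z with dec y z ≠ i, noiseProb p (symmDiff (b i) z) := ⟨_, rfl⟩
  have hf0 : ∀ i y, 0 ≤ f i y := fun i y => by
    rw [hf]
    exact sum_nonneg fun z _ => noiseProb_nonneg h0.le h1.le _
  have hfib : ∀ y, w * E * (((C.filter fun i => (symmDiff (a i) y).card = k).card : ℝ) - K)
      ≤ ∑ i ∈ C, noiseProb p (symmDiff (a i) y) * f i y := by
    intro y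
    have hgood : ((C.filter fun i => f i y < E).card : ℝ) < K := by
      by_contra! hcon
      have h2 := hlow _ (dec y) hcon
      have hne : (C.filter fun i => f i y < E).Nonempty :=
        card_pos.1 (by exact_mod_cast hK.trans_le hcon)
      have h3 : ∑ i ∈ C with f i y < E, f i y < (C.filter fun i => f i y < E).card * E := by
        rw [← nsmul_eq_mul]
        refine (sum_lt_sum_of_nonempty hne fun i hi => (mem_filter.1 hi).2).trans_eq ?_
        rw [sum_const]
      rw [hf] at h2 h3
      exact absurd h2 (not_le.2 h3)
    obtain ⟨Sk, hSk⟩ : ∃ Sk, Sk = C.filter fun i => (symmDiff (a i) y).card = k := ⟨_, rfl⟩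
    rw [← hSk]
    have hsplit : (Sk.card : ℝ) = (Sk.filter fun i => f i y < E).card
        + (Sk.filter fun i => ¬ f i y < E).card := by
      exact_mod_cast (card_filter_add_card_filter_not (s := Sk) (fun i => f i y < E)).symm
    have hsub : ((Sk.filter fun i => f i y < E).card : ℝ) ≤ (C.filter fun i => f i y < E).card := by
      exact_mod_cast card_le_card (filter_subset_filter _ (hSk ▸ filter_subset _ _))
    have hbad : ((Sk.filter fun i => ¬ f i y < E).card : ℝ) * (w * E)
        ≤ ∑ i ∈ C, noiseProb p (symmDiff (a i) y) * f i y := by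
      rw [← nsmul_eq_mul]
      refine (card_nsmul_le_sum _ (fun i => noiseProb p (symmDiff (a i) y) * f i y) _
        fun i hi => ?_).trans (sum_le_sum_of_subset_of_nonneg
          ((filter_subset _ _).trans (hSk ▸ filter_subset _ _)) fun i _ _ =>
            mul_nonneg (noiseProb_nonneg h0.le h1.le _) (hf0 i y))
      rw [mem_filter, hSk, mem_filter] at hi
      rw [noiseProb, hi.1.2, ← hw]
      exact mul_le_mul_of_nonneg_left (not_lt.1 hi.2) hw0.le
    have h5 : w * E * ((Sk.card : ℝ) - K) ≤ w * E * (Sk.filter fun i => ¬ f i y < E).card :=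
      mul_le_mul_of_nonneg_left (by linarith) (by positivity)
    linarith
  have hsum := sum_le_sum fun y (_ : y ∈ univ) => hfib y
  rw [← mul_sum, sum_sub_distrib, sum_const, card_univ, Fintype.card_finset, Fintype.card_fin,
    ← Nat.cast_sum, sum_card_sphere, nsmul_eq_mul, sum_comm] at hsum
  push_cast at hsum
  have hR : ∑ i ∈ C, ∑ y, ∑ z with dec y z ≠ i,
        noiseProb p (symmDiff (a i) y) * noiseProb p (symmDiff (b i) z)
      = ∑ i ∈ C, ∑ y, noiseProb p (symmDiff (a i) y) * f i y := by
    simp only [hf, mul_sum]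
  rw [hR, ← hw]
  have h6 : w * E * (C.card * n₁.choose k / 2)
      ≤ w * E * (C.card * n₁.choose k - 2 ^ n₁ * K) :=
    mul_le_mul_of_nonneg_left (by linarith) (by positivity)
  linarith

/-- The set of coordinates at which a binary word is `true`. -/
def trueSet {n : ℕ} : (Fin n → Bool) ≃ Finset (Fin n) where
  toFun x := univ.filter fun i => x i = true
  invFun s i := decide (i ∈ s)
  left_inv x := by ext i; simp
  right_inv s := by ext i; simp

lemma hammingDist_eq_card {n : ℕ} (x y : Fin n → Bool) :
    hammingDist x y = (symmDiff (trueSet x) (trueSet y)).card := by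
  rw [hammingDist]
  congr 1
  ext i
  simp only [trueSet, Equiv.coe_fn_mk, mem_filter, mem_univ, true_and, mem_symmDiff]
  cases x i <;> cases y i <;> simp

lemma bscProb_eq_noiseProb {n : ℕ} (p : ℝ) (x y : Fin n → Bool) :
    bscProb n p x y = noiseProb p (symmDiff (trueSet x) (trueSet y)) := by
  rw [bscProb, noiseProb, hammingDist_eq_card]

lemma bscProb_append {n₁ n₂ : ℕ} (p : ℝ) (x y : (Fin n₁ → Bool) × (Fin n₂ → Bool)) :
    bscProb (n₁ + n₂) p (Fin.append x.1 x.2) (Fin.append y.1 y.2)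
      = bscProb n₁ p x.1 y.1 * bscProb n₂ p x.2 y.2 := by
  have hd : hammingDist (Fin.append x.1 x.2) (Fin.append y.1 y.2)
      = hammingDist x.1 y.1 + hammingDist x.2 y.2 := by
    simp only [hammingDist, card_filter]
    rw [Fin.sum_univ_add]
    simp
  have h1 : hammingDist x.1 y.1 ≤ n₁ := by
    simpa using hammingDist_le_card_fintype (x := x.1) (y := y.1)
  have h2 : hammingDist x.2 y.2 ≤ n₂ := by
    simpa using hammingDist_le_card_fintype (x := x.2) (y := y.2)
  rw [bscProb, bscProb, bscProb, hd, pow_add,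
    show n₁ + n₂ - (hammingDist x.1 y.1 + hammingDist x.2 y.2)
      = (n₁ - hammingDist x.1 y.1) + (n₂ - hammingDist x.2 y.2) by omega, pow_add]
  ring

lemma sum_bscProb_append {n₁ n₂ : ℕ} (p : ℝ) (x : Fin (n₁ + n₂) → Bool)
    (P : (Fin (n₁ + n₂) → Bool) → Prop) [DecidablePred P] :
    ∑ y with P y, bscProb (n₁ + n₂) p x y
      = ∑ y : Finset (Fin n₁), ∑ z : Finset (Fin n₂) with
          P (Fin.append (trueSet.symm y) (trueSet.symm z)),
        noiseProb p (symmDiff (trueSet ((Fin.appendEquiv n₁ n₂).symm x).1) y)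
          * noiseProb p (symmDiff (trueSet ((Fin.appendEquiv n₁ n₂).symm x).2) z) := by
  simp only [sum_filter]
  rw [← (Fin.appendEquiv n₁ n₂).sum_comp, Fintype.sum_prod_type, ← trueSet.symm.sum_comp]
  refine sum_congr rfl fun y _ => ?_
  rw [← trueSet.symm.sum_comp]
  refine sum_congr rfl fun z _ => ?_
  obtain ⟨x', rfl⟩ := (Fin.appendEquiv n₁ n₂).surjective x
  have h := bscProb_append p x' (trueSet.symm y, trueSet.symm z)
  rw [bscProb_eq_noiseProb (n := n₁), bscProb_eq_noiseProb (n := n₂)] at h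
  simp only [Equiv.apply_symm_apply] at h
  rw [Equiv.symm_apply_apply, ← h]
  rfl

lemma PeCode_ge {n : ℕ} {p c : ℝ} {C : Finset (Fin n → Bool)} (hC : C.Nonempty)
    (h : ∀ dec : (Fin n → Bool) → (Fin n → Bool),
      C.card * c ≤ ∑ x ∈ C, ∑ y with dec y ≠ x, bscProb n p x y) :
    c ≤ PeCode n p C := by
  obtain ⟨x₀, hx₀⟩ := hC
  refine le_csInf ⟨_, fun _ => x₀, fun _ => hx₀, rfl⟩ ?_
  rintro _ ⟨dec, -, rfl⟩
  have hC0 : (0 : ℝ) < C.card := by exact_mod_cast card_pos.2 ⟨x₀, hx₀⟩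
  rw [le_inv_mul_iff₀ hC0]
  exact h dec

/-- The critical rate in natural logarithms. -/
noncomputable def critRate (e : ℝ) : ℝ := Real.log 2 - Real.binEntropy ((1 - e) / 2)

lemma critRate_add_cutoff {e : ℝ} (h0 : 0 < e) (h1 : e < 1) :
    (1 - e) / 2 * Real.log (crossover e) + (1 - (1 - e) / 2) * Real.log (1 - crossover e)
      = critRate e - Real.log (1 + e ^ 2) - Real.binEntropy ((1 - e) / 2) := by
  have h1' : 0 < 1 - e := by linarith
  have e1 : Real.log (crossover e)
      = 2 * Real.log (1 - e) - Real.log 2 - Real.log (1 + e ^ 2) := by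
    rw [crossover, Real.log_div (by positivity) (by positivity),
      Real.log_mul (by norm_num) (by positivity), Real.log_pow]
    push_cast
    ring
  have e2 : Real.log (1 - crossover e)
      = 2 * Real.log (1 + e) - Real.log 2 - Real.log (1 + e ^ 2) := by
    rw [one_sub_crossover, Real.log_div (by positivity) (by positivity),
      Real.log_mul (by norm_num) (by positivity), Real.log_pow]
    push_cast
    ring
  have e3 : Real.binEntropy ((1 - e) / 2)
      = -((1 - e) / 2 * (Real.log (1 - e) - Real.log 2)
        + (1 + e) / 2 * (Real.log (1 + e) - Real.log 2)) := by
    rw [Real.binEntropy_eq_negMulLog_add_negMulLog_one_sub, Real.negMulLog, Real.negMulLog,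
      show 1 - (1 - e) / 2 = (1 + e) / 2 by ring, Real.log_div h1'.ne' (by norm_num),
      Real.log_div (by positivity) (by norm_num)]
    ring
  rw [critRate, e3, e1, e2]
  ring

lemma exp_le_pow_mul_pow {p ρ : ℝ} (h0 : 0 < p) (h1 : p ≤ 1 - p) {n k : ℕ} (hk : k ≤ n)
    (hkρ : (k : ℝ) ≤ ρ * n) :
    Real.exp (n * (ρ * Real.log p + (1 - ρ) * Real.log (1 - p))) ≤ p ^ k * (1 - p) ^ (n - k) := by
  have hq : 0 < 1 - p := by linarith
  rw [← Real.exp_log (pow_pos h0 k), ← Real.exp_log (pow_pos hq (n - k)), ← Real.exp_add,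
    Real.exp_le_exp, Real.log_pow, Real.log_pow, Nat.cast_sub hk]
  have := mul_le_mul_of_nonneg_right hkρ (sub_nonneg.2 (Real.log_le_log h0 h1))
  linarith

lemma tendsto_sub_floor {θ : ℝ} (h0 : 0 ≤ θ) (h1 : θ < 1) :
    Tendsto (fun n : ℕ => n - ⌊θ * n⌋₊) atTop atTop := by
  have h : Tendsto (fun n : ℕ => ⌊(1 - θ) * n⌋₊) atTop atTop :=
    tendsto_nat_floor_atTop.comp
      (Tendsto.const_mul_atTop (by linarith) tendsto_natCast_atTop_atTop)
  refine tendsto_atTop_mono (fun n => ?_) h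
  have h2 := Nat.floor_le (mul_nonneg (sub_nonneg.2 h1.le) (Nat.cast_nonneg (α := ℝ) n))
  have h3 := Nat.floor_le (mul_nonneg h0 (Nat.cast_nonneg (α := ℝ) n))
  have h4 : ((⌊(1 - θ) * n⌋₊ + ⌊θ * n⌋₊ : ℕ) : ℝ) ≤ n := by
    push_cast
    linarith
  have h5 : ⌊(1 - θ) * n⌋₊ + ⌊θ * n⌋₊ ≤ n := by exact_mod_cast h4
  omega

/-- Choice of the proportion `θ` of the block on which the typical noise is exploited. -/
lemma exists_block_proportion {H c r ε η : ℝ} (h1 : H ≤ r) (h2 : r ≤ c) (hε : 0 < ε) (hη : 0 < η) :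
    ∃ θ τ, 0 < θ ∧ θ < 1 ∧ 0 < τ ∧ τ ≤ η ∧ θ * (c - H) ≤ r - H + (1 - θ) * ε - 2 * τ
      ∧ r - H - η ≤ θ * (c - H) := by
  obtain ⟨s, hs0, hs1, hs⟩ : ∃ s : ℝ, 0 ≤ s ∧ s ≤ 1 ∧ s * (c - H) = r - H := by
    rcases eq_or_lt_of_le (h1.trans h2) with h | h
    · exact ⟨0, le_rfl, zero_le_one, by linarith⟩
    · have h3 : 0 < c - H := by linarith
      exact ⟨(r - H) / (c - H), div_nonneg (by linarith) h3.le,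
        (div_le_one h3).2 (by linarith), div_mul_cancel₀ _ h3.ne'⟩
  obtain ⟨Δ, hΔ⟩ : ∃ Δ, Δ = c - H := ⟨_, rfl⟩
  have hΔ0 : 0 ≤ Δ := by linarith
  rw [← hΔ] at hs ⊢
  obtain ⟨k, hk0, hk1, hk2, hk3⟩ : ∃ k : ℝ, 0 < k ∧ k ≤ 1 / 4 ∧ k * Δ ≤ ε / 2 ∧ k * Δ ≤ η := by
    have hd : 0 < Δ + 1 := by linarith
    have hm : 0 < min (ε / 2) η := lt_min (half_pos hε) hη
    refine ⟨min (1 / 4) (min (ε / 2) η / (Δ + 1)), by positivity, min_le_left _ _, ?_⟩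
    have h3 : min (1 / 4) (min (ε / 2) η / (Δ + 1)) * Δ ≤ min (ε / 2) η := by
      calc _ ≤ min (ε / 2) η / (Δ + 1) * (Δ + 1) :=
            mul_le_mul (min_le_right _ _) (by linarith) hΔ0 (by positivity)
        _ = _ := div_mul_cancel₀ _ hd.ne'
    exact ⟨h3.trans (min_le_left _ _), h3.trans (min_le_right _ _)⟩
  refine ⟨s * (1 - 2 * k) + k, min (ε * k / 2) η, by nlinarith, by nlinarith, by positivity,
    min_le_right _ _, ?_, ?_⟩
  · have hτ := min_le_left (ε * k / 2) η
    have hs' : 0 ≤ 1 - s := by linarith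
    have h4 : k * Δ * (1 - 2 * s) ≤ ε / 2 * (1 - s) := by
      have h5 : k * Δ * (1 - 2 * s) ≤ k * Δ * (1 - s) :=
        mul_le_mul_of_nonneg_left (by linarith) (by positivity)
      exact h5.trans (mul_le_mul_of_nonneg_right hk2 hs')
    have h6 : 0 ≤ ε * (1 - s) * (1 / 2 - 2 * k) := by
      have : 0 ≤ 1 / 2 - 2 * k := by linarith
      positivity
    have h7 : (s * (1 - 2 * k) + k) * Δ = (r - H) + k * Δ * (1 - 2 * s) := by
      rw [← hs]
      ring
    rw [h7]
    linarith
  · have h7 : (s * (1 - 2 * k) + k) * Δ = (r - H) + k * Δ * (1 - s) - s * (k * Δ) := by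
      rw [← hs]
      ring
    have h8 : 0 ≤ k * Δ * (1 - s) := by
      have : 0 ≤ 1 - s := by linarith
      positivity
    have h9 : s * (k * Δ) ≤ 1 * (k * Δ) := mul_le_mul_of_nonneg_right hs1 (by positivity)
    rw [h7]
    linarith

/-- The straight-line upper bound on the reliability function. -/
theorem eventually_exp_le_PeCode {e r η : ℝ} (h0 : 0 < e) (h1 : e ^ 2 ≤ 84 / 205)
    (hr1 : jplEntropy e ≤ r) (hr2 : r ≤ critRate e) (hη : 0 < η) :
    ∀ᶠ n : ℕ in atTop, ∀ C : Finset (Fin n → Bool), Real.exp (r * n) ≤ C.card →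
      Real.exp (-(n * (Real.log (1 + e ^ 2) - r + η))) ≤ PeCode n (crossover e) C := by
  have he1 : e < 1 := by nlinarith
  have hp := crossover_pos he1
  have hp1 : crossover e < 1 := by linarith [one_sub_crossover_pos h0]
  have hpq : crossover e ≤ 1 - crossover e := by
    rw [one_sub_crossover, crossover]
    gcongr
    linarith
  have hη4 : 0 < η / 4 := by positivity
  obtain ⟨ε, hε, hlow⟩ := exists_low_rate_bound h0 h1 hη4
  obtain ⟨θ, τ, hθ0, hθ1, hτ0, hτη, hθa, hθb⟩ := exists_block_proportion hr1 hr2 hε hη4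
  obtain ⟨H, hH⟩ : ∃ H, H = jplEntropy e := ⟨_, rfl⟩
  obtain ⟨c, hc⟩ : ∃ c, c = critRate e := ⟨_, rfl⟩
  obtain ⟨X, hX⟩ : ∃ X, X = Real.log (1 + e ^ 2) := ⟨_, rfl⟩
  obtain ⟨b, hb⟩ : ∃ b, b = Real.binEntropy ((1 - e) / 2) := ⟨_, rfl⟩
  have hcross := critRate_add_cutoff h0 he1
  rw [← hc, ← hb, ← hX] at hcross
  have hcb : c = Real.log 2 - b := by rw [hc, hb, critRate]
  have hfl : Tendsto (fun n : ℕ => ⌊θ * n⌋₊) atTop atTop :=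
    tendsto_nat_floor_atTop.comp (Tendsto.const_mul_atTop hθ0 tendsto_natCast_atTop_atTop)
  have hbig : Tendsto (fun n : ℕ => τ * (n : ℝ)) atTop atTop :=
    Tendsto.const_mul_atTop hτ0 tendsto_natCast_atTop_atTop
  have hbig' : Tendsto (fun n : ℕ => η / 4 * (n : ℝ)) atTop atTop :=
    Tendsto.const_mul_atTop hη4 tendsto_natCast_atTop_atTop
  filter_upwards [(tendsto_sub_floor hθ0.le hθ1).eventually hlow,
    hfl.eventually (eventually_exp_le_choose_floor (ω := (1 - e) / 2) (by linarith) (by linarith)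
      hτ0), hbig.eventually_ge_atTop (Real.log 2),
    hbig'.eventually_ge_atTop (Real.log 2 + (c - H))] with n hlow hch hn1 hn2 C hC
  have hn' : (0 : ℝ) ≤ n := n.cast_nonneg
  obtain ⟨n₁, hn₁⟩ : ∃ n₁, n₁ = ⌊θ * n⌋₊ := ⟨_, rfl⟩
  rw [← hn₁] at hlow hch
  have hle : (n₁ : ℝ) ≤ θ * n := by rw [hn₁]; exact Nat.floor_le (by positivity)
  have hge : θ * n ≤ n₁ + 1 := by rw [hn₁]; exact (Nat.lt_floor_add_one _).le
  have hn₁n : n₁ ≤ n := by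
    have : (n₁ : ℝ) ≤ n := hle.trans (by nlinarith)
    exact_mod_cast this
  clear hn₁
  obtain ⟨n₂, rfl⟩ := Nat.exists_eq_add_of_le hn₁n
  rw [Nat.add_sub_cancel_left] at hlow
  obtain ⟨k, hk⟩ : ∃ k, k = ⌊(1 - e) / 2 * n₁⌋₊ := ⟨_, rfl⟩
  have hkρ : (k : ℝ) ≤ (1 - e) / 2 * n₁ := by
    rw [hk]
    have : 0 ≤ 1 - e := by linarith
    exact Nat.floor_le (by positivity)
  have hkn : k ≤ n₁ := by
    have : (k : ℝ) ≤ n₁ := hkρ.trans (by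
      have : (0 : ℝ) ≤ n₁ := n₁.cast_nonneg
      nlinarith)
    exact_mod_cast this
  rw [← hk, ← hb] at hch
  rw [← hH] at hr1 hθa hθb hlow
  rw [← hc] at hr2 hθa hθb
  push_cast at hn1 hn2 hC hle hge hn' ⊢
  have hw := exp_le_pow_mul_pow hp hpq hkn hkρ
  rw [hcross] at hw
  have hne : C.Nonempty := card_pos.1 (by exact_mod_cast (Real.exp_pos _).trans_le hC)
  have hn₁0 : (0 : ℝ) ≤ n₁ := n₁.cast_nonneg
  have hn₂0 : (0 : ℝ) ≤ n₂ := n₂.cast_nonneg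
  have hM : 2 * ((2 : ℝ) ^ n₁ * Real.exp (n₂ * (H - ε))) ≤ C.card * n₁.choose k := by
    refine le_trans ?_ (mul_le_mul hC hch (Real.exp_pos _).le (Nat.cast_nonneg _))
    rw [← Real.exp_add, ← Real.exp_log (show (0 : ℝ) < 2 by norm_num), ← Real.exp_nat_mul,
      ← Real.exp_add, ← Real.exp_add, Real.exp_le_exp]
    have h3 := mul_le_mul_of_nonneg_right hθa hn'
    have h4 : (n₁ : ℝ) * ((c - H) + ε) ≤ θ * (n₁ + n₂) * ((c - H) + ε) :=
      mul_le_mul_of_nonneg_right hle (by linarith)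
    have h5 : 0 ≤ τ * n₂ := by positivity
    rw [hcb] at h3 h4
    linarith
  refine PeCode_ge hne fun dec => ?_
  have hmain := straight_line_bound C
    (fun x => trueSet ((Fin.appendEquiv n₁ n₂).symm x).1)
    (fun x => trueSet ((Fin.appendEquiv n₁ n₂).symm x).2)
    (fun y z => dec (Fin.append (trueSet.symm y) (trueSet.symm z)))
    (K := Real.exp (n₂ * (H - ε))) (E := Real.exp (-(n₂ * (rateGap e + η / 4)))) (k := k)
    hp hp1 (Real.exp_pos _) (Real.exp_pos _).le
    (fun S dec' hS => hlow _ S _ dec' hS) hM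
  have hsum : ∑ x ∈ C, ∑ y with dec y ≠ x, bscProb (n₁ + n₂) (crossover e) x y
      = ∑ x ∈ C, ∑ y, ∑ z with dec (Fin.append (trueSet.symm y) (trueSet.symm z)) ≠ x,
        noiseProb (crossover e) (symmDiff (trueSet ((Fin.appendEquiv n₁ n₂).symm x).1) y)
          * noiseProb (crossover e) (symmDiff (trueSet ((Fin.appendEquiv n₁ n₂).symm x).2) z) :=
    sum_congr rfl fun x _ => sum_bscProb_append _ x fun y => dec y ≠ x
  rw [hsum]
  have hfin : 2 * Real.exp (-((n₁ + n₂) * (X - r + η)))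
      ≤ n₁.choose k * (crossover e ^ k * (1 - crossover e) ^ (n₁ - k))
        * Real.exp (-(n₂ * (rateGap e + η / 4))) := by
    refine le_trans ?_ (mul_le_mul_of_nonneg_right
      (mul_le_mul hch hw (Real.exp_pos _).le (Nat.cast_nonneg _)) (Real.exp_pos _).le)
    rw [← Real.exp_log (show (0 : ℝ) < 2 by norm_num), ← Real.exp_add, ← Real.exp_add,
      ← Real.exp_add, Real.exp_le_exp, rateGap, ← hX, ← hH]
    have h3 := mul_le_mul_of_nonneg_right hθb hn'
    have h4 : θ * (n₁ + n₂) * (c - H) ≤ (n₁ + 1) * (c - H) :=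
      mul_le_mul_of_nonneg_right hge (by linarith)
    have h5 := mul_le_mul_of_nonneg_right hτη hn₁0
    have h6 : 0 ≤ η * n₁ := by positivity
    have h7 : 0 ≤ η * n₂ := by positivity
    linarith
  rw [← hX]
  have h8 := mul_le_mul_of_nonneg_left hfin (Nat.cast_nonneg (α := ℝ) C.card)
  linarith

end StraightLine

section Achievability

variable {n : ℕ}

lemma hammingDist_comm_card_symmDiff (x y : Fin n → Bool) (E : Finset (Fin n)) :
    (symmDiff (trueSet y) (symmDiff (trueSet x) E)).card + E.card
      = hammingDist x y + 2 * (E \ symmDiff (trueSet x) (trueSet y)).card := by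
  rw [hammingDist_eq_card, ← symmDiff_assoc, symmDiff_comm (trueSet y)]
  obtain ⟨D, hD⟩ : ∃ D, D = symmDiff (trueSet x) (trueSet y) := ⟨_, rfl⟩
  rw [← hD]
  have h1 : (symmDiff D E).card = (D \ E).card + (E \ D).card := by
    rw [symmDiff_def, sup_eq_union, card_union_of_disjoint disjoint_sdiff_sdiff]
  have h2 := card_sdiff_add_card_inter D E
  have h3 := card_sdiff_add_card_inter E D
  rw [inter_comm E D] at h3
  omega

/-- The Bhattacharyya bound for the pairwise error probability. -/
lemma sum_bscProb_closer_le {p r : ℝ} (h1 : p < 1) (hr0 : 0 < r) (hr1 : r ≤ 1)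
    (hr : (1 - p) * r ^ 2 = p) (x x' : Fin n → Bool) :
    ∑ y with hammingDist x' y ≤ hammingDist x y, bscProb n p x y
      ≤ (2 * ((1 - p) * r)) ^ hammingDist x x' := by
  have hq : 0 < 1 - p := by linarith
  obtain ⟨D, hD⟩ : ∃ D, D = symmDiff (trueSet x) (trueSet x') := ⟨_, rfl⟩
  have hpt : ∀ y, (if hammingDist x' y ≤ hammingDist x y then bscProb n p x y else 0)
      ≤ (1 - p) ^ n * r ^ (hammingDist x' y + hammingDist x y) := fun y => by
    split_ifs with h
    · rw [bscProb_eq_noiseProb, noiseProb_eq hr, ← hammingDist_eq_card]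
      exact mul_le_mul_of_nonneg_left (pow_le_pow_of_le_one hr0.le hr1 (by omega)) (by positivity)
    · positivity
  rw [sum_filter]
  refine (sum_le_sum fun y _ => hpt y).trans (le_of_eq ?_)
  rw [← mul_sum]
  have hre : ∑ y, r ^ (hammingDist x' y + hammingDist x y)
      = ∑ E : Finset (Fin n), r ^ hammingDist x x' * ∏ a ∈ E, if a ∈ D then 1 else r ^ 2 := by
    refine sum_nbij' (fun y => symmDiff (trueSet x) (trueSet y))
      (fun E => trueSet.symm (symmDiff (trueSet x) E)) (fun _ _ => mem_univ _)
      (fun _ _ => mem_univ _) (fun y _ => by simp) (fun E _ => by simp) fun y _ => ?_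
    have h2 := hammingDist_comm_card_symmDiff x x' (symmDiff (trueSet x) (trueSet y))
    rw [symmDiff_symmDiff_cancel_left, ← hammingDist_eq_card, ← hammingDist_eq_card, ← hD] at h2
    rw [h2, pow_add, pow_mul]
    congr 1
    rw [prod_ite, prod_const_one, one_mul, prod_const]
    congr 2
    ext a
    simp
  rw [hre, ← mul_sum, sum_prod_subset]
  have hprod : ∏ a : Fin n, (1 + if a ∈ D then (1 : ℝ) else r ^ 2)
      = 2 ^ D.card * (1 + r ^ 2) ^ (n - D.card) := by
    have : ∀ a : Fin n, (1 + if a ∈ D then (1 : ℝ) else r ^ 2) = if a ∈ D then 2 else 1 + r ^ 2 :=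
      fun a => by split_ifs <;> norm_num
    simp only [this, prod_ite, prod_const]
    have e1 : univ.filter (fun a => a ∈ D) = D := by ext a; simp
    have e2 : univ.filter (fun a => a ∉ D) = Dᶜ := by ext a; simp
    rw [e1, e2, card_compl, Fintype.card_fin]
  have hDn : D.card ≤ n := by simpa using card_le_univ D
  have hone : (1 - p) * (1 + r ^ 2) = 1 := by rw [mul_add, hr]; ring
  rw [hprod, show hammingDist x x' = D.card by rw [hD, hammingDist_eq_card]]
  calc (1 - p) ^ n * (r ^ D.card * (2 ^ D.card * (1 + r ^ 2) ^ (n - D.card)))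
      = (1 - p) ^ (D.card + (n - D.card))
        * (r ^ D.card * (2 ^ D.card * (1 + r ^ 2) ^ (n - D.card))) := by
        rw [Nat.add_sub_cancel' hDn]
    _ = (2 * ((1 - p) * r)) ^ D.card * ((1 - p) * (1 + r ^ 2)) ^ (n - D.card) := by
        rw [pow_add, mul_pow, mul_pow, mul_pow]
        ring
    _ = _ := by rw [hone, one_pow, mul_one]

lemma bscProb_nonneg {p : ℝ} (h0 : 0 ≤ p) (h1 : p ≤ 1) (x y : Fin n → Bool) :
    0 ≤ bscProb n p x y :=
  mul_nonneg (pow_nonneg h0 _) (pow_nonneg (by linarith) _)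

/-- The union bound for minimum distance decoding. -/
lemma PeCode_le {p r : ℝ} (h0 : 0 ≤ p) (h1 : p < 1) (hr0 : 0 < r) (hr1 : r ≤ 1)
    (hr : (1 - p) * r ^ 2 = p) {C : Finset (Fin n → Bool)} (hC : C.Nonempty) :
    PeCode n p C ≤ (C.card : ℝ)⁻¹ * ∑ x ∈ C, ∑ x' ∈ C with x' ≠ x,
      (2 * ((1 - p) * r)) ^ hammingDist x x' := by
  choose dec hdec hmin using fun y => exists_min_image C (fun x => hammingDist x y) hC
  have hbdd : BddBelow {e : ℝ | ∃ dec : (Fin n → Bool) → (Fin n → Bool), (∀ y, dec y ∈ C) ∧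
      e = (C.card : ℝ)⁻¹ * ∑ x ∈ C,
        ∑ y ∈ Finset.univ.filter (fun y => dec y ≠ x), bscProb n p x y} := by
    refine ⟨0, ?_⟩
    rintro _ ⟨d, -, rfl⟩
    exact mul_nonneg (by positivity) (sum_nonneg fun x _ => sum_nonneg fun y _ =>
      bscProb_nonneg h0 h1.le x y)
  refine (csInf_le hbdd ⟨dec, hdec, rfl⟩).trans
    (mul_le_mul_of_nonneg_left (sum_le_sum fun x _ => ?_) (by positivity))
  calc ∑ y with dec y ≠ x, bscProb n p x y
      ≤ ∑ y, ∑ x' ∈ C with x' ≠ x,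
          if hammingDist x' y ≤ hammingDist x y then bscProb n p x y else 0 := by
        rw [sum_filter]
        refine sum_le_sum fun y _ => ?_
        have hnn : ∀ x' ∈ C.filter (fun x' => x' ≠ x),
            0 ≤ if hammingDist x' y ≤ hammingDist x y then bscProb n p x y else 0 := fun x' _ => by
          split_ifs
          exacts [bscProb_nonneg h0 h1.le x y, le_rfl]
        split_ifs with h
        · by_cases hx : x ∈ C
          · have := single_le_sum hnn (mem_filter.2 ⟨hdec y, h⟩)
            rwa [if_pos (hmin y x hx)] at this
          · contradiction
        · exact sum_nonneg hnn
    _ ≤ _ := by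
        rw [sum_comm]
        refine sum_le_sum fun x' _ => ?_
        rw [← sum_filter]
        exact sum_bscProb_closer_le h1 hr0 hr1 hr x x'

lemma sum_pow_hammingDist (B : ℝ) (x : Fin n → Bool) :
    ∑ z, B ^ hammingDist x z = (1 + B) ^ n := by
  have h := Fintype.sum_pow_mul_eq_add_pow (Fin n) B 1
  simp only [one_pow, mul_one, Fintype.card_fin] at h
  rw [add_comm, ← h]
  refine sum_nbij' (fun y => symmDiff (trueSet x) (trueSet y))
    (fun E => trueSet.symm (symmDiff (trueSet x) E)) (fun _ _ => mem_univ _)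
    (fun _ _ => mem_univ _) (fun y _ => by simp) (fun E _ => by simp) fun y _ => ?_
  rw [hammingDist_eq_card]

/-- Greedy selection of a code with a small Bhattacharyya union bound. -/
lemma exists_code_sum_le {B : ℝ} (hB : 0 ≤ B) (M : ℕ) (hM : 2 * M ≤ 2 ^ n) :
    ∃ C : Finset (Fin n → Bool), C.card = M ∧
      ∑ x ∈ C, ∑ x' ∈ C with x' ≠ x, B ^ hammingDist x x' ≤ 2 * M ^ 2 * ((1 + B) ^ n / 2 ^ n) := by
  induction M with
  | zero => exact ⟨∅, rfl, by simp⟩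
  | succ M ih =>
    obtain ⟨C, hC, hsum⟩ := ih (by omega)
    obtain ⟨W, hW⟩ : ∃ W, W = (1 + B) ^ n / 2 ^ n := ⟨_, rfl⟩
    have hW0 : 0 ≤ W := by rw [hW]; positivity
    have hcompl : 2 ^ n ≤ 2 * Cᶜ.card := by
      rw [card_compl, Fintype.card_fun, Fintype.card_bool, Fintype.card_fin, hC]
      omega
    have hne : Cᶜ.Nonempty := card_pos.1 (by have := Nat.two_pow_pos n; omega)
    have htot : ∑ z ∈ Cᶜ, ∑ x ∈ C, B ^ hammingDist x z ≤ ∑ _z ∈ Cᶜ, 2 * M * W := by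
      calc ∑ z ∈ Cᶜ, ∑ x ∈ C, B ^ hammingDist x z ≤ ∑ z, ∑ x ∈ C, B ^ hammingDist x z :=
            sum_le_sum_of_subset_of_nonneg (subset_univ _) fun z _ _ =>
              sum_nonneg fun x _ => by positivity
        _ = M * (1 + B) ^ n := by
            rw [sum_comm]
            simp only [sum_pow_hammingDist, sum_const, hC, nsmul_eq_mul]
        _ = 2 ^ n * (M * W) := by
            rw [hW]
            field_simp
        _ ≤ (2 * Cᶜ.card : ℝ) * (M * W) := by
            refine mul_le_mul_of_nonneg_right ?_ (by positivity)
            exact_mod_cast hcompl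
        _ = _ := by
            rw [sum_const, nsmul_eq_mul]
            ring
    obtain ⟨z, hz, hzle⟩ := exists_le_of_sum_le hne htot
    have hzC : z ∉ C := mem_compl.1 hz
    refine ⟨insert z C, by rw [card_insert_of_notMem hzC, hC], ?_⟩
    rw [sum_insert hzC]
    have e1 : ∑ x' ∈ insert z C with x' ≠ z, B ^ hammingDist z x'
        = ∑ x ∈ C, B ^ hammingDist x z := by
      rw [filter_insert, if_neg (by simp), filter_true_of_mem]
      · exact sum_congr rfl fun x _ => by rw [hammingDist_comm]
      · rintro x hx rfl
        exact hzC hx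
    have e2 : ∀ x ∈ C, ∑ x' ∈ insert z C with x' ≠ x, B ^ hammingDist x x'
        = B ^ hammingDist x z + ∑ x' ∈ C with x' ≠ x, B ^ hammingDist x x' := fun x hx => by
      rw [filter_insert, if_pos (by rintro rfl; exact hzC hx), sum_insert]
      simp [hzC]
    rw [e1, sum_congr rfl e2, sum_add_distrib, ← hW]
    rw [← hW] at hsum
    push_cast
    linarith

/-- Codes attaining the random coding exponent below the critical rate. -/
theorem exists_PeCode_le {e : ℝ} (h0 : 0 < e) (h1 : e < 1) {M : ℕ} (hM0 : 0 < M)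
    (hM : 2 * M ≤ 2 ^ n) :
    ∃ C : Finset (Fin n → Bool), C.card = M ∧
      PeCode n (crossover e) C ≤ 2 * M / (1 + e ^ 2) ^ n := by
  obtain ⟨C, hC, hsum⟩ := exists_code_sum_le (bhattacharyya_pos h0 h1).le M hM
  refine ⟨C, hC, ?_⟩
  have hle := PeCode_le (n := n) (crossover_pos h1).le (by linarith [one_sub_crossover_pos h0])
    (oddsRoot_pos h0 h1) (oddsRoot_le_one h0) (one_sub_crossover_mul h0)
    (card_pos.1 (by omega : 0 < C.card))
  rw [← bhattacharyya_eq h0] at hle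
  have hM0' : (0 : ℝ) < M := by exact_mod_cast hM0
  rw [hC] at hle
  refine hle.trans ((mul_le_mul_of_nonneg_left hsum (by positivity)).trans (le_of_eq ?_))
  have : 1 + bhattacharyya e = 2 / (1 + e ^ 2) := by
    rw [bhattacharyya]
    field_simp
    ring
  rw [this, div_pow]
  field_simp

end Achievability

section Exponent

/-- The optimal error exponents at block length `n` converge. -/
lemma tendsto_reliability {e R : ℝ} (h0 : 0 < e) (h1 : e ^ 2 ≤ 84 / 205)
    (hr1 : jplEntropy e ≤ R * Real.log 2) (hr2 : R * Real.log 2 ≤ critRate e) :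
    Tendsto (fun n : ℕ => sSup {t : ℝ | ∃ C : Finset (Fin n → Bool),
      (2 : ℝ) ^ (R * n) ≤ (C.card : ℝ) ∧
      t = (n : ℝ)⁻¹ * Real.logb 2 (1 / PeCode n (crossover e) C)}) atTop
      (nhds (Real.log (1 + e ^ 2) / Real.log 2 - R)) := by
  have he1 : e < 1 := by nlinarith
  have hl2 : 0 < Real.log 2 := Real.log_pos one_lt_two
  obtain ⟨X, hX⟩ : ∃ X, X = Real.log (1 + e ^ 2) := ⟨_, rfl⟩
  have hrpow : ∀ n : ℕ, (2 : ℝ) ^ (R * n) = Real.exp (R * Real.log 2 * n) := fun n => by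
    rw [Real.rpow_def_of_pos two_pos]
    ring_nf
  have hupper : ∀ η > 0, ∀ᶠ n : ℕ in atTop, ∀ C : Finset (Fin n → Bool),
      (2 : ℝ) ^ (R * n) ≤ C.card → 0 < PeCode n (crossover e) C ∧
      (n : ℝ)⁻¹ * Real.logb 2 (1 / PeCode n (crossover e) C) ≤ X / Real.log 2 - R + η := by
    intro η hη
    filter_upwards [eventually_exp_le_PeCode h0 h1 hr1 hr2 (mul_pos hη hl2),
      eventually_gt_atTop 0] with n hn hn0 C hC
    rw [hrpow] at hC
    have hn' : (0 : ℝ) < n := by exact_mod_cast hn0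
    have hP := hn C hC
    have hpos := (Real.exp_pos _).trans_le hP
    refine ⟨hpos, ?_⟩
    have h2 := (Real.le_log_iff_exp_le hpos).2 hP
    rw [← hX] at h2
    rw [one_div, Real.logb, Real.log_inv, inv_mul_le_iff₀ hn', div_le_iff₀ hl2]
    calc _ ≤ n * (X - R * Real.log 2 + η * Real.log 2) := by linarith
      _ = _ := by field_simp
  have hR0 : 0 ≤ R * Real.log 2 := by
    refine le_trans ?_ hr1
    have h3 := Real.sqrt_nonneg (1 - (e ^ 2) ^ 2)
    have h4 : Real.sqrt (1 - (e ^ 2) ^ 2) ≤ 1 :=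
      Real.sqrt_le_one.2 (by nlinarith [sq_nonneg (e ^ 2)])
    exact Real.binEntropy_nonneg (by linarith) (by linarith)
  have hR1 : R < 1 := by
    have h5 : 0 < Real.binEntropy ((1 - e) / 2) := Real.binEntropy_pos (by linarith) (by linarith)
    have h6 : R * Real.log 2 < 1 * Real.log 2 := by
      rw [critRate] at hr2
      linarith
    exact lt_of_mul_lt_mul_right h6 hl2.le
  have hlower : ∀ᶠ n : ℕ in atTop, ∃ C : Finset (Fin n → Bool), (2 : ℝ) ^ (R * n) ≤ C.card ∧
      X / Real.log 2 - R - 2 / n ≤ (n : ℝ)⁻¹ * Real.logb 2 (1 / PeCode n (crossover e) C) := by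
    have hbig : Tendsto (fun n : ℕ => (1 - R) * (n : ℝ)) atTop atTop :=
      Tendsto.const_mul_atTop (by linarith) tendsto_natCast_atTop_atTop
    filter_upwards [hupper 1 one_pos, eventually_gt_atTop 0, hbig.eventually_ge_atTop 2]
      with n hup hn0 hn2
    have hn' : (0 : ℝ) < n := by exact_mod_cast hn0
    have hone : (1 : ℝ) ≤ 2 ^ (R * n) := by
      rw [hrpow]
      exact Real.one_le_exp (by positivity)
    have hceil := Nat.le_ceil ((2 : ℝ) ^ (R * n))
    have hceil2 : (⌈(2 : ℝ) ^ (R * n)⌉₊ : ℝ) ≤ 2 * 2 ^ (R * n) := by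
      have := Nat.ceil_lt_add_one (zero_le_one.trans hone)
      linarith
    have h4 : (4 : ℝ) * 2 ^ (R * n) ≤ 2 ^ n := by
      rw [← Real.rpow_natCast 2 n, show (4 : ℝ) = 2 ^ (2 : ℝ) by norm_num,
        ← Real.rpow_add two_pos]
      exact Real.rpow_le_rpow_of_exponent_le one_le_two (by linarith)
    obtain ⟨C, hC, hPe⟩ := exists_PeCode_le (n := n) h0 he1 (M := ⌈(2 : ℝ) ^ (R * n)⌉₊)
      (Nat.ceil_pos.2 (by linarith)) (by
        have : ((2 * ⌈(2 : ℝ) ^ (R * n)⌉₊ : ℕ) : ℝ) ≤ (2 ^ n : ℕ) := by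
          push_cast
          linarith
        exact_mod_cast this)
    rw [← hC] at hceil hceil2 hPe
    refine ⟨C, hceil, ?_⟩
    have hpos := (hup C hceil).1
    have h5 : PeCode n (crossover e) C
        ≤ Real.exp (2 * Real.log 2 + R * Real.log 2 * n - n * X) := by
      refine hPe.trans ?_
      rw [Real.exp_sub, Real.exp_nat_mul, hX, Real.exp_log (by positivity), Real.exp_add,
        two_mul (Real.log 2), Real.exp_add, Real.exp_log two_pos, ← hrpow,
        mul_assoc (2 : ℝ) 2]
      gcongr
    have h6 := (Real.log_le_iff_le_exp hpos).2 h5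
    rw [one_div, Real.logb, Real.log_inv, le_inv_mul_iff₀ hn', le_div_iff₀ hl2]
    calc (n : ℝ) * (X / Real.log 2 - R - 2 / n) * Real.log 2
        = n * X - R * Real.log 2 * n - 2 * Real.log 2 := by field_simp
      _ ≤ _ := by linarith
  rw [← hX]
  refine tendsto_order.2 ⟨fun a ha => ?_, fun a ha => ?_⟩
  · have hlim : Tendsto (fun n : ℕ => X / Real.log 2 - R - 2 / (n : ℝ)) atTop
        (nhds (X / Real.log 2 - R)) := by
      have := tendsto_const_div_atTop_nhds_zero_nat (2 : ℝ)
      simpa using this.const_sub (X / Real.log 2 - R)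
    filter_upwards [hlower, hupper 1 one_pos, hlim.eventually (lt_mem_nhds ha)]
      with n hlow hup han
    obtain ⟨C, hC, hle⟩ := hlow
    refine (han.trans_le hle).trans_le (le_csSup ⟨X / Real.log 2 - R + 1, ?_⟩ ⟨C, hC, rfl⟩)
    rintro _ ⟨C', hC', rfl⟩
    exact (hup C' hC').2
  · filter_upwards [hlower, hupper ((a - (X / Real.log 2 - R)) / 2) (by linarith)]
      with n hlow hup
    obtain ⟨C, hC, -⟩ := hlow
    refine lt_of_le_of_lt (csSup_le ⟨_, C, hC, rfl⟩ ?_)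
      (by linarith : X / Real.log 2 - R + (a - (X / Real.log 2 - R)) / 2 < a)
    rintro _ ⟨C', hC', rfl⟩
    exact (hup C' hC').2

lemma binEnt_eq (x : ℝ) : binEnt x = Real.binEntropy x / Real.log 2 := by
  rw [binEnt, Real.logb, Real.logb, Real.binEntropy_eq_negMulLog_add_negMulLog_one_sub,
    Real.negMulLog, Real.negMulLog]
  ring

lemma exists_crossover_eq {p : ℝ} (h0 : 0 < p) (h1 : p < 1 / 2) :
    ∃ e, 0 < e ∧ e < 1 ∧ crossover e = p ∧ rho0 p = (1 - e) / 2 := by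
  obtain ⟨a, ha⟩ : ∃ a, a = Real.sqrt p := ⟨_, rfl⟩
  obtain ⟨b, hb⟩ : ∃ b, b = Real.sqrt (1 - p) := ⟨_, rfl⟩
  have ha0 : 0 < a := by rw [ha]; exact Real.sqrt_pos.2 h0
  have hab : a < b := by rw [ha, hb]; exact Real.sqrt_lt_sqrt h0.le (by linarith)
  have ha2 : a ^ 2 = p := by rw [ha]; exact Real.sq_sqrt h0.le
  have hb2 : b ^ 2 = 1 - p := by rw [hb]; exact Real.sq_sqrt (by linarith)
  have hs : 0 < a + b := by linarith
  refine ⟨(b - a) / (a + b), div_pos (by linarith) hs, ?_, ?_, ?_⟩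
  · rw [div_lt_one hs]
    linarith
  · have e1 : 1 - (b - a) / (a + b) = 2 * a / (a + b) := by
      field_simp
      ring
    have e2 : 1 + ((b - a) / (a + b)) ^ 2 = 2 / (a + b) ^ 2 := by
      field_simp
      linarith
    rw [crossover, e1, e2, div_pow, mul_pow, ha2]
    field_simp
  · rw [rho0, ← ha, ← hb]
    field_simp
    ring

lemma sq_le_of_crossover_ge {e : ℝ} (h0 : 0 < e) (h1 : e < 1) (h : 0.046 ≤ crossover e)
    (h2 : crossover e < 1 / 2) : e ^ 2 ≤ 84 / 205 := by
  by_contra! hcon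
  have hx : e ^ 2 < 1 := by nlinarith
  have h3 : 4 * (crossover e * (1 - crossover e)) = bhattacharyya e ^ 2 := by
    rw [one_sub_crossover, crossover, bhattacharyya]
    field_simp
    ring
  have h4 : bhattacharyya e < 121 / 289 := by
    rw [bhattacharyya, div_lt_div_iff₀ (by positivity) (by norm_num)]
    linarith
  have h5 := bhattacharyya_pos h0 h1
  nlinarith

lemma R1_eq {e : ℝ} (hρ : rho0 (crossover e) = (1 - e) / 2) :
    R1 (crossover e) = jplEntropy e / Real.log 2 := by
  rw [R1, binEnt_eq, omega0, hρ, ← entropy_close_eq]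
  congr 5 <;> ring

lemma Rcrit_eq {e : ℝ} (hρ : rho0 (crossover e) = (1 - e) / 2) :
    Rcrit (crossover e) = critRate e / Real.log 2 := by
  have hl2 : 0 < Real.log 2 := Real.log_pos one_lt_two
  rw [Rcrit, binEnt_eq, hρ, critRate]
  field_simp

lemma binKL_rho0_eq {e : ℝ} (h0 : 0 < e) (h1 : e < 1)
    (hρ : rho0 (crossover e) = (1 - e) / 2) :
    binKL (rho0 (crossover e)) (crossover e)
      = (Real.log (1 + e ^ 2) - critRate e) / Real.log 2 := by
  have hcross := critRate_add_cutoff h0 h1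
  have hp := crossover_pos h1
  have hq := one_sub_crossover_pos h0
  rw [binKL, hρ, Real.logb, Real.logb, Real.log_div (by linarith) hp.ne',
    Real.log_div (by linarith) hq.ne']
  rw [Real.binEntropy_eq_negMulLog_add_negMulLog_one_sub, Real.negMulLog, Real.negMulLog] at hcross
  rw [mul_div_assoc', mul_div_assoc', ← add_div]
  congr 1
  linarith

end Exponent

/-- **Main theorem**: for `0.046 ≤ p < 1/2` and every rate `R ∈ [R₁, R_crit]`, the
reliability function of the BSC equals the straight-line portion of the random
coding exponent: `E(R,p) = D(ρ₀‖p) + R_crit − R`. -/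
theorem reliability_eq_random_coding_exponent
    (p : ℝ) (hp0 : 0.046 ≤ p) (hp : p < 1 / 2) :
    ∀ R : ℝ, R1 p ≤ R → R ≤ Rcrit p →
      reliability p R = binKL (rho0 p) p + Rcrit p - R := by
  intro R hR1 hR2
  obtain ⟨e, h0, h1, rfl, hρ⟩ := exists_crossover_eq (by linarith) hp
  have hl2 : 0 < Real.log 2 := Real.log_pos one_lt_two
  rw [R1_eq hρ, div_le_iff₀ hl2] at hR1
  rw [Rcrit_eq hρ, le_div_iff₀ hl2] at hR2
  rw [reliability,
    (tendsto_reliability h0 (sq_le_of_crossover_ge h0 h1 hp0 hp) hR1 hR2).limsup_eq,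
    binKL_rho0_eq h0 h1 hρ, Rcrit_eq hρ]
  ring
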